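/- Let D be a 2-strong digraph of order n ≥ 9 with minimum degree at least n−4. If n−1 vertices of D have degree at least n, then D is Hamiltonian. -/

import Mathlib

/-! A digraph on a vertex type `V` is given by its arc relation `A : V → V → Prop`
(this automatically forbids multiple arcs); looplessness is expressed by the
hypothesis `Irreflexive A`. -/

/-- The degree of `x`: its out-degree plus its in-degree. -/
noncomputable def degree {V : Type*} (A : V → V → Prop) (x : V) : ℕ :=
  {y | A x y}.ncard + {y | A y x}.ncard

/-- `degreeIn A x S` is the number of arcs between `x` and vertices of `S`,
in both directions. -/
noncomputable def degreeIn {V : Type*} (A : V → V → Prop) (x : V) (S : Set V) : ℕ :=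
  {y ∈ S | A x y}.ncard + {y ∈ S | A y x}.ncard

/-- `c : Fin m → V` is a directed cycle of length `m` (indices taken mod `m`). -/
def IsCycle {V : Type*} (A : V → V → Prop) {m : ℕ} (c : Fin m → V) : Prop :=
  2 ≤ m ∧ Function.Injective c ∧
    ∀ i : Fin m, A (c i) (c ⟨(i.val + 1) % m, Nat.mod_lt _ i.pos⟩)

/-- `p : Fin m → V` is a directed path on `m` vertices (of length `m - 1`). -/
def IsPath {V : Type*} (A : V → V → Prop) {m : ℕ} (p : Fin m → V) : Prop :=
  Function.Injective p ∧ ∀ (i : Fin m) (h : i.val + 1 < m), A (p i) (p ⟨i.val + 1, h⟩)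

/-- A digraph is Hamiltonian if it has a directed cycle through all of its vertices. -/
def IsHamiltonian {V : Type*} [Fintype V] (A : V → V → Prop) : Prop :=
  ∃ c : Fin (Fintype.card V) → V, IsCycle A c ∧ Function.Surjective c

/-- Reachability by a directed path staying inside the set `S`. -/
def ReachIn {V : Type*} (A : V → V → Prop) (S : Set V) : V → V → Prop :=
  Relation.ReflTransGen (fun u v => u ∈ S ∧ v ∈ S ∧ A u v)

/-- A digraph is strong if every vertex is reachable from every other by a directed path. -/
def IsStrong {V : Type*} (A : V → V → Prop) : Prop :=
  ∀ x y : V, Relation.ReflTransGen A x y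

/-- A digraph is `k`-strong if it has at least `k + 1` vertices and the deletion of
any set of at most `k - 1` vertices leaves a strong digraph. -/
def IsKStrong {V : Type*} [Fintype V] (A : V → V → Prop) (k : ℕ) : Prop :=
  k + 1 ≤ Fintype.card V ∧
    ∀ S : Set V, S.ncard ≤ k - 1 → ∀ x ∈ Sᶜ, ∀ y ∈ Sᶜ, ReachIn A Sᶜ x y

/-- `Walk A x y L`: the list `L` is the vertex sequence of a directed walk from `x` to `y`. -/
inductive Walk {V : Type*} (A : V → V → Prop) : V → V → List V → Prop
  | single (x : V) : Walk A x x [x]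
  | cons {x y z : V} {L : List V} : A x y → Walk A y z L → Walk A x z (x :: L)

namespace Walk

variable {V W : Type*} {A : V → V → Prop}

theorem ne_nil {x y : V} {L : List V} (h : Walk A x y L) : L ≠ [] := by
  cases h <;> simp

theorem start_mem {x y : V} {L : List V} (h : Walk A x y L) : x ∈ L := by
  cases h <;> simp

theorem end_mem {x y : V} {L : List V} (h : Walk A x y L) : y ∈ L := by
  induction h with
  | single x => simp
  | cons _ _ ih => exact List.mem_cons_of_mem _ ih

theorem append {x y u v : V} {L M : List V} (h : Walk A x y L) (hyu : A y u)
    (h' : Walk A u v M) : Walk A x v (L ++ M) := by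
  induction h with
  | single x => exact cons hyu h'
  | cons ha _ ih => exact cons ha (ih hyu)

theorem split {x y w : V} {L₁ L₂ : List V} (h : Walk A x y (L₁ ++ w :: L₂)) :
    Walk A x w (L₁ ++ [w]) ∧ Walk A w y (w :: L₂) := by
  induction L₁ generalizing x with
  | nil =>
    cases h with
    | single => exact ⟨single _, single _⟩
    | cons ha h => exact ⟨single _, cons ha h⟩
  | cons a L₁ ih =>
    rw [List.cons_append] at h
    generalize hM : L₁ ++ w :: L₂ = M at h ih
    cases h with
    | single => simp at hM
    | cons ha h =>
      obtain ⟨h₁, h₂⟩ := ih h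
      exact ⟨cons ha h₁, h₂⟩

/-- Cutting a walk along an arc. -/
theorem cut {x y a b : V} {L₁ L₂ : List V} (h : Walk A x y (L₁ ++ a :: b :: L₂)) :
    Walk A x a (L₁ ++ [a]) ∧ A a b ∧ Walk A b y (b :: L₂) := by
  obtain ⟨h₁, h₂⟩ := h.split
  cases h₂ with
  | cons ha h₂ =>
    cases h₂ with
    | single => exact ⟨h₁, ha, single _⟩
    | cons hb h₂ => exact ⟨h₁, ha, cons hb h₂⟩

theorem insert {x y a b v : V} {L₁ L₂ : List V} (h : Walk A x y (L₁ ++ a :: b :: L₂))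
    (hav : A a v) (hvb : A v b) : Walk A x y (L₁ ++ a :: v :: b :: L₂) := by
  obtain ⟨h₁, -, h₂⟩ := h.cut
  have := h₁.append hav (cons hvb h₂)
  simpa using this

theorem map {B : W → W → Prop} (f : W → V) (hf : ∀ i j, B i j → A (f i) (f j)) {x y : W}
    {L : List W} (h : Walk B x y L) : Walk A (f x) (f y) (L.map f) := by
  induction h with
  | single x => exact single _
  | cons ha _ ih => exact cons (hf _ _ ha) ih

theorem reverse {x y : V} {L : List V} (h : Walk A x y L) :
    Walk (fun u v => A v u) y x L.reverse := by
  induction h with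
  | single x => exact single _
  | cons ha _ ih =>
    rw [List.reverse_cons]
    exact ih.append ha (single _)

/-- Prefix of a walk, as a walk to a given vertex. -/
theorem exists_eq_append {x y w : V} {L : List V} (h : Walk A x y L) (hw : w ∈ L) :
    ∃ L₁ L₂, L = L₁ ++ w :: L₂ ∧ Walk A x w (L₁ ++ [w]) ∧ Walk A w y (w :: L₂) := by
  obtain ⟨L₁, L₂, rfl⟩ := List.append_of_mem hw
  exact ⟨L₁, L₂, rfl, h.split⟩

/-- Splitting a walk of at least two vertices after a given non-final vertex. -/
theorem tail {x y : V} {L : List V} (h : Walk A x y (x :: L)) :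
    L = [] ∧ x = y ∨ ∃ u, A x u ∧ Walk A u y L := by
  cases h with
  | single => exact Or.inl ⟨rfl, rfl⟩
  | cons ha h => exact Or.inr ⟨_, ha, h⟩

end Walk

section Degrees

variable {V : Type*} (A : V → V → Prop)

open Classical in
/-- The number of arcs between `u` and `v`. -/
noncomputable def arcs (u v : V) : ℕ :=
  (if A u v then 1 else 0) + (if A v u then 1 else 0)

/-- The number of arcs between `v` and the vertices of `S`. -/
noncomputable def degOn (v : V) (S : Finset V) : ℕ := ∑ u ∈ S, arcs A v u

variable {A}

theorem arcs_le_two (u v : V) : arcs A u v ≤ 2 := by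
  unfold arcs; split_ifs <;> omega

theorem arcs_self (h : ∀ u, ¬ A u u) (u : V) : arcs A u u = 0 := by
  simp [arcs, h u]

theorem arcs_eq_zero {u v : V} : arcs A u v = 0 ↔ ¬ A u v ∧ ¬ A v u := by
  unfold arcs; split_ifs <;> simp_all

theorem arcs_comm (u v : V) : arcs A u v = arcs A v u := by
  unfold arcs; omega

theorem arcs_swap (u v : V) : arcs (fun a b => A b a) u v = arcs A u v := by
  simp only [arcs]; omega

theorem degOn_swap (v : V) (S : Finset V) : degOn (fun a b => A b a) v S = degOn A v S := by
  simp [degOn, arcs_swap]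

theorem degOn_union [DecidableEq V] {v : V} {S T : Finset V} (h : Disjoint S T) :
    degOn A v (S ∪ T) = degOn A v S + degOn A v T := Finset.sum_union h

theorem degOn_le_two_mul (v : V) (S : Finset V) : degOn A v S ≤ 2 * S.card := by
  unfold degOn
  calc _ ≤ ∑ _u ∈ S, 2 := Finset.sum_le_sum fun _ _ => arcs_le_two _ _
    _ = _ := by simp [mul_comm]

theorem degOn_eq_zero {v : V} {S : Finset V} (h : ∀ u ∈ S, ¬ A v u ∧ ¬ A u v) :
    degOn A v S = 0 :=
  Finset.sum_eq_zero fun u hu => arcs_eq_zero.2 (h u hu)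

open Classical in
theorem degOn_eq_card (v : V) (S : Finset V) :
    degOn A v S = (S.filter fun u => A v u).card + (S.filter fun u => A u v).card := by
  simp [degOn, arcs, Finset.sum_add_distrib]

theorem degree_eq_degOn [Fintype V] (v : V) : degree A v = degOn A v Finset.univ := by
  classical
  rw [degOn_eq_card, degree, Set.ncard_eq_toFinset_card', Set.ncard_eq_toFinset_card']
  simp

theorem degOn_image {W : Type*} [DecidableEq V] (f : W → V) (v : W) (S : Finset W)
    (hf : Set.InjOn f S) :
    degOn A (f v) (S.image f) = degOn (fun i j => A (f i) (f j)) v S := by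
  unfold degOn
  rw [Finset.sum_image hf]
  rfl

/-- A vertex with many arcs to a path can be inserted between two consecutive vertices. -/
theorem exists_insertion [DecidableEq V] {v : V} {L : List V} (hL : L.Nodup)
    (hd : L.length + 2 ≤ degOn A v L.toFinset) :
    ∃ L₁ a b L₂, L = L₁ ++ a :: b :: L₂ ∧ A a v ∧ A v b := by
  classical
  by_contra hno
  have key : ∀ (a : V) (M : List V), (a :: M).Nodup →
      (¬ ∃ L₁ c b L₂, a :: M = L₁ ++ c :: b :: L₂ ∧ A c v ∧ A v b) →
      degOn A v (a :: M).toFinset ≤ (a :: M).length + (if A v a then 1 else 0) := by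
    intro a M
    induction M generalizing a with
    | nil =>
      intro _ _
      simp only [List.toFinset_cons, List.toFinset_nil, degOn, arcs]
      simp
      split_ifs <;> omega
    | cons b M ih =>
      intro hnd hn
      have h1 := ih b hnd.of_cons (by
        rintro ⟨L₁, c, d, L₂, h, h'⟩
        exact hn ⟨a :: L₁, c, d, L₂, by simp [h], h'⟩)
      have h2 : ¬ (A a v ∧ A v b) := fun h => hn ⟨[], a, b, M, rfl, h⟩
      have h3 : a ∉ (b :: M).toFinset := by simpa using (List.nodup_cons.1 hnd).1
      rw [List.toFinset_cons, degOn, Finset.sum_insert h3]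
      change arcs A v a + degOn A v (b :: M).toFinset ≤ _
      simp only [List.length_cons, arcs] at *
      split_ifs at * <;> first | omega | (exfalso; tauto)
  cases L with
  | nil => simp [degOn] at hd
  | cons a M =>
    have := key a M hL hno
    split_ifs at this <;> omega

/-- The counting lemma behind the Bondy–Thomassen argument: under a degree sum condition, all of
`T` can be inserted into the path `L`. -/
theorem exists_walk_union [DecidableEq V] (hirr : ∀ u, ¬ A u u) (U : Finset V) {a b : V}
    {L : List V} (hw : Walk A a b L) (hnd : L.Nodup) (hLU : L.toFinset ⊆ U) {T : Finset V}
    (hTU : T ⊆ U) (hLT : Disjoint L.toFinset T) {x : V} (hxU : x ∈ U) (hxL : x ∉ L)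
    (hxT : x ∉ T) (hxT0 : ∀ t ∈ T, arcs A x t = 0)
    (hW : ∀ w ∈ U, w ∉ L → w ∉ T → w ≠ x → ∀ t ∈ T, arcs A x w + arcs A t w ≤ 2)
    (hx : degOn A x L.toFinset ≤ L.length + 1)
    (hsum : ∀ t ∈ T, 2 * U.card ≤ degOn A x U + degOn A t U) :
    ∃ L', Walk A a b L' ∧ L'.Nodup ∧ L'.toFinset = L.toFinset ∪ T := by
  classical
  have main : ∀ k, k ≤ T.card → ∃ T' ⊆ T, T'.card = k ∧
      ∃ L', Walk A a b L' ∧ L'.Nodup ∧ L'.toFinset = L.toFinset ∪ T' := by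
    intro k
    induction k with
    | zero => intro _; exact ⟨∅, by simp, rfl, L, hw, hnd, by simp⟩
    | succ k ih =>
      intro hk
      obtain ⟨T', hT', hc, L', hw', hnd', hL'⟩ := ih (by omega)
      obtain ⟨t, htT, ht⟩ : ∃ t ∈ T, t ∉ T' := by
        by_contra! h
        have := Finset.card_le_card (show T ⊆ T' from h)
        omega
      have hcL : L.toFinset.card = L.length := List.toFinset_card_of_nodup hnd
      have hlen : L'.length = L.length + k := by
        rw [← List.toFinset_card_of_nodup hnd', hL',
          Finset.card_union_of_disjoint (hLT.mono_right hT'), hcL, hc]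
      have htL : t ∉ L := fun h =>
        Finset.disjoint_left.1 hLT (List.mem_toFinset.2 h) htT
      have hdeg : L'.length + 2 ≤ degOn A t L'.toFinset := by
        set X := U \ (L.toFinset ∪ T ∪ {x}) with hX
        have hsubU : L.toFinset ∪ T ∪ {x} ⊆ U :=
          Finset.union_subset (Finset.union_subset hLU hTU) (by simpa using hxU)
        have hUeq : U = (L.toFinset ∪ T ∪ {x}) ∪ X := by
          rw [hX, Finset.union_sdiff_of_subset hsubU]
        have hd3 : Disjoint (L.toFinset ∪ T ∪ {x}) X := Finset.disjoint_sdiff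
        have hd2 : Disjoint (L.toFinset ∪ T) {x} := by simp [hxL, hxT]
        have e : ∀ v, degOn A v U
            = degOn A v L.toFinset + degOn A v T + arcs A v x + degOn A v X := by
          intro v
          conv_lhs => rw [hUeq]
          rw [degOn_union hd3, degOn_union hd2, degOn_union hLT]
          simp [degOn]
        have hcU : U.card = L.length + T.card + 1 + X.card := by
          conv_lhs => rw [hUeq]
          rw [Finset.card_union_of_disjoint hd3, Finset.card_union_of_disjoint hd2,
            Finset.card_union_of_disjoint hLT, hcL]
          simp
        have hxT' : degOn A x T = 0 := Finset.sum_eq_zero hxT0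
        have htx : arcs A t x = 0 := by rw [arcs_comm]; exact hxT0 t htT
        have hXs : degOn A x X + degOn A t X ≤ 2 * X.card := by
          unfold degOn
          rw [← Finset.sum_add_distrib]
          calc _ ≤ ∑ _u ∈ X, 2 := Finset.sum_le_sum fun w hwX => by
                simp only [hX, Finset.mem_sdiff, Finset.mem_union, Finset.mem_singleton,
                  List.mem_toFinset, not_or] at hwX
                exact hW w hwX.1 hwX.2.1.1 hwX.2.1.2 hwX.2.2 t htT
            _ = _ := by simp [mul_comm]
        have htT2 : degOn A t T + 2 ≤ degOn A t T' + 2 * (T.card - k) := by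
          have h1 : T = T' ∪ ({t} ∪ (T \ T').erase t) := by
            ext y; simp; grind
          have h2 : Disjoint T' ({t} ∪ (T \ T').erase t) := by
            rw [Finset.disjoint_left]; intro y; simp; grind
          have h3 : Disjoint {t} ((T \ T').erase t) := by simp
          have h4 : degOn A t T = degOn A t T' + degOn A t ((T \ T').erase t) := by
            conv_lhs => rw [h1]
            rw [degOn_union h2, degOn_union h3]
            simp [degOn, arcs_self hirr]
          have h5 := degOn_le_two_mul (A := A) t ((T \ T').erase t)
          have h6 : ((T \ T').erase t).card = T.card - k - 1 := by
            rw [Finset.card_erase_of_mem (by simp [htT, ht]), Finset.card_sdiff_of_subset hT', hc]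
          omega
        have := hsum t htT
        rw [e x, e t, arcs_self hirr x] at this
        rw [hL', degOn_union (hLT.mono_right hT')]
        omega
      obtain ⟨L₁, c, d, L₂, rfl, h1, h2⟩ := exists_insertion hnd' hdeg
      have htL' : t ∉ (L₁ ++ c :: d :: L₂).toFinset := by
        rw [hL']; simp [htL, ht]
      refine ⟨Insert.insert t T', ?_, ?_, _, hw'.insert h1 h2, ?_, ?_⟩
      · exact Finset.insert_subset htT hT'
      · rw [Finset.card_insert_of_notMem ht, hc]
      · have : (L₁ ++ c :: t :: d :: L₂).Perm (t :: (L₁ ++ c :: d :: L₂)) := by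
          have := List.perm_middle (a := t) (l₁ := L₁ ++ [c]) (l₂ := d :: L₂)
          simpa using this
        rw [this.nodup_iff, List.nodup_cons]
        exact ⟨fun h => htL' (List.mem_toFinset.2 h), hnd'⟩
      · rw [Finset.union_insert, ← hL']
        ext y; simp; tauto
  obtain ⟨T', hT', hc, h⟩ := main T.card le_rfl
  rwa [Finset.eq_of_subset_of_card_le hT' hc.ge] at h

end Degrees

section Reach

variable {V : Type*} {A : V → V → Prop}

/-- Reachability inside `S` is witnessed by a walk without repeated vertices. -/
theorem ReachIn.exists_walk {S : Set V} {x y : V} (h : ReachIn A S x y) (hx : x ∈ S) :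
    ∃ L : List V, Walk A x y L ∧ L.Nodup ∧ ∀ v ∈ L, v ∈ S := by
  induction h using Relation.ReflTransGen.head_induction_on with
  | refl => exact ⟨[y], .single y, by simp, by simpa⟩
  | @head a c hac _ ih =>
    obtain ⟨L, hw, hnd, hS⟩ := ih hac.2.1
    by_cases ha : a ∈ L
    · obtain ⟨L₁, L₂, rfl, -, h₂⟩ := hw.exists_eq_append ha
      exact ⟨a :: L₂, h₂, (List.nodup_append.1 hnd).2.1,
        fun v hv => hS v (List.mem_append_right _ hv)⟩
    · refine ⟨a :: L, .cons hac.2.2 hw, List.nodup_cons.2 ⟨ha, hnd⟩, ?_⟩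
      simpa [hx] using hS

/-- A path leaving `X` leaves it along some arc. -/
theorem ReachIn.exists_exit {S X : Set V} {x y : V} (h : ReachIn A S x y) (hx : x ∈ X)
    (hy : y ∉ X) :
    ∃ u v, ReachIn A (S ∩ X) x u ∧ u ∈ X ∧ v ∉ X ∧ u ∈ S ∧ v ∈ S ∧ A u v := by
  have key : (y ∈ X ∧ ReachIn A (S ∩ X) x y) ∨
      ∃ u v, ReachIn A (S ∩ X) x u ∧ u ∈ X ∧ v ∉ X ∧ u ∈ S ∧ v ∈ S ∧ A u v := by
    clear hy
    induction h with
    | refl => exact Or.inl ⟨hx, .refl⟩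
    | @tail b c _ hbc ih =>
      rcases ih with ⟨hb, ih⟩ | ih
      · by_cases hc : c ∈ X
        · exact Or.inl ⟨hc, ih.tail ⟨⟨hbc.1, hb⟩, ⟨hbc.2.1, hc⟩, hbc.2.2⟩⟩
        · exact Or.inr ⟨b, c, ih, hb, hc, hbc⟩
      · exact Or.inr ih
  exact key.resolve_left fun h => hy h.1

theorem ReachIn.swap {S : Set V} {x y : V} (h : ReachIn A S x y) :
    ReachIn (fun u v => A v u) S y x := by
  induction h with
  | refl => exact .refl
  | tail _ hbc ih => exact Relation.ReflTransGen.head ⟨hbc.2.1, hbc.1, hbc.2.2⟩ ih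

theorem ReachIn.trans {S : Set V} {x y w : V} (h : ReachIn A S x y) (h' : ReachIn A S y w) :
    ReachIn A S x w :=
  Relation.ReflTransGen.trans h h'

theorem ReachIn.mono {S T : Set V} {x y : V} (h : ReachIn A S x y) (hST : S ⊆ T) :
    ReachIn A T x y :=
  Relation.ReflTransGen.mono (fun _ _ h => ⟨hST h.1, hST h.2.1, h.2.2⟩) _ _ h

end Reach

section Cycles

variable {V : Type*} {A : V → V → Prop}

/-- `ClosedWalk A L`: `L` lists the vertices of a directed cycle. -/
def ClosedWalk (A : V → V → Prop) (L : List V) : Prop :=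
  L.Nodup ∧ ∃ x y, Walk A x y L ∧ A y x

theorem ClosedWalk.map {W : Type*} {B : W → W → Prop} {f : W → V}
    (hf : ∀ i j, B i j → A (f i) (f j)) {L : List W} (h : ClosedWalk B L)
    (hinj : ∀ i ∈ L, ∀ j ∈ L, f i = f j → i = j) : ClosedWalk A (L.map f) := by
  obtain ⟨hnd, x, y, hw, ha⟩ := h
  exact ⟨hnd.map_on fun i hi j hj h => hinj i hi j hj h, f x, f y, hw.map f hf, hf _ _ ha⟩

theorem ClosedWalk.reverse {L : List V} (h : ClosedWalk A L) :
    ClosedWalk (fun u v => A v u) L.reverse := by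
  obtain ⟨hnd, x, y, hw, ha⟩ := h
  exact ⟨List.nodup_reverse.2 hnd, y, x, hw.reverse, ha⟩

/-- A walk `Q` outside the cycle `T ++ L`, leading from the end of `L` to its start, yields a cycle
with a strictly larger vertex set. -/
theorem exists_cycle_of_bypass [DecidableEq V] (hirr : ∀ u, ¬ A u u) (U : Finset V) {k : ℕ} :
    ∀ {T L Q : List V} {a b c d : V}, T.length = k → Walk A b a L →
      Walk A a b (a :: (T ++ [b])) → Walk A c d Q → A a c → A d b →
      (T ++ L).Nodup → Q.Nodup → (∀ q ∈ Q, q ∉ T ++ L) → (∀ v ∈ T ++ L, v ∈ U) →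
      (∀ q ∈ Q, q ∈ U) →
      (∀ x ∈ U, x ∉ T ++ L → ∀ t ∈ T, 2 * U.card ≤ degOn A x U + degOn A t U) →
      ∃ M, ClosedWalk A M ∧ (∀ v ∈ M, v ∈ U) ∧ (∀ v ∈ T ++ L, v ∈ M) ∧
        ∃ v ∈ M, v ∉ T ++ L := by
  induction k using Nat.strong_induction_on with
  | _ k ih =>
  intro T L Q a b c d hk hL hT hQ hac hdb hnd hndQ hQK hU hQU hsum
  have hndT : T.Nodup := (List.nodup_append.1 hnd).1
  have hndL : L.Nodup := (List.nodup_append.1 hnd).2.1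
  have hTL : ∀ v ∈ T, v ∉ L := fun v h1 h2 => (List.nodup_append.1 hnd).2.2 v h1 v h2 rfl
  have hcQ := hQ.start_mem
  -- shortening the skipped segment, keeping its first part
  have first : ∀ {T₁ T₂ Q' : List V} {t c' d' : V}, T = T₁ ++ t :: T₂ → Walk A c' d' Q' →
      A a c' → A d' t → Q'.Nodup → (∀ q ∈ Q', q ∉ T ++ L) → (∀ q ∈ Q', q ∈ U) →
      ∃ M, ClosedWalk A M ∧ (∀ v ∈ M, v ∈ U) ∧ (∀ v ∈ T ++ L, v ∈ M) ∧
        ∃ v ∈ M, v ∉ T ++ L := by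
    intro T₁ T₂ Q' t c' d' hTe hQ' h1 h2 h3 h4 h5
    subst hTe
    have hT' : Walk A a b ((a :: T₁) ++ t :: (T₂ ++ [b])) := by simpa using hT
    obtain ⟨w1, w2⟩ := hT'.split
    have w3 : Walk A t a ((t :: T₂) ++ L) := by
      have : Walk A t b ((t :: T₂) ++ [b]) := by simpa using w2
      cases L with
      | nil => exact absurd rfl hL.ne_nil
      | cons b' L =>
        have hbb : b' = b := by cases hL <;> rfl
        subst hbb
        rcases hL.tail with ⟨rfl, rfl⟩ | ⟨u, hu, hw⟩
        · exact this
        · simpa using this.append hu hw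
    have := ih T₁.length (by simp at hk; omega) (T := T₁) (L := t :: T₂ ++ L) rfl w3
      (by simpa using w1) hQ' h1 h2 (by simpa using hnd) h3 (by simpa using h4)
      (by simpa using hU) h5
      (fun x hx hxK t ht => hsum x hx (by simpa using hxK) t (by simp [ht]))
    simpa using this
  have last : ∀ {T₁ T₂ Q' : List V} {t c' d' : V}, T = T₁ ++ t :: T₂ → Walk A c' d' Q' →
      A t c' → A d' b → Q'.Nodup → (∀ q ∈ Q', q ∉ T ++ L) → (∀ q ∈ Q', q ∈ U) →
      ∃ M, ClosedWalk A M ∧ (∀ v ∈ M, v ∈ U) ∧ (∀ v ∈ T ++ L, v ∈ M) ∧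
        ∃ v ∈ M, v ∉ T ++ L := by
    intro T₁ T₂ Q' t c' d' hTe hQ' h1 h2 h3 h4 h5
    subst hTe
    have hT' : Walk A a b ((a :: T₁) ++ t :: (T₂ ++ [b])) := by simpa using hT
    obtain ⟨w1, w2⟩ := hT'.split
    have w3 : Walk A b t (L ++ (T₁ ++ [t])) := by
      rw [List.cons_append] at w1
      rcases w1.tail with ⟨h, -⟩ | ⟨u, hu, hw⟩
      · simp at h
      · exact hL.append hu hw
    have hperm : (T₂ ++ (L ++ (T₁ ++ [t]))).Perm (T₁ ++ t :: T₂ ++ L) := by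
      rw [List.perm_iff_count]; intro v; simp [List.count_cons]; omega
    have hmem : ∀ v, v ∈ T₂ ++ (L ++ (T₁ ++ [t])) ↔ v ∈ T₁ ++ t :: T₂ ++ L :=
      fun v => hperm.mem_iff
    have := ih T₂.length (by simp at hk; omega) (T := T₂) (L := L ++ (T₁ ++ [t])) rfl w3
      (by simpa using w2) hQ' h1 h2 (hperm.nodup_iff.2 hnd) h3 (by simpa only [hmem] using h4)
      (by simpa only [hmem] using hU) h5
      (fun x hx hxK t ht => hsum x hx (by simpa only [hmem] using hxK) t (by simp [ht]))
    simpa only [hmem] using this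
  by_cases hT0 : T = []
  · subst hT0
    refine ⟨L ++ Q, ⟨?_, b, d, hL.append hac hQ, hdb⟩, ?_, ?_, c, by simp [hcQ], hQK c hcQ⟩
    · rw [List.nodup_append]
      exact ⟨hndL, hndQ, fun u hu v hv h => hQK v hv (by simpa [← h] using hu)⟩
    · intro v hv
      rcases List.mem_append.1 hv with h | h
      · exact hU v (by simpa using h)
      · exact hQU v h
    · intro v hv
      exact List.mem_append_left _ (by simpa using hv)
  by_cases hins : L.length + 2 ≤ degOn A c L.toFinset
  · obtain ⟨L₁, p, q, L₂, rfl, h1, h2⟩ := exists_insertion hndL hins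
    have hw := hL.insert h1 h2
    rcases hT.tail with ⟨h, -⟩ | ⟨u, hu, hw'⟩
    · simp at h
    have hw2 : ∃ e, Walk A u e T ∧ A e b := by
      obtain ⟨T', e, rfl⟩ := T.eq_nil_or_concat.resolve_left hT0
      rw [List.concat_eq_append, List.append_assoc] at hw'
      obtain ⟨h1, h2, -⟩ := Walk.cut (L₂ := []) hw'
      exact ⟨e, by simpa using h1, h2⟩
    obtain ⟨e, hw2, heb⟩ := hw2
    have hperm : ((L₁ ++ p :: c :: q :: L₂) ++ T).Perm (c :: (T ++ (L₁ ++ p :: q :: L₂))) := by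
      rw [List.perm_iff_count]; intro v; simp [List.count_cons]; omega
    refine ⟨(L₁ ++ p :: c :: q :: L₂) ++ T, ⟨?_, b, e, hw.append hu hw2, heb⟩, ?_, ?_, c, ?_,
      hQK c hcQ⟩
    · exact hperm.nodup_iff.2 (List.nodup_cons.2 ⟨hQK c hcQ, hnd⟩)
    · intro v hv
      rcases List.mem_cons.1 (hperm.mem_iff.1 hv) with rfl | h
      · exact hQU _ hcQ
      · exact hU v h
    · intro v hv
      exact hperm.mem_iff.2 (List.mem_cons_of_mem _ hv)
    · exact hperm.mem_iff.2 (by simp)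
  by_cases hct : ∃ t ∈ T, A c t
  · obtain ⟨t, ht, h⟩ := hct
    obtain ⟨T₁, T₂, hTe⟩ := List.append_of_mem ht
    exact first hTe (.single c) hac h (by simp) (by simpa using hQK c hcQ)
      (by simpa using hQU c hcQ)
  by_cases htc : ∃ t ∈ T, A t c
  · obtain ⟨t, ht, h⟩ := htc
    obtain ⟨T₁, T₂, hTe⟩ := List.append_of_mem ht
    exact last hTe hQ h hdb hndQ hQK hQU
  by_cases hcw : ∃ w ∈ U, w ∉ L ∧ w ∉ T ∧ w ≠ c ∧ ∃ t ∈ T, A c w ∧ A w t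
  · obtain ⟨w, hwU, hwL, hwT, hwc, t, ht, h1, h2⟩ := hcw
    obtain ⟨T₁, T₂, hTe⟩ := List.append_of_mem ht
    refine first hTe (.cons h1 (.single w)) hac h2 (by simpa using hwc.symm) ?_ ?_
    · intro q hq
      rcases List.mem_cons.1 hq with rfl | hq
      · exact hQK q hcQ
      · rw [List.mem_singleton] at hq
        simp [hq, hwL, hwT]
    · intro q hq
      rcases List.mem_cons.1 hq with rfl | hq
      · exact hQU q hcQ
      · rw [List.mem_singleton] at hq
        exact hq ▸ hwU
  by_cases hwc : ∃ w ∈ U, w ∉ L ∧ w ∉ T ∧ w ≠ c ∧ ∃ t ∈ T, A t w ∧ A w c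
  · obtain ⟨w, hwU, hwL, hwT, -, t, ht, h1, h2⟩ := hwc
    obtain ⟨T₁, T₂, hTe⟩ := List.append_of_mem ht
    by_cases hwQ : w ∈ Q
    · obtain ⟨Q₁, Q₂, rfl, -, h3⟩ := hQ.exists_eq_append hwQ
      exact last hTe h3 h1 hdb (List.nodup_append.1 hndQ).2.1
        (fun q hq => hQK q (List.mem_append_right _ hq))
        (fun q hq => hQU q (List.mem_append_right _ hq))
    · refine last hTe (.cons h2 hQ) h1 hdb (List.nodup_cons.2 ⟨hwQ, hndQ⟩) ?_ ?_
      · intro q hq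
        rcases List.mem_cons.1 hq with rfl | hq
        · simp [hwL, hwT]
        · exact hQK q hq
      · intro q hq
        rcases List.mem_cons.1 hq with rfl | hq
        · exact hwU
        · exact hQU q hq
  have hcK := hQK c hcQ
  simp only [List.mem_append, not_or] at hcK
  push Not at hct htc hcw hwc
  obtain ⟨L', hw', hnd', hL'⟩ := exists_walk_union hirr U hL hndL
    (fun v hv => hU v (by simpa using Or.inr (List.mem_toFinset.1 hv))) (T := T.toFinset)
    (fun v hv => hU v (by simpa using Or.inl (List.mem_toFinset.1 hv)))
    (Finset.disjoint_left.2 fun v h1 h2 => hTL v (List.mem_toFinset.1 h2) (List.mem_toFinset.1 h1))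
    (hQU c hcQ) hcK.2 (by simpa using hcK.1)
    (fun t ht => arcs_eq_zero.2 ⟨hct t (by simpa using ht), htc t (by simpa using ht)⟩)
    (fun w hwU hwL hwT hwc' t ht => by
      have h1 := hcw w hwU hwL (by simpa using hwT) hwc' t (by simpa using ht)
      have h2 := hwc w hwU hwL (by simpa using hwT) hwc' t (by simpa using ht)
      unfold arcs
      split_ifs <;> first | omega | tauto)
    (by omega)
    (fun t ht => hsum c (hQU c hcQ) (by simp [hcK]) t
      (List.mem_toFinset.1 ht))
  have hmem : ∀ v, v ∈ L' ↔ v ∈ T ++ L := by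
    intro v
    rw [← List.mem_toFinset, hL']
    simp [or_comm]
  refine ⟨L' ++ Q, ⟨?_, b, d, hw'.append hac hQ, hdb⟩, ?_, ?_, c, by simp [hcQ], hQK c hcQ⟩
  · rw [List.nodup_append]
    exact ⟨hnd', hndQ, fun u hu v hv h => hQK v hv ((hmem v).1 (h ▸ hu))⟩
  · intro v hv
    rcases List.mem_append.1 hv with h | h
    · exact hU v ((hmem v).1 h)
    · exact hQU v h
  · intro v hv
    exact List.mem_append_left _ ((hmem v).2 hv)

end Cycles

section Counting

open Classical in
/-- Every `k ∈ [1, s + 1]` accounts for at most one of `k ∈ O` and `k - 1 ∈ I`, and elements of `M`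
account for none. -/
theorem card_filter_add_le (O I : ℕ → Prop) (s : ℕ)
    (h : ∀ k, 1 ≤ k → k < s → I k → ¬ O (k + 1)) (M : Finset ℕ)
    (hM : ∀ k ∈ M, 1 ≤ k ∧ k ≤ s + 1 ∧ (k ≤ s → ¬ O k) ∧ (2 ≤ k → ¬ I (k - 1))) :
    ((Finset.Icc 1 s).filter O).card + ((Finset.Icc 1 s).filter I).card + M.card ≤ s + 1 := by
  have h1 : ((Finset.Icc 1 s).filter I).card
      = (((Finset.Icc 1 s).filter I).image (· + 1)).card :=
    (Finset.card_image_of_injective _ (add_left_injective 1)).symm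
  have h2 : Disjoint ((Finset.Icc 1 s).filter O) (((Finset.Icc 1 s).filter I).image (· + 1)) := by
    rw [Finset.disjoint_left]
    intro k hk hk'
    simp only [Finset.mem_image, Finset.mem_filter, Finset.mem_Icc] at hk hk'
    obtain ⟨i, ⟨hi, hI⟩, rfl⟩ := hk'
    exact h i hi.1 (by omega) hI hk.2
  have h3 : Disjoint ((Finset.Icc 1 s).filter O ∪ ((Finset.Icc 1 s).filter I).image (· + 1)) M := by
    rw [Finset.disjoint_left]
    intro k hk hkM
    obtain ⟨hk1, hk2, hk3, hk4⟩ := hM k hkM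
    simp only [Finset.mem_union, Finset.mem_image, Finset.mem_filter, Finset.mem_Icc] at hk
    rcases hk with hk | ⟨i, ⟨hi, hI⟩, rfl⟩
    · exact hk3 hk.1.2 hk.2
    · exact hk4 (by omega) (by simpa using hI)
  have h4 : ((Finset.Icc 1 s).filter O ∪ ((Finset.Icc 1 s).filter I).image (· + 1)) ∪ M
      ⊆ Finset.Icc 1 (s + 1) := by
    intro k hk
    simp only [Finset.mem_union, Finset.mem_image, Finset.mem_filter, Finset.mem_Icc] at hk ⊢
    rcases hk with (hk | ⟨i, hi, rfl⟩) | hk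
    · omega
    · omega
    · exact ⟨(hM k hk).1, (hM k hk).2.1⟩
  have h5 := Finset.card_le_card h4
  rw [Finset.card_union_of_disjoint h3, Finset.card_union_of_disjoint h2, ← h1] at h5
  simpa using h5

variable {B : ℕ → ℕ → Prop}

theorem degOn_Icc_add_card_le {v s : ℕ} (h : ∀ k, 1 ≤ k → k < s → B k v → ¬ B v (k + 1))
    (M : Finset ℕ)
    (hM : ∀ k ∈ M, 1 ≤ k ∧ k ≤ s + 1 ∧ (k ≤ s → ¬ B v k) ∧ (2 ≤ k → ¬ B (k - 1) v)) :
    degOn B v (Finset.Icc 1 s) + M.card ≤ s + 1 := by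
  classical
  rw [degOn_eq_card]
  convert card_filter_add_le (fun k => B v k) (fun k => B k v) s h M hM

/-- If no vertex is lost in the count, the out-neighbours form an initial segment and the
in-neighbours a final segment with one common vertex. -/
theorem exists_turn {O I : ℕ → Prop} {s : ℕ} (hs : 1 ≤ s)
    (h : ∀ i j, 1 ≤ i → i < j → j ≤ s → I i → ¬ O j)
    (hM : ∀ k, 1 ≤ k → k ≤ s + 1 → (k ≤ s ∧ O k) ∨ (2 ≤ k ∧ I (k - 1))) :
    ∃ b, 1 ≤ b ∧ b ≤ s ∧ ∀ k, 1 ≤ k → k ≤ s → ((O k ↔ k ≤ b) ∧ (I k ↔ b ≤ k)) := by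
  classical
  have hex : ∃ k, 1 ≤ k ∧ I k :=
    ⟨s, hs, by simpa using (hM (s + 1) (by omega) le_rfl).resolve_left (by omega) |>.2⟩
  refine ⟨Nat.find hex, (Nat.find_spec hex).1, ?_, ?_⟩
  · by_contra hlt
    have := (hM (s + 1) (by omega) le_rfl).resolve_left (by omega)
    exact Nat.find_min hex (m := s) (by omega) ⟨hs, by simpa using this.2⟩
  · have hO : ∀ k, 1 ≤ k → k ≤ s → k ≤ Nat.find hex → O k := by
      intro k h1 h2 h3
      rcases hM k h1 (by omega) with h4 | h4
      · exact h4.2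
      · exact absurd ⟨by omega, h4.2⟩ (Nat.find_min hex (m := k - 1) (by omega))
    have hO' : ∀ k, 1 ≤ k → k ≤ s → O k → k ≤ Nat.find hex := by
      intro k h1 h2 h3
      by_contra h4
      exact h _ k (Nat.find_spec hex).1 (by omega) h2 (Nat.find_spec hex).2 h3
    intro k h1 h2
    refine ⟨⟨hO' k h1 h2, hO k h1 h2⟩, fun h3 => ?_, fun h3 => ?_⟩
    · exact Nat.find_min' hex ⟨h1, h3⟩
    · rcases Nat.eq_or_lt_of_le h2 with rfl | h2
      · simpa using ((hM (k + 1) (by omega) le_rfl).resolve_left (by omega)).2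
      · rcases hM (k + 1) (by omega) (by omega) with h4 | h4
        · exact absurd (hO' _ (by omega) (by omega) h4.2) (by omega)
        · simpa using h4.2

end Counting

/-- A digraph on `{0, …, n - 1}` satisfying the degree and connectivity conditions (with special
vertex `0`) whose cycles through `0` have at most `m` vertices. -/
structure Base (B : ℕ → ℕ → Prop) (n m : ℕ) : Prop where
  irrefl : ∀ i, ¬ B i i
  degree_le : ∀ v, 1 ≤ v → v < n → n ≤ degOn B v (Finset.range n)
  degree_zero : n ≤ degOn B 0 (Finset.range n) + 4
  reach : ∀ k x y, k < n → x < n → y < n → x ≠ k → y ≠ k → ReachIn B {u | u < n ∧ u ≠ k} x y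
  longest : ∀ L, ClosedWalk B L → (∀ i ∈ L, i < n) → 0 ∈ L → L.length ≤ m

namespace Base

variable {B : ℕ → ℕ → Prop} {n m : ℕ}

theorem swap (h : Base B n m) : Base (fun i j => B j i) n m where
  irrefl := h.irrefl
  degree_le v h1 h2 := by rw [degOn_swap]; exact h.degree_le v h1 h2
  degree_zero := by rw [degOn_swap]; exact h.degree_zero
  reach k x y hk hx hy hxk hyk := (h.reach k y x hk hy hx hyk hxk).swap
  longest L hL hn h0 := by
    simpa using h.longest L.reverse hL.reverse (by simpa using hn) (by simpa using h0)

theorem reindex (h : Base B n m) (g : ℕ → ℕ) (hg : ∀ i < n, g i < n)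
    (hinj : ∀ i < n, ∀ j < n, g i = g j → i = j) (h0 : g 0 = 0) (hn : 0 < n) :
    Base (fun i j => B (g i) (g j)) n m := by
  have himg : (Finset.range n).image g = Finset.range n := by
    apply Finset.eq_of_subset_of_card_le
    · intro i hi
      simp only [Finset.mem_image, Finset.mem_range] at hi ⊢
      obtain ⟨j, hj, rfl⟩ := hi
      exact hg j hj
    · rw [Finset.card_image_of_injOn fun i hi j hj =>
        hinj i (by simpa using hi) j (by simpa using hj)]
  have hdeg : ∀ v, degOn (fun i j => B (g i) (g j)) v (Finset.range n)
      = degOn B (g v) (Finset.range n) := by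
    intro v
    rw [← degOn_image g v _ fun i hi j hj => hinj i (by simpa using hi) j (by simpa using hj), himg]
  refine ⟨fun i => h.irrefl _, fun v h1 h2 => ?_, ?_, ?_, ?_⟩
  · rw [hdeg]
    refine h.degree_le _ ?_ (hg v h2)
    by_contra h3
    have := hinj v h2 0 hn (by omega)
    omega
  · rw [hdeg, h0]; exact h.degree_zero
  · intro k x y hk hx hy hxk hyk
    have key : ∀ v, ReachIn B {u | u < n ∧ u ≠ g k} (g x) v → ∀ y < n, g y = v →
        ReachIn (fun i j => B (g i) (g j)) {u | u < n ∧ u ≠ k} x y := by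
      intro v hv
      induction hv with
      | refl =>
        intro y hy hyx
        rw [hinj y hy x hx hyx]
        exact .refl
      | @tail b c _ hbc ih =>
        intro y hy hyc
        obtain ⟨b', hb', rfl⟩ : ∃ b' < n, g b' = b := by
          have : b ∈ (Finset.range n).image g := by rw [himg]; simpa using hbc.1.1
          simpa using this
        subst hyc
        exact (ih b' hb' rfl).tail ⟨⟨hb', fun h => hbc.1.2 (by rw [h])⟩,
          ⟨hy, fun h => hbc.2.1.2 (by rw [h])⟩, hbc.2.2⟩
    exact key _ (h.reach (g k) (g x) (g y) (hg k hk) (hg x hx) (hg y hy)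
      (fun e => hxk (hinj x hx k hk e)) (fun e => hyk (hinj y hy k hk e))) y hy rfl
  · intro L hL hLn hL0
    have := h.longest (L.map g) (hL.map (f := g) (A := B) (fun _ _ => id)
      fun i hi j hj => hinj i (hLn i hi) j (hLn j hj)) ?_ ?_
    · simpa using this
    · intro i hi
      obtain ⟨j, hj, rfl⟩ := List.mem_map.1 hi
      exact hg j (hLn j hj)
    · exact List.mem_map.2 ⟨0, hL0, h0⟩

end Base

/-- Concatenation of the integer intervals `[a, b]`. -/
def blocks (l : List (ℕ × ℕ)) : List ℕ := l.flatMap fun p => List.range' p.1 (p.2 + 1 - p.1)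

/-- Total length of a list of intervals. -/
def blocksLength : List (ℕ × ℕ) → ℕ
  | [] => 0
  | p :: l => (p.2 + 1 - p.1) + blocksLength l

/-- The interval `[a, b]` avoids all intervals of a list. -/
def Avoids (a b : ℕ) : List (ℕ × ℕ) → Prop
  | [] => True
  | p :: l => (b < p.1 ∨ p.2 < a) ∧ Avoids a b l

/-- Intervals in `[0, s]` or singletons in `[0, n)`, pairwise disjoint. -/
def Fits (s n : ℕ) : List (ℕ × ℕ) → Prop
  | [] => True
  | p :: l => p.1 ≤ p.2 ∧ p.2 < n ∧ (p.2 ≤ s ∨ p.1 = p.2) ∧ Avoids p.1 p.2 l ∧ Fits s n l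

/-- Arcs linking the consecutive intervals of a list, from `e` to `f`. -/
def Links (B : ℕ → ℕ → Prop) (f : ℕ) : ℕ → List (ℕ × ℕ) → Prop
  | e, [] => B e f
  | e, p :: l => B e p.1 ∧ Links B f p.2 l

section Blocks

variable {B : ℕ → ℕ → Prop} {s n : ℕ}

theorem length_blocks (l : List (ℕ × ℕ)) : (blocks l).length = blocksLength l := by
  induction l with
  | nil => rfl
  | cons p l ih =>
    have : blocks (p :: l) = List.range' p.1 (p.2 + 1 - p.1) ++ blocks l := rfl
    rw [this, List.length_append, ih, List.length_range', blocksLength]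

theorem mem_blocks {l : List (ℕ × ℕ)} {v : ℕ} : v ∈ blocks l ↔ ∃ p ∈ l, p.1 ≤ v ∧ v ≤ p.2 := by
  simp only [blocks, List.mem_flatMap, List.mem_range'_1]
  constructor <;> rintro ⟨p, hp, h⟩ <;> exact ⟨p, hp, by omega⟩

theorem Avoids.not_mem {a b v : ℕ} {l : List (ℕ × ℕ)} (h : Avoids a b l) (h1 : a ≤ v)
    (h2 : v ≤ b) : v ∉ blocks l := by
  induction l with
  | nil => simp [blocks]
  | cons p l ih =>
    rw [mem_blocks]
    rintro ⟨q, hq, h3⟩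
    rcases List.mem_cons.1 hq with rfl | hq
    · have := h.1
      omega
    · exact ih h.2 (mem_blocks.2 ⟨q, hq, h3⟩)

theorem Fits.nodup {l : List (ℕ × ℕ)} (h : Fits s n l) : (blocks l).Nodup := by
  induction l with
  | nil => simp [blocks]
  | cons p l ih =>
    have : blocks (p :: l) = List.range' p.1 (p.2 + 1 - p.1) ++ blocks l := rfl
    rw [this, List.nodup_append]
    refine ⟨List.nodup_range', ih h.2.2.2.2, ?_⟩
    rintro u hu v hv rfl
    rw [List.mem_range'_1] at hu
    exact h.2.2.2.1.not_mem hu.1 (by omega) hv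

theorem Fits.lt {l : List (ℕ × ℕ)} (h : Fits s n l) : ∀ v ∈ blocks l, v < n := by
  intro v hv
  induction l with
  | nil => simp [blocks] at hv
  | cons p l ih =>
    have : blocks (p :: l) = List.range' p.1 (p.2 + 1 - p.1) ++ blocks l := rfl
    rw [this, List.mem_append, List.mem_range'_1] at hv
    rcases hv with hv | hv
    · have := h.1
      have := h.2.1
      omega
    · exact ih h.2.2.2.2 hv

theorem walk_range' (ha : ∀ i < s, B i (i + 1)) {a : ℕ} (k : ℕ) (h : k = 0 ∨ a + k ≤ s) :
    Walk B a (a + k) (List.range' a (k + 1)) := by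
  induction k with
  | zero => exact .single a
  | succ k ih =>
    rw [List.range'_concat]
    refine (ih (by omega)).append (ha _ (by omega)) ?_
    rw [show a + 1 * (k + 1) = a + (k + 1) by omega]
    exact .single _

theorem walk_blocks (ha : ∀ i < s, B i (i + 1)) {f : ℕ} {l : List (ℕ × ℕ)} {p : ℕ × ℕ}
    (h : Fits s n (p :: l)) (hl : Links B f p.2 l) :
    ∃ e, Walk B p.1 e (blocks (p :: l)) ∧ B e f := by
  induction l generalizing p with
  | nil =>
    have hw := walk_range' ha (a := p.1) (p.2 - p.1) (by have := h.1; have := h.2.2.1; omega)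
    have h1 := h.1
    refine ⟨p.2, ?_, hl⟩
    rw [show p.1 + (p.2 - p.1) = p.2 by omega] at hw
    simpa [blocks, show p.2 + 1 - p.1 = p.2 - p.1 + 1 by omega] using hw
  | cons q l ih =>
    have hw := walk_range' ha (a := p.1) (p.2 - p.1) (by have := h.1; have := h.2.2.1; omega)
    have h1 := h.1
    obtain ⟨e, hw', he⟩ := ih h.2.2.2.2 hl.2
    refine ⟨e, ?_, he⟩
    have : blocks (p :: q :: l) = List.range' p.1 (p.2 - p.1 + 1) ++ blocks (q :: l) := by
      rw [show p.2 - p.1 + 1 = p.2 + 1 - p.1 by omega]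
      rfl
    rw [this]
    rw [show p.1 + (p.2 - p.1) = p.2 by omega] at hw
    exact hw.append hl.1 hw'

end Blocks

/-- A longest cycle `0, 1, …, s` through the special vertex `0`, with `r` vertices
`s + 1, …, s + r` left over. -/
structure Cfg (B : ℕ → ℕ → Prop) (s r : ℕ) : Prop extends Base B (s + r + 1) (s + 1) where
  arc : ∀ i < s, B i (i + 1)
  back : B s 0

namespace Cfg

variable {B : ℕ → ℕ → Prop} {s r : ℕ}

theorem not_links (h : Cfg B s r) (e : ℕ) (l : List (ℕ × ℕ))
    (hl : Links B 0 e l) (hf : Fits s (s + r + 1) ((0, e) :: l))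
    (hlen : s + 1 < blocksLength ((0, e) :: l)) : False := by
  obtain ⟨f, hw, hf0⟩ := walk_blocks h.arc hf hl
  have := h.longest _ ⟨hf.nodup, 0, f, hw, hf0⟩ hf.lt (by
    rw [mem_blocks]; exact ⟨(0, e), by simp, le_rfl, Nat.zero_le _⟩)
  rw [length_blocks] at this
  omega

/-- The vertex numbering of the reversed configuration. -/
def mirror (s r i : ℕ) : ℕ := if i = 0 then 0 else if i ≤ s then s + 1 - i else 2 * s + r + 1 - i

theorem mirror_zero : mirror s r 0 = 0 := rfl

theorem mirror_of_le {i : ℕ} (h1 : 1 ≤ i) (h2 : i ≤ s) : mirror s r i = s + 1 - i := by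
  unfold mirror; split_ifs <;> omega

theorem mirror_of_lt {i : ℕ} (h1 : s < i) : mirror s r i = 2 * s + r + 1 - i := by
  unfold mirror; split_ifs <;> omega

theorem rev (h : Cfg B s r) : Cfg (fun i j => B (mirror s r j) (mirror s r i)) s r where
  toBase := h.toBase.swap.reindex (mirror s r)
    (fun i hi => by unfold mirror; split_ifs <;> omega)
    (fun i hi j hj => by unfold mirror; split_ifs <;> omega) rfl (by omega)
  arc i hi := by
    rw [mirror_of_le (i := i + 1) (by omega) (by omega)]
    rcases Nat.eq_zero_or_pos i with rfl | h0
    · simpa [mirror] using h.back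
    · rw [mirror_of_le h0 (by omega)]
      have := h.arc (s + 1 - (i + 1)) (by omega)
      rwa [show s + 1 - (i + 1) + 1 = s + 1 - i by omega] at this
  back := by
    have h0 : s ≠ 0 := by
      rintro rfl
      exact h.irrefl 0 h.back
    simpa [mirror, h0] using h.arc 0 (by omega)

theorem reindex (h : Cfg B s r) (g : ℕ → ℕ) (hg : ∀ i < s + r + 1, g i < s + r + 1)
    (hinj : ∀ i < s + r + 1, ∀ j < s + r + 1, g i = g j → i = j) (h0 : g 0 = 0)
    (harc : ∀ i < s, B (g i) (g (i + 1))) (hback : B (g s) 0) :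
    Cfg (fun i j => B (g i) (g j)) s r where
  toBase := h.toBase.reindex g hg hinj h0 (by omega)
  arc := harc
  back := by rw [h0]; exact hback

end Cfg

namespace Cfg

variable {B : ℕ → ℕ → Prop} {s r : ℕ}

theorem pos (h : Cfg B s r) : 1 ≤ s := by
  rcases Nat.eq_zero_or_pos s with rfl | h0
  · exact absurd h.back (h.irrefl 0)
  · exact h0

theorem degree_split (B : ℕ → ℕ → Prop) (s r v : ℕ) : degOn B v (Finset.range (s + r + 1))
    = arcs B v 0 + degOn B v (Finset.Icc 1 s) + degOn B v (Finset.Ioc s (s + r)) := by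
  have h1 : Finset.range (s + r + 1) = ({0} ∪ Finset.Icc 1 s) ∪ Finset.Ioc s (s + r) := by
    ext k; simp; omega
  rw [h1, degOn_union, degOn_union]
  · simp [degOn]
  · rw [Finset.disjoint_left]; intro k; simp; omega
  · rw [Finset.disjoint_left]; intro k; simp; omega

/-- No walk outside the cycle joins two of its vertices in the direction of the cycle. -/
theorem not_bypass (h : Cfg B s r) {Q : List ℕ} {i j b x y : ℕ} (hij : i < j)
    (hb : b = j ∧ j ≤ s ∨ b = 0 ∧ j = s + 1) (hQ : Walk B x y Q) (hnd : Q.Nodup)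
    (hQR : ∀ q ∈ Q, q ∈ Set.Ioc s (s + r)) (hix : B i x) (hyb : B y b) : False := by
  have hs := h.pos
  obtain ⟨L, hL, hLnd, hLmem⟩ : ∃ L, Walk B b i L ∧ L.Nodup ∧
      ∀ v, v ∈ L ↔ v ≤ i ∨ (j ≤ v ∧ v ≤ s) := by
    have h0 : Walk B 0 i (List.range' 0 (i + 1)) := by
      simpa using walk_range' h.arc (a := 0) i (by omega)
    rcases hb with ⟨rfl, hj⟩ | ⟨rfl, hj⟩
    · have h1 := walk_range' h.arc (a := b) (s - b) (by omega)
      rw [show b + (s - b) = s by omega] at h1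
      refine ⟨_, h1.append h.back h0, ?_, fun v => ?_⟩
      · rw [List.nodup_append]
        refine ⟨List.nodup_range', List.nodup_range', ?_⟩
        rintro u hu v hv rfl
        rw [List.mem_range'_1] at hu hv
        omega
      · rw [List.mem_append, List.mem_range'_1, List.mem_range'_1]
        omega
    · refine ⟨_, h0, List.nodup_range', fun v => ?_⟩
      rw [List.mem_range'_1]
      omega
  have hT : Walk B i b (i :: (List.range' (i + 1) (j - i - 1) ++ [b])) := by
    have h1 := walk_range' h.arc (a := i) (j - i - 1) (by omega)
    have h2 : B (i + (j - i - 1)) b := by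
      rcases hb with ⟨rfl, hj⟩ | ⟨rfl, rfl⟩
      · have := h.arc (b - 1) (by omega)
        rwa [show b - 1 + 1 = b by omega, show b - 1 = i + (b - i - 1) by omega] at this
      · rw [show i + (s + 1 - i - 1) = s by omega]
        exact h.back
    have := h1.append h2 (.single b)
    rwa [List.range'_succ] at this
  have hmem : ∀ v, v ∈ List.range' (i + 1) (j - i - 1) ++ L ↔ v ≤ s := by
    intro v
    rw [List.mem_append, hLmem, List.mem_range'_1]
    omega
  obtain ⟨M, hM, hMU, hMK, w, hw, hwK⟩ := exists_cycle_of_bypass h.irrefl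
    (Finset.range (s + r + 1)) rfl hL hT hQ hix hyb
    (by
      rw [List.nodup_append]
      refine ⟨List.nodup_range', hLnd, ?_⟩
      rintro u hu v hv rfl
      rw [List.mem_range'_1] at hu
      rw [hLmem] at hv
      omega) hnd
    (fun q hq => by rw [hmem]; have := (hQR q hq).1; omega)
    (fun v hv => by rw [hmem] at hv; rw [Finset.mem_range]; omega)
    (fun q hq => by rw [Finset.mem_range]; have := (hQR q hq).2; omega)
    (fun x hx hxK t ht => by
      rw [hmem] at hxK
      rw [List.mem_range'_1] at ht
      rw [Finset.mem_range] at hx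
      have h1 := h.degree_le x (by omega) hx
      have h2 := h.degree_le t (by omega) (by omega)
      rw [Finset.card_range]
      omega)
  have hlen := h.longest M hM (fun v hv => by simpa using hMU v hv)
    (hMK 0 ((hmem 0).2 (Nat.zero_le _)))
  rw [hmem] at hwK
  have hsub : insert w (Finset.range (s + 1)) ⊆ M.toFinset := by
    intro v hv
    rw [Finset.mem_insert, Finset.mem_range] at hv
    rw [List.mem_toFinset]
    rcases hv with rfl | hv
    · exact hw
    · exact hMK v ((hmem v).2 (by omega))
  have h1 := Finset.card_le_card hsub
  rw [Finset.card_insert_of_notMem (by simp; omega), List.toFinset_card_of_nodup hM.1,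
    Finset.card_range] at h1
  omega

theorem not_forward (h : Cfg B s r) {i j x y : ℕ} (hij : i < j) (hj : j ≤ s)
    (hx : x ∈ Set.Ioc s (s + r)) (hxy : ReachIn B (Set.Ioc s (s + r)) x y) (hix : B i x) :
    ¬ B y j := fun hyj => by
  obtain ⟨Q, hQ, hnd, hQR⟩ := hxy.exists_walk hx
  exact h.not_bypass hij (Or.inl ⟨rfl, hj⟩) hQ hnd hQR hix hyj

theorem not_forward_zero (h : Cfg B s r) {i x y : ℕ} (hi : i ≤ s)
    (hx : x ∈ Set.Ioc s (s + r)) (hxy : ReachIn B (Set.Ioc s (s + r)) x y) (hix : B i x) :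
    ¬ B y 0 := fun hyj => by
  obtain ⟨Q, hQ, hnd, hQR⟩ := hxy.exists_walk hx
  exact h.not_bypass (j := s + 1) (by omega) (Or.inr ⟨rfl, rfl⟩) hQ hnd hQR hix hyj

/-- Avoiding `k`, every outside vertex can reach the cycle. -/
theorem exists_exit (h : Cfg B s r) {k x : ℕ} (hk : k ≤ s) (hx : x ∈ Set.Ioc s (s + r)) :
    ∃ y j, y ∈ Set.Ioc s (s + r) ∧ ReachIn B (Set.Ioc s (s + r)) x y ∧ j ≤ s ∧ j ≠ k ∧ B y j := by
  have hs := h.pos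
  obtain ⟨t, ht, htk⟩ : ∃ t ≤ s, t ≠ k := by
    by_cases h0 : k = 0
    · exact ⟨1, hs, by omega⟩
    · exact ⟨0, by omega, by omega⟩
  obtain ⟨u, v, hr, hu, hv, -, hv', huv⟩ := (h.reach k x t (by omega)
    (by have := hx.2; omega) (by omega) (by have := hx.1; omega) htk).exists_exit
    (X := Set.Ioc s (s + r)) hx (fun h => by have := h.1; omega)
  refine ⟨u, v, hu, hr.mono Set.inter_subset_right, ?_, hv'.2, huv⟩
  by_contra hvs
  exact hv ⟨by omega, by have := hv'.1; omega⟩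

/-- Avoiding `k`, every outside vertex can be reached from the cycle. -/
theorem exists_entry (h : Cfg B s r) {k x : ℕ} (hk : k ≤ s) (hx : x ∈ Set.Ioc s (s + r)) :
    ∃ y j, y ∈ Set.Ioc s (s + r) ∧ ReachIn B (Set.Ioc s (s + r)) y x ∧ j ≤ s ∧ j ≠ k ∧ B j y := by
  have hs := h.pos
  obtain ⟨t, ht, htk⟩ : ∃ t ≤ s, t ≠ k := by
    by_cases h0 : k = 0
    · exact ⟨1, hs, by omega⟩
    · exact ⟨0, by omega, by omega⟩
  obtain ⟨u, v, hr, hu, hv, -, hv', huv⟩ := (h.reach k t x (by omega) (by omega)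
    (by have := hx.2; omega) htk (by have := hx.1; omega)).swap.exists_exit
    (X := Set.Ioc s (s + r)) hx (fun h => by have := h.1; omega)
  refine ⟨u, v, hu, (hr.mono Set.inter_subset_right).swap, ?_, hv'.2, huv⟩
  by_contra hvs
  exact hv ⟨by omega, by have := hv'.1; omega⟩

theorem not_zero_out (h : Cfg B s r) {x : ℕ} (hx : x ∈ Set.Ioc s (s + r)) : ¬ B 0 x := fun h0 => by
  obtain ⟨y, j, -, hxy, hj, hj0, hyj⟩ := h.exists_exit (Nat.zero_le s) hx
  exact h.not_forward (by omega) hj hx hxy h0 hyj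

theorem not_zero_in (h : Cfg B s r) {x : ℕ} (hx : x ∈ Set.Ioc s (s + r)) : ¬ B x 0 := fun h0 => by
  obtain ⟨y, j, hy, hxy, hj, hj0, hyj⟩ := h.exists_entry (Nat.zero_le s) hx
  exact h.not_forward_zero hj hy hxy hyj h0

theorem le_degOn_of_outside (h : Cfg B s r) {x : ℕ} (hx : x ∈ Set.Ioc s (s + r)) :
    s + r + 1 ≤ degOn B x (Finset.Icc 1 s) + degOn B x (Finset.Ioc s (s + r)) := by
  have h1 := h.degree_le x (by have := hx.1; omega) (by have := hx.2; omega)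
  rw [degree_split, arcs_eq_zero.2 ⟨h.not_zero_in hx, h.not_zero_out hx⟩] at h1
  omega

theorem le_degOn_zero (h : Cfg B s r) :
    s + r + 1 ≤ degOn B 0 (Finset.Icc 1 s) + 4 := by
  have h1 := h.degree_zero
  rw [degree_split, arcs_self h.irrefl, degOn_eq_zero (S := Finset.Ioc s (s + r)) fun u hu => by
    rw [Finset.mem_Ioc] at hu
    exact ⟨h.not_zero_out hu, h.not_zero_in hu⟩] at h1
  omega

/-- An outside vertex has total degree at most `2 (r - 1)` to the other outside vertices. -/
theorem degOn_outside_le (h : Cfg B s r) {x : ℕ} (hx : x ∈ Set.Ioc s (s + r)) :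
    degOn B x (Finset.Ioc s (s + r)) + 2 ≤ 2 * r := by
  have h1 : Finset.Ioc s (s + r) = {x} ∪ (Finset.Ioc s (s + r)).erase x := by
    ext k
    have h1 := hx.1
    have h2 := hx.2
    simp
    omega
  have h2 := degOn_le_two_mul (A := B) x ((Finset.Ioc s (s + r)).erase x)
  rw [Finset.card_erase_of_mem (by simpa using hx), Nat.card_Ioc] at h2
  have h3 : degOn B x {x} = 0 := by simp [degOn, arcs_self h.irrefl]
  rw [h1, degOn_union (by simp), h3]
  have h1 := hx.1
  have h2 := hx.2
  omega

theorem degOn_Icc_le (h : Cfg B s r) {x : ℕ} (hx : x ∈ Set.Ioc s (s + r)) (M : Finset ℕ)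
    (hM : ∀ k ∈ M, 1 ≤ k ∧ k ≤ s + 1 ∧ (k ≤ s → ¬ B x k) ∧ (2 ≤ k → ¬ B (k - 1) x)) :
    degOn B x (Finset.Icc 1 s) + M.card ≤ s + 1 :=
  degOn_Icc_add_card_le
    (fun k _ h2 hk hk' => h.not_forward (Nat.lt_succ_self k) h2 hx .refl hk hk') M hM

theorem two_le (h : Cfg B s r) (hr : 1 ≤ r) : 2 ≤ r := by
  have hx : s + 1 ∈ Set.Ioc s (s + r) := ⟨by omega, by omega⟩
  have h1 := h.le_degOn_of_outside hx
  have h2 := h.degOn_outside_le hx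
  have h3 := h.degOn_Icc_le hx ∅ (by simp)
  simp at h3
  omega

/-- Unless the special vertex provides a detour around `k`, some arc jumps over `k`. -/
theorem exists_jump (h : Cfg B s r) {k : ℕ} (hk1 : 1 < k) (hks : k < s)
    (hz : (∀ i, 1 ≤ i → i < k → ¬ B i 0) ∨ ∀ j, k < j → j ≤ s → ¬ B 0 j) :
    ∃ i j, 1 ≤ i ∧ i < k ∧ k < j ∧ j ≤ s ∧ B i j := by
  by_contra! hno
  let X : Set ℕ := {v | (1 ≤ v ∧ v < k) ∨ (v = 0 ∧ ∀ j, k < j → j ≤ s → ¬ B 0 j) ∨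
    (v ∈ Set.Ioc s (s + r) ∧ ∃ i x, 1 ≤ i ∧ i < k ∧ B i x ∧ x ∈ Set.Ioc s (s + r) ∧
      ReachIn B (Set.Ioc s (s + r)) x v)}
  obtain ⟨u, v, -, hu, hv, -, hv', huv⟩ := (h.reach k 1 s (by omega) (by omega) (by omega)
    (by omega) (by omega)).exists_exit (X := X) (Or.inl ⟨le_rfl, hk1⟩) (by
      rintro (h | h | h)
      · omega
      · omega
      · have := h.1.1
        omega)
  have hvn := hv'.1
  have hvk := hv'.2
  have hcase : (1 ≤ v ∧ v < k) ∨ (v = 0) ∨ (k < v ∧ v ≤ s) ∨ v ∈ Set.Ioc s (s + r) := by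
    rw [Set.mem_Ioc]; omega
  rcases hu with hu | ⟨rfl, hu⟩ | ⟨hu, i, x, hi1, hik, hix, hx, hxu⟩ <;>
    rcases hcase with hc | rfl | hc | hc
  · exact hv (Or.inl hc)
  · rcases hz with hz | hz
    · exact hz u hu.1 hu.2 huv
    · exact hv (Or.inr (Or.inl ⟨rfl, hz⟩))
  · exact hno u v hu.1 hu.2 hc.1 hc.2 huv
  · exact hv (Or.inr (Or.inr ⟨hc, u, v, hu.1, hu.2, huv, hc, .refl⟩))
  · exact hv (Or.inl hc)
  · exact h.irrefl 0 huv
  · exact hu v hc.1 hc.2 huv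
  · exact h.not_zero_out hc huv
  · exact hv (Or.inl hc)
  · exact h.not_zero_in hu huv
  · exact h.not_forward (by omega) hc.2 hx hxu hix huv
  · exact hv (Or.inr (Or.inr ⟨hc, i, x, hi1, hik, hix, hx, hxu.tail ⟨hu, hc, huv⟩⟩))

end Cfg

namespace Cfg

variable {B : ℕ → ℕ → Prop} {s r : ℕ}

theorem exists_zero_out (h : Cfg B s r) (hs : 2 ≤ s) (k : ℕ) (hk : 1 ≤ k) (hks : k ≤ s) :
    ∃ j, 1 ≤ j ∧ j ≤ s ∧ j ≠ k ∧ B 0 j := by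
  obtain ⟨t, ht1, ht, htk⟩ : ∃ t, 1 ≤ t ∧ t ≤ s ∧ t ≠ k := by
    by_cases h0 : k = 1
    · exact ⟨2, by omega, hs, by omega⟩
    · exact ⟨1, by omega, by omega, by omega⟩
  obtain ⟨u, v, -, hu, hv, -, hv', huv⟩ := (h.reach k 0 t (by omega) (by omega) (by omega)
    (by omega) htk).exists_exit (X := {0}) rfl (by simp; omega)
  obtain rfl : u = 0 := hu
  have h0 : v ≠ 0 := hv
  refine ⟨v, by omega, ?_, hv'.2, huv⟩
  by_contra hvs
  exact h.not_zero_out ⟨by omega, by have := hv'.1; omega⟩ huv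

/-- If the special vertex can be inserted nowhere into the path `1, …, s`, then few positions are
lost in counting its arcs. -/
theorem card_defects_le (h : Cfg B s r) (hcons : ∀ k, 1 ≤ k → k < s → B k 0 → ¬ B 0 (k + 1))
    (M : Finset ℕ)
    (hM : ∀ k ∈ M, 1 ≤ k ∧ k ≤ s + 1 ∧ (k ≤ s → ¬ B 0 k) ∧ (2 ≤ k → ¬ B (k - 1) 0)) :
    M.card + r ≤ 4 := by
  have h1 := h.le_degOn_zero
  have h2 := degOn_Icc_add_card_le hcons M hM
  omega

end Cfg

theorem exists_closest {O I : ℕ → Prop} {i j : ℕ} (hij : i < j) (hi : I i) (hj : O j) :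
    ∃ i' j', i ≤ i' ∧ i' < j' ∧ j' ≤ j ∧ I i' ∧ O j' ∧ ∀ k, i' < k → k < j' → ¬ O k ∧ ¬ I k := by
  classical
  have hex : ∃ j', i < j' ∧ O j' := ⟨j, hij, hj⟩
  obtain ⟨h1, h2⟩ := Nat.find_spec hex
  have h3 : i ≤ Nat.findGreatest I (Nat.find hex - 1) := Nat.le_findGreatest (by omega) hi
  have h4 := Nat.findGreatest_le (P := I) (Nat.find hex - 1)
  refine ⟨_, Nat.find hex, h3, by omega, Nat.find_min' hex ⟨hij, hj⟩,
    Nat.findGreatest_spec (m := i) (by omega) hi, h2, fun k hk1 hk2 => ⟨fun hO => ?_, ?_⟩⟩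
  · exact Nat.find_min hex hk2 ⟨by omega, hO⟩
  · exact Nat.findGreatest_is_greatest (n := Nat.find hex - 1) hk1 (by omega)

/-- Between an in-neighbour `i` and a later out-neighbour `j` of the special vertex, one position is
lost. -/
theorem exists_defect {O I : ℕ → Prop} {i j : ℕ} (hij : i < j) (hi : I i) (hj : O j)
    (hgap : ∀ i' j', i ≤ i' → j' ≤ j → i' < j' → I i' → O j' → i' + 3 ≤ j') :
    ∃ k, i + 1 < k ∧ k < j ∧ ¬ O k ∧ ¬ I (k - 1) := by
  obtain ⟨i', j', h1, h2, h3, h4, h5, h6⟩ := exists_closest hij hi hj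
  have h7 := hgap i' j' h1 h3 h2 h4 h5
  exact ⟨i' + 2, by omega, by omega, (h6 _ (by omega) (by omega)).1,
    (h6 _ (by omega) (by omega)).2⟩

/-- A configuration with two outside vertices, which are twins turning at `b`. -/
structure Twins (B : ℕ → ℕ → Prop) (s b : ℕ) : Prop extends Cfg B s 2 where
  one_lt : 1 < b
  lt : b < s
  twin : B (s + 1) (s + 2)
  twin' : B (s + 2) (s + 1)
  out : ∀ x, s < x → x ≤ s + 2 → ∀ k, 1 ≤ k → k ≤ s → (B x k ↔ k ≤ b)
  inn : ∀ x, s < x → x ≤ s + 2 → ∀ k, 1 ≤ k → k ≤ s → (B k x ↔ b ≤ k)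

theorem Cfg.exists_twins {B : ℕ → ℕ → Prop} {s : ℕ} (h : Cfg B s 2) : ∃ b, Twins B s b := by
  have hs := h.pos
  have key : ∀ x ∈ Set.Ioc s (s + 2), 2 ≤ degOn B x (Finset.Ioc s (s + 2)) ∧
      ∃ b, 1 ≤ b ∧ b ≤ s ∧ ∀ k, 1 ≤ k → k ≤ s → ((B x k ↔ k ≤ b) ∧ (B k x ↔ b ≤ k)) := by
    intro x hx
    have h1 := h.le_degOn_of_outside hx
    have h2 := h.degOn_outside_le hx
    have h3 := h.degOn_Icc_le hx ∅ (by simp)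
    simp only [Finset.card_empty] at h3
    refine ⟨by omega, exists_turn (I := fun k => B k x) hs
      (fun i j _ hij hj hi hj' => h.not_forward hij hj hx .refl hi hj') fun k hk1 hk2 => ?_⟩
    by_contra! hk
    have := h.degOn_Icc_le hx {k} (by simpa using ⟨hk1, hk2, hk.1, hk.2⟩)
    simp only [Finset.card_singleton] at this
    omega
  have hx1 : s + 1 ∈ Set.Ioc s (s + 2) := ⟨by omega, by omega⟩
  have hx2 : s + 2 ∈ Set.Ioc s (s + 2) := ⟨by omega, by omega⟩
  obtain ⟨hd, b, hb1, hbs, hb⟩ := key _ hx1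
  obtain ⟨-, c, hc1, hcs, hc⟩ := key _ hx2
  have htw : B (s + 1) (s + 2) ∧ B (s + 2) (s + 1) := by
    have hR : Finset.Ioc s (s + 2) = {s + 1, s + 2} := by ext; simp; omega
    rw [hR, degOn, Finset.sum_insert (by simp), Finset.sum_singleton, arcs_self h.irrefl,
      arcs] at hd
    split_ifs at hd <;> first | omega | exact ⟨by assumption, by assumption⟩
  have hr1 : ReachIn B (Set.Ioc s (s + 2)) (s + 1) (s + 2) := .single ⟨hx1, hx2, htw.1⟩
  have hr2 : ReachIn B (Set.Ioc s (s + 2)) (s + 2) (s + 1) := .single ⟨hx2, hx1, htw.2⟩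
  have hbc : ¬ b < c := fun hlt => h.not_forward hlt hcs hx1 hr1 ((hb b hb1 hbs).2.2 le_rfl)
    ((hc c hc1 hcs).1.2 le_rfl)
  have hcb : ¬ c < b := fun hlt => h.not_forward hlt hbs hx2 hr2 ((hc c hc1 hcs).2.2 le_rfl)
    ((hb b hb1 hbs).1.2 le_rfl)
  obtain rfl : b = c := by omega
  have hall : ∀ x, s < x → x ≤ s + 2 →
      ∀ k, 1 ≤ k → k ≤ s → ((B x k ↔ k ≤ b) ∧ (B k x ↔ b ≤ k)) := by
    intro x hx hx' k h1 h2
    obtain rfl | rfl : x = s + 1 ∨ x = s + 2 := by omega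
    · exact hb k h1 h2
    · exact hc k h1 h2
  refine ⟨b, h, ?_, ?_, htw.1, htw.2, fun x h1 h2 k h3 h4 => (hall x h1 h2 k h3 h4).1,
    fun x h1 h2 k h3 h4 => (hall x h1 h2 k h3 h4).2⟩
  · obtain ⟨y, j, hy, -, hj, hj1, hyj⟩ := h.exists_exit (k := 1) hs hx1
    have hj0 : j ≠ 0 := fun h0 => h.not_zero_in hy (h0 ▸ hyj)
    have := (hall y hy.1 hy.2 j (by omega) hj).1.1 hyj
    omega
  · obtain ⟨y, j, hy, -, hj, hj1, hyj⟩ := h.exists_entry (k := s) le_rfl hx1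
    have hj0 : j ≠ 0 := fun h0 => h.not_zero_out hy (h0 ▸ hyj)
    have := (hall y hy.1 hy.2 j (by omega) hj).2.1 hyj
    omega

namespace Twins

variable {B : ℕ → ℕ → Prop} {s b : ℕ}

theorem rev (h : Twins B s b) :
    Twins (fun i j => B (Cfg.mirror s 2 j) (Cfg.mirror s 2 i)) s (s + 1 - b) where
  toCfg := h.toCfg.rev
  one_lt := by have := h.lt; omega
  lt := by have := h.one_lt; have := h.lt; omega
  twin := by
    rw [Cfg.mirror_of_lt (by omega), Cfg.mirror_of_lt (by omega)]
    convert h.twin using 1 <;> omega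
  twin' := by
    rw [Cfg.mirror_of_lt (by omega), Cfg.mirror_of_lt (by omega)]
    convert h.twin' using 1 <;> omega
  out x hx hx' k h1 h2 := by
    have := h.lt
    rw [Cfg.mirror_of_lt hx, Cfg.mirror_of_le h1 h2,
      h.inn _ (by omega) (by omega) _ (by omega) (by omega)]
    omega
  inn x hx hx' k h1 h2 := by
    have := h.lt
    rw [Cfg.mirror_of_lt hx, Cfg.mirror_of_le h1 h2,
      h.out _ (by omega) (by omega) _ (by omega) (by omega)]
    omega

theorem to_one (h : Twins B s b) {k : ℕ} (h1 : 1 ≤ k) (h2 : k ≤ b) : B (s + 1) k :=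
  (h.out _ (by omega) (by omega) k h1 (h2.trans h.lt.le)).2 h2

theorem to_two (h : Twins B s b) {k : ℕ} (h1 : 1 ≤ k) (h2 : k ≤ b) : B (s + 2) k :=
  (h.out _ (by omega) (by omega) k h1 (h2.trans h.lt.le)).2 h2

theorem from_one (h : Twins B s b) {k : ℕ} (h1 : b ≤ k) (h2 : k ≤ s) : B k (s + 1) :=
  (h.inn _ (by omega) (by omega) k (h.one_lt.le.trans h1) h2).2 h1

theorem from_two (h : Twins B s b) {k : ℕ} (h1 : b ≤ k) (h2 : k ≤ s) : B k (s + 2) :=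
  (h.inn _ (by omega) (by omega) k (h.one_lt.le.trans h1) h2).2 h1

theorem gap (h : Twins B s b) {i j : ℕ} (hi : 1 ≤ i) (hij : i < j) (hj : j ≤ s) (hi0 : B i 0)
    (h0j : B 0 j) : i + 3 ≤ j := by
  have := h.one_lt
  have := h.lt
  by_contra hlt
  refine h.not_links 0 [(j, s), (s + 1, s + 1), (s + 2, s + 2), (1, i)]
    ⟨h0j, h.from_one (by omega) le_rfl, h.twin, h.to_two le_rfl (by omega), hi0⟩ ?_ ?_
  · simp only [Fits, Avoids, or_true, and_true, true_and]; omega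
  · simp only [blocksLength]; omega

theorem card_defects_le (h : Twins B s b) (M : Finset ℕ)
    (hM : ∀ k ∈ M, 1 ≤ k ∧ k ≤ s + 1 ∧ (k ≤ s → ¬ B 0 k) ∧ (2 ≤ k → ¬ B (k - 1) 0)) :
    M.card ≤ 2 := by
  have := h.toCfg.card_defects_le (fun k h1 h2 h3 h4 => by
    have := h.gap h1 (Nat.lt_succ_self k) h2 h3 h4
    omega) M hM
  omega

/-- There are no three defects. -/
theorem not_three_defects (h : Twins B s b) {k₁ k₂ k₃ : ℕ} (h12 : k₁ ≠ k₂) (h13 : k₁ ≠ k₃)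
    (h23 : k₂ ≠ k₃)
    (h1 : 1 ≤ k₁ ∧ k₁ ≤ s + 1 ∧ (k₁ ≤ s → ¬ B 0 k₁) ∧ (2 ≤ k₁ → ¬ B (k₁ - 1) 0))
    (h2 : 1 ≤ k₂ ∧ k₂ ≤ s + 1 ∧ (k₂ ≤ s → ¬ B 0 k₂) ∧ (2 ≤ k₂ → ¬ B (k₂ - 1) 0))
    (h3 : 1 ≤ k₃ ∧ k₃ ≤ s + 1 ∧ (k₃ ≤ s → ¬ B 0 k₃) ∧ (2 ≤ k₃ → ¬ B (k₃ - 1) 0)) : False := by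
  have := h.card_defects_le {k₁, k₂, k₃} (by
    intro k hk
    simp only [Finset.mem_insert, Finset.mem_singleton] at hk
    rcases hk with rfl | rfl | rfl <;> assumption)
  rw [Finset.card_insert_of_notMem (by simp [h12, h13]),
    Finset.card_insert_of_notMem (by simp [h23]), Finset.card_singleton] at this
  omega

theorem defect_between (h : Twins B s b) {i j : ℕ} (hi : 1 ≤ i) (hij : i < j) (hj : j ≤ s)
    (hi0 : B i 0) (h0j : B 0 j) : ∃ k, i + 1 < k ∧ k < j ∧ ¬ B 0 k ∧ ¬ B (k - 1) 0 :=
  exists_defect (O := fun k => B 0 k) (I := fun k => B k 0) hij hi0 h0j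
    fun _ _ h1 h2 h3 h4 h5 => h.gap (by omega) h3 (by omega) h4 h5

/-- Rerouting along an arc `x → y` through the outside vertices and the special vertex. -/
theorem not_jump_in (h : Twins B s b) {x y o i : ℕ} (hx : 1 ≤ x) (hxo : x < o) (hoi : o ≤ i)
    (hiy : i < y) (hy : y ≤ s) (hxy : B x y) (hob : o ≤ b) (hi : B i 0)
    (hlost : o + y ≤ x + i + 3) : False := by
  have := h.one_lt
  have := h.lt
  refine h.not_links x [(y, s), (s + 1, s + 1), (s + 2, s + 2), (o, i)]
    ⟨hxy, h.from_one (by omega) le_rfl, h.twin, h.to_two (by omega) hob, hi⟩ ?_ ?_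
  · simp only [Fits, Avoids, or_true, and_true, true_and]; omega
  · simp only [blocksLength]; omega

theorem not_jump_out (h : Twins B s b) {x y o i : ℕ} (hx : 1 ≤ x) (hxo : x < o) (hoi : o ≤ i)
    (hiy : i < y) (hy : y ≤ s) (hxy : B x y) (ho : B 0 o) (hib : b ≤ i)
    (hlost : o + y ≤ x + i + 3) : False := by
  have := h.one_lt
  have := h.lt
  refine h.not_links 0 [(o, i), (s + 1, s + 1), (s + 2, s + 2), (1, x), (y, s)]
    ⟨ho, h.from_one hib (by omega), h.twin, h.to_two le_rfl (by omega), hxy, h.back⟩ ?_ ?_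
  · simp only [Fits, Avoids, or_true, and_true, true_and]; omega
  · simp only [blocksLength]; omega

theorem not_cross (h : Twins B s b) {x y : ℕ} (hx : 1 ≤ x) (hxb : x < b) (hby : b < y)
    (hy : y ≤ s) (hx0 : B x 0) : ¬ B 0 y := fun h0y => by
  have := h.one_lt
  have := h.lt
  refine h.not_links 0 [(y, s), (s + 1, s + 1), (x + 1, y - 1), (s + 2, s + 2), (1, x)]
    ⟨h0y, h.from_one (by omega) le_rfl, h.to_one (by omega) (by omega),
      h.from_two (by omega) (by omega), h.to_two (by omega) (by omega), hx0⟩ ?_ ?_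
  · simp only [Fits, Avoids, or_true, and_true, true_and]; omega
  · simp only [blocksLength]; omega

theorem exists_out_ge (h : Twins B s b) : ∃ j, b ≤ j ∧ j ≤ s ∧ B 0 j := by
  have hb1 := h.one_lt
  have hbs := h.lt
  by_contra! hO
  obtain ⟨j₁, hj1, hj1s, -, h0j1⟩ := h.exists_zero_out (by omega) 1 le_rfl (by omega)
  obtain ⟨j₂, hj2, hj2s, hne, h0j2⟩ := h.exists_zero_out (by omega) j₁ hj1 hj1s
  have hlt1 : j₁ < b := by by_contra hlt; exact hO j₁ (by omega) hj1s h0j1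
  have hlt2 : j₂ < b := by by_contra hlt; exact hO j₂ (by omega) hj2s h0j2
  obtain ⟨x, y, hx, hxb, hby, hys, hxy⟩ : ∃ x y, 1 ≤ x ∧ x + 2 ≤ b ∧ b < y ∧ y ≤ s ∧ B x y := by
    obtain ⟨x, y, hx, hxb, hby, hys, hxy⟩ := h.exists_jump (k := b - 1) (by omega) (by omega)
      (Or.inr fun j h1 h2 => hO j (by omega) h2)
    by_cases hyb : y = b
    · subst hyb
      obtain ⟨x', y', hx', hxb', hby', hys', hxy'⟩ := h.exists_jump hb1 hbs
        (Or.inr fun j h1 h2 => hO j (by omega) h2)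
      by_cases hxb2 : x' + 2 ≤ y
      · exact ⟨x', y', hx', hxb2, hby', hys', hxy'⟩
      · obtain rfl : x' = y - 1 := by omega
        exfalso
        refine h.not_links x [(y, y' - 1), (s + 1, s + 1), (s + 2, s + 2), (x + 1, y - 1), (y', s)]
          ⟨hxy, h.from_one (by omega) (by omega), h.twin, h.to_two (by omega) (by omega), hxy',
            h.back⟩ ?_ ?_
        · simp only [Fits, Avoids, or_true, and_true, true_and]; omega
        · simp only [blocksLength]; omega
    · exact ⟨x, y, hx, by omega, by omega, hys, hxy⟩
  have hI1 : ¬ B (y - 1) 0 := fun hi =>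
    h.not_jump_in hx (Nat.lt_succ_self x) (by omega) (by omega) hys hxy (by omega) hi (by omega)
  have hI2 : ¬ B (y - 2) 0 := fun hi =>
    h.not_jump_in hx (Nat.lt_succ_self x) (by omega) (by omega) hys hxy (by omega) hi (by omega)
  have hnd : ∀ k, 1 ≤ k → k ≤ s + 1 → k ≠ y - 1 → k ≠ y →
      (k ≤ s ∧ B 0 k) ∨ (2 ≤ k ∧ B (k - 1) 0) := by
    intro k h1 h2 h3 h4
    by_contra! hk
    exact h.not_three_defects (k₁ := y - 1) (k₂ := y) (k₃ := k) (by omega) (by omega) (by omega)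
      ⟨by omega, by omega, fun _ => hO _ (by omega) (by omega), fun _ => hI2⟩
      ⟨by omega, by omega, fun _ => hO _ (by omega) (by omega), fun _ => hI1⟩ ⟨h1, h2, hk.1, hk.2⟩
  obtain ⟨a, ha, hab, h0a, hmax⟩ : ∃ a, 2 ≤ a ∧ a < b ∧ B 0 a ∧ ∀ k, a < k → k ≤ s → ¬ B 0 k := by
    classical
    have h1 : j₁ ≤ Nat.findGreatest (fun k => B 0 k) s := Nat.le_findGreatest hj1s h0j1
    have h2 : j₂ ≤ Nat.findGreatest (fun k => B 0 k) s := Nat.le_findGreatest hj2s h0j2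
    have h3 : B 0 (Nat.findGreatest (fun k => B 0 k) s) :=
      Nat.findGreatest_spec (P := fun k => B 0 k) hj1s h0j1
    have h4 := Nat.findGreatest_le (P := fun k => B 0 k) s
    refine ⟨_, by omega, ?_, h3, fun k hk1 hk2 => Nat.findGreatest_is_greatest hk1 hk2⟩
    by_contra hlt
    exact hO _ (by omega) h4 h3
  have hIa : ∀ i, 1 ≤ i → i < a → ¬ B i 0 := by
    intro i hi hia hi0
    obtain ⟨k, hk1, hk2, hk3, hk4⟩ := h.defect_between hi hia (by omega) hi0 h0a
    rcases hnd k (by omega) (by omega) (by omega) (by omega) with hk | hk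
    · exact hk3 hk.2
    · exact hk4 hk.2
  have hOa : ∀ k, 1 ≤ k → k ≤ a → B 0 k := by
    intro k hk1 hk2
    rcases hnd k (by omega) (by omega) (by omega) (by omega) with hk | hk
    · exact hk.2
    · exact absurd hk.2 (hIa _ (by omega) (by omega))
  have hxa : a ≤ x := by
    by_contra hlt
    exact h.not_jump_out hx (Nat.lt_succ_self x) (show x + 1 ≤ y - 1 by omega) (by omega) hys hxy
      (hOa _ (by omega) (by omega)) (by omega) (by omega)
  obtain ⟨x', y', hx', hxa', hay', hys', hxy'⟩ := h.exists_jump (k := a) (by omega) (by omega)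
    (Or.inr fun j h1 h2 => hmax j h1 h2)
  have hyb' : y' ≤ b := by
    by_contra hlt
    exact h.not_jump_out hx' (Nat.lt_succ_self x') (show x' + 1 ≤ y' - 1 by omega) (by omega) hys'
      hxy' (hOa _ (by omega) (by omega)) (by omega) (by omega)
  by_cases hy' : y' = y - 1
  · have hi : B (y' - 2) 0 := by
      rcases hnd (y' - 1) (by omega) (by omega) (by omega) (by omega) with hk | hk
      · exact absurd hk.2 (hmax _ (by omega) (by omega))
      · exact hk.2
    exact h.not_jump_in hx' (Nat.lt_succ_self x') (by omega) (by omega) hys' hxy' (by omega) hi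
      (by omega)
  · have hi : B (y' - 1) 0 := by
      rcases hnd y' (by omega) (by omega) (by omega) (by omega) with hk | hk
      · exact absurd hk.2 (hmax _ (by omega) (by omega))
      · exact hk.2
    exact h.not_jump_in hx' (Nat.lt_succ_self x') (by omega) (by omega) hys' hxy' (by omega) hi
      (by omega)

theorem exists_in_le (h : Twins B s b) : ∃ j, 1 ≤ j ∧ j ≤ b ∧ B j 0 := by
  obtain ⟨j, h1, h2, h3⟩ := h.rev.exists_out_ge
  have := h.one_lt
  have := h.lt
  rw [Cfg.mirror_of_le (by omega) h2] at h3
  exact ⟨s + 1 - j, by omega, by omega, h3⟩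

/-- The numbering obtained by exchanging the twins with the vertices `i + 1`, `i + 2`. -/
def exchange (s i k : ℕ) : ℕ :=
  if k = 0 then 0 else if k + i ≤ s then k + i + 2 else k + i - s

theorem exchange_zero {s i : ℕ} : exchange s i 0 = 0 := rfl

theorem exchange_of_le {s i k : ℕ} (hk : 1 ≤ k) (h : k + i ≤ s) : exchange s i k = k + i + 2 := by
  unfold exchange; split_ifs <;> omega

theorem exchange_of_lt {s i k : ℕ} (hk : 1 ≤ k) (h : s < k + i) : exchange s i k = k + i - s := by
  unfold exchange; split_ifs <;> omega

theorem false_of_out_le (h : Twins B s b) (hO : ∀ j, b < j → j ≤ s → ¬ B 0 j) : False := by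
  have hb1 := h.one_lt
  have hbs := h.lt
  have h0b : B 0 b := by
    obtain ⟨j, h1, h2, h3⟩ := h.exists_out_ge
    rcases Nat.eq_or_lt_of_le h1 with rfl | h1
    · exact h3
    · exact absurd h3 (hO j h1 h2)
  obtain ⟨x, y, hx, hxb, hby, hys, hxy⟩ := h.exists_jump hb1 hbs (Or.inr hO)
  have hO1 : ¬ B 0 (x + 1) := fun ho => h.not_jump_out hx (Nat.lt_succ_self x)
    (show x + 1 ≤ y - 1 by omega) (by omega) hys hxy ho (by omega) (by omega)
  have hx1 : x + 1 ≠ b := by rintro rfl; exact hO1 h0b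
  have hO2 : ¬ B 0 (x + 2) := fun ho => h.not_jump_out hx (show x < x + 2 by omega)
    (show x + 2 ≤ y - 1 by omega) (by omega) hys hxy ho (by omega) (by omega)
  have hx2 : x + 2 ≠ b := by rintro rfl; exact hO2 h0b
  have hI1 : ¬ B (y - 1) 0 := fun hi =>
    h.not_jump_in hx (Nat.lt_succ_self x) (by omega) (by omega) hys hxy (by omega) hi (by omega)
  have hI2 : ¬ B (y - 2) 0 := fun hi =>
    h.not_jump_in hx (Nat.lt_succ_self x) (by omega) (by omega) hys hxy (by omega) hi (by omega)
  obtain rfl : y = b + 1 := by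
    by_contra hyb
    have hnd : ∀ k, 1 ≤ k → k ≤ s + 1 → k ≠ y - 1 → k ≠ y →
        (k ≤ s ∧ B 0 k) ∨ (2 ≤ k ∧ B (k - 1) 0) := by
      intro k h1 h2 h3 h4
      by_contra! hk
      exact h.not_three_defects (k₁ := y - 1) (k₂ := y) (k₃ := k) (by omega) (by omega) (by omega)
        ⟨by omega, by omega, fun _ => hO _ (by omega) (by omega), fun _ => hI2⟩
        ⟨by omega, by omega, fun _ => hO _ (by omega) (by omega), fun _ => hI1⟩
        ⟨h1, h2, hk.1, hk.2⟩
    have hi : B (x + 1) 0 := by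
      rcases hnd (x + 2) (by omega) (by omega) (by omega) (by omega) with hk | hk
      · exact absurd hk.2 hO2
      · exact hk.2
    obtain ⟨k, hk1, hk2, hk3, hk4⟩ := h.defect_between (by omega) (by omega) hbs.le hi h0b
    rcases hnd k (by omega) (by omega) (by omega) (by omega) with hk | hk
    · exact hk3 hk.2
    · exact hk4 hk.2
  rw [show b + 1 - 1 = b by omega] at hI1
  rw [show b + 1 - 2 = b - 1 by omega] at hI2
  have hnd : ∀ k l, 1 ≤ k → k < l → l ≤ b →
      B 0 k ∨ (2 ≤ k ∧ B (k - 1) 0) ∨ B 0 l ∨ (2 ≤ l ∧ B (l - 1) 0) := by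
    intro k l h1 h2 h3
    by_contra! hk
    exact h.not_three_defects (k₁ := k) (k₂ := l) (k₃ := b + 1) (by omega) (by omega) (by omega)
      ⟨by omega, by omega, fun _ => hk.1, hk.2.1⟩ ⟨by omega, by omega, fun _ => hk.2.2.1, hk.2.2.2⟩
      ⟨by omega, by omega, fun h4 => hO _ (by omega) h4, fun _ => hI1⟩
  obtain ⟨i₀, hi0, hi0b, hi00⟩ : ∃ i, 1 ≤ i ∧ i < b ∧ B i 0 := by
    rcases hnd (x + 1) (x + 2) (by omega) (by omega) (by omega) with hk | hk | hk | hk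
    · exact absurd hk hO1
    · exact ⟨x, hx, by omega, hk.2⟩
    · exact absurd hk hO2
    · exact ⟨x + 1, by omega, by omega, hk.2⟩
  classical
  obtain ⟨i, hi, hib, hiz, himax⟩ : ∃ i, 1 ≤ i ∧ i < b ∧ B i 0 ∧ ∀ k, i < k → k ≤ b → ¬ B k 0 := by
    have h1 : i₀ ≤ Nat.findGreatest (fun k => B k 0) (b - 1) := Nat.le_findGreatest (by omega) hi00
    have h2 := Nat.findGreatest_le (P := fun k => B k 0) (b - 1)
    refine ⟨Nat.findGreatest (fun k => B k 0) (b - 1), by omega, by omega,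
      Nat.findGreatest_spec (P := fun k => B k 0) (m := i₀) (by omega) hi00, fun k hk1 hk2 => ?_⟩
    rcases Nat.eq_or_lt_of_le hk2 with rfl | hk2
    · exact hI1
    · exact Nat.findGreatest_is_greatest (P := fun k => B k 0) (n := b - 1) hk1 (by omega)
  have hex : ∃ j, i < j ∧ B 0 j := ⟨b, hib, h0b⟩
  obtain ⟨j, hj⟩ : ∃ j, j = Nat.find hex := ⟨_, rfl⟩
  obtain ⟨hij, h0j⟩ : i < j ∧ B 0 j := hj ▸ Nat.find_spec hex
  have hjmin : ∀ k, i < k → k < j → ¬ B 0 k := fun k h1 h2 h3 =>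
    Nat.find_min hex (hj ▸ h2) ⟨h1, h3⟩
  have hjb : j ≤ b := hj ▸ Nat.find_min' hex ⟨hib, h0b⟩
  have hgap := h.gap hi hij (by omega) hiz h0j
  have hO3 : ¬ B 0 (i + 2) := hjmin _ (by omega) (by omega)
  have hI3 : ¬ B (i + 1) 0 := himax _ (by omega) (by omega)
  obtain rfl : j = i + 3 := by
    by_contra hne
    rcases hnd (i + 2) (i + 3) (by omega) (by omega) (by omega) with hk | hk | hk | hk
    · exact hO3 hk
    · exact hI3 hk.2
    · exact hjmin (i + 3) (by omega) (by omega) hk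
    · exact himax (i + 2) (by omega) (by omega) hk.2
  have hcfg : Cfg (fun k l => B (exchange s i k) (exchange s i l)) s 2 := by
    refine h.toCfg.reindex _ (fun k hk => ?_) (fun k hk l hl hkl => ?_) rfl (fun k hk => ?_) ?_
    · unfold exchange; split_ifs <;> omega
    · unfold exchange at hkl; split_ifs at hkl <;> omega
    · rcases Nat.eq_zero_or_pos k with rfl | hk0
      · rw [exchange_zero, exchange_of_le (by omega) (by omega),
          show 0 + 1 + i + 2 = i + 3 by omega]
        exact h0j
      · by_cases h1 : k + 1 + i ≤ s
        · rw [exchange_of_le hk0 (by omega), exchange_of_le (by omega) h1,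
            show k + 1 + i + 2 = k + i + 2 + 1 by omega]
          by_cases h2 : k + i + 2 < s
          · exact h.arc _ h2
          · obtain h2 | h2 : k + i + 2 = s ∨ k + i + 2 = s + 1 := by omega
            · rw [h2]; exact h.from_one hbs.le le_rfl
            · rw [h2]; exact h.twin
        · rw [exchange_of_lt (k := k + 1) (by omega) (by omega)]
          by_cases h2 : k + i = s
          · rw [exchange_of_le hk0 (by omega), show k + 1 + i - s = 1 by omega,
              show k + i + 2 = s + 2 by omega]
            exact h.to_two le_rfl (by omega)
          · rw [exchange_of_lt hk0 (by omega), show k + 1 + i - s = k + i - s + 1 by omega]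
            exact h.arc _ (by omega)
    · rw [exchange_of_lt (by omega) (by omega), show s + i - s = i by omega]
      exact hiz
  obtain ⟨c, hc⟩ := hcfg.exists_twins
  have hc1 := hc.one_lt
  have hcs := hc.lt
  have hcb : c + i + 2 < s + 1 := by
    have h1 : exchange s i (s - i - 1) = s + 1 := by
      rw [exchange_of_le (by omega) (by omega)]; omega
    have h2 : exchange s i (s + 1) = i + 1 := by
      rw [exchange_of_lt (by omega) (by omega)]; omega
    have h3 := hc.out (s + 1) (by omega) (by omega) (s - i - 1) (by omega) (by omega)
    have h4 := hc.inn (s + 1) (by omega) (by omega) (s - i - 1) (by omega) (by omega)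
    simp only [h1, h2] at h3 h4
    have h5 := h4.1 (h.to_one (by omega) (by omega))
    have h6 : ¬ B (i + 1) (s + 1) := fun h6 => by
      have := (h.inn (s + 1) (by omega) (by omega) (i + 1) (by omega) (by omega)).1 h6
      omega
    have h7 : ¬ s - i - 1 ≤ c := fun h7 => h6 (h3.2 h7)
    omega
  by_cases hcb' : c + i + 2 ≤ b
  · obtain ⟨l, hl1, hl2, hl0⟩ := hc.exists_in_le
    rw [exchange_of_le hl1 (by omega)] at hl0
    exact himax _ (by omega) (by omega) hl0
  · have h1 : B (i + 2) (b + 1) := by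
      have h3 := hc.out (s + 2) (by omega) (by omega) (b - i - 1) (by omega) (by omega)
      rw [exchange_of_lt (by omega) (by omega), exchange_of_le (by omega) (by omega),
        show s + 2 + i - s = i + 2 by omega, show b - i - 1 + i + 2 = b + 1 by omega] at h3
      exact h3.2 (by omega)
    refine h.not_links 0 [(i + 3, b), (s + 1, s + 1), (s + 2, s + 2), (1, i + 2), (b + 1, s)]
      ⟨h0j, h.from_one le_rfl (by omega), h.twin, h.to_two le_rfl (by omega), h1, h.back⟩ ?_ ?_
    · simp only [Fits, Avoids, or_true, and_true, true_and]; omega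
    · simp only [blocksLength]; omega

end Twins

theorem Cfg.false_of_two {B : ℕ → ℕ → Prop} {s : ℕ} (h : Cfg B s 2) : False := by
  obtain ⟨b, hb⟩ := h.exists_twins
  have h1 := hb.one_lt
  have h2 := hb.lt
  by_cases hO : ∀ j, b < j → j ≤ s → ¬ B 0 j
  · exact hb.false_of_out_le hO
  · refine hb.rev.false_of_out_le fun j hj hjs h0 => hO fun y hy hys h0y => ?_
    rw [Cfg.mirror_of_le (by omega) hjs] at h0
    exact hb.not_cross (by omega) (show s + 1 - j < b by omega) hy hys h0 h0y

/-- Position `k` is lost in counting the arcs between `1, …, s` and a vertex with out-neighbours `O`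
and in-neighbours `I`. -/
def Lost (O I : ℕ → Prop) (s k : ℕ) : Prop := (k ≤ s → ¬ O k) ∧ (2 ≤ k → ¬ I (k - 1))

theorem exists_turn_except {O I : ℕ → Prop} {s : ℕ}
    (hle : ∀ i j, 1 ≤ i → i ≤ s → 1 ≤ j → j ≤ s → I i → O j → j ≤ i)
    (hd : ∀ k l, 1 ≤ k → k < l → l ≤ s + 1 → Lost O I s k → ¬ Lost O I s l)
    (hO : ∃ j, 1 ≤ j ∧ j ≤ s ∧ O j) :
    ∃ b d, 1 ≤ b ∧ b ≤ s ∧ O b ∧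
      ∀ k, 1 ≤ k → k ≤ s → (O k ↔ k ≤ b ∧ k ≠ d) ∧ (I k ↔ b ≤ k ∧ k + 1 ≠ d) := by
  classical
  obtain ⟨b, hb1, hbs, hOb, hmax⟩ : ∃ b, 1 ≤ b ∧ b ≤ s ∧ O b ∧ ∀ k, b < k → k ≤ s → ¬ O k := by
    obtain ⟨j, hj1, hjs, hOj⟩ := hO
    have := Nat.le_findGreatest (P := O) hjs hOj
    exact ⟨Nat.findGreatest O s, by omega, Nat.findGreatest_le s, Nat.findGreatest_spec hjs hOj,
      fun k hk hks => Nat.findGreatest_is_greatest hk hks⟩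
  obtain ⟨d, hd1, hd2⟩ : ∃ d, (∀ k, 1 ≤ k → k ≤ s + 1 → k ≠ d → ¬ Lost O I s k) ∧
      (1 ≤ d → Lost O I s d) := by
    by_cases hex : ∃ d, 1 ≤ d ∧ d ≤ s + 1 ∧ Lost O I s d
    · obtain ⟨d, h1, h2, h3⟩ := hex
      refine ⟨d, fun k hk hks hkd hl => ?_, fun _ => h3⟩
      rcases Nat.lt_or_gt_of_ne hkd with h | h
      · exact hd k d hk h h2 hl h3
      · exact hd d k h1 h hks h3 hl
    · push Not at hex
      exact ⟨0, fun k hk hks _ => hex k hk hks, fun h => absurd h (by omega)⟩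
  refine ⟨b, d, hb1, hbs, hOb, fun k hk hks => ⟨⟨fun hOk => ⟨?_, ?_⟩, fun ⟨hkb, hkd⟩ => ?_⟩,
    ⟨fun hIk => ⟨hle k b hk hks hb1 hbs hIk hOb, ?_⟩, fun ⟨hbk, hkd⟩ => ?_⟩⟩⟩
  · by_contra hlt
    exact hmax k (by omega) hks hOk
  · rintro rfl
    exact (hd2 hk).1 hks hOk
  · by_contra hOk
    refine hd1 k hk (by omega) hkd ⟨fun _ => hOk, fun h2 hI => ?_⟩
    have := hle (k - 1) b (by omega) (by omega) hb1 hbs hI hOb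
    omega
  · rintro rfl
    exact (hd2 (by omega)).2 (by omega) hIk
  · by_contra hIk
    exact hd1 (k + 1) (by omega) (by omega) hkd ⟨fun h => hmax _ (by omega) h, fun _ => hIk⟩

/-- Some vertex outside the cycle has an arc to `k`. -/
def Enters (B : ℕ → ℕ → Prop) (s r k : ℕ) : Prop := ∃ x ∈ Set.Ioc s (s + r), B x k

/-- Some vertex outside the cycle has an arc from `k`. -/
def Leaves (B : ℕ → ℕ → Prop) (s r k : ℕ) : Prop := ∃ x ∈ Set.Ioc s (s + r), B k x

/-- A configuration with three outside vertices, spanned by paths between all possible ends. -/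
structure Triple (B : ℕ → ℕ → Prop) (s : ℕ) : Prop extends Cfg B s 3 where
  le : ∀ i j, 1 ≤ i → i ≤ s → 1 ≤ j → j ≤ s → Leaves B s 3 i → Enters B s 3 j → j ≤ i
  lost : ∀ k l, 1 ≤ k → k < l → l ≤ s + 1 → Lost (Enters B s 3) (Leaves B s 3) s k →
    ¬ Lost (Enters B s 3) (Leaves B s 3) s l
  path : ∀ i j, 1 ≤ i → i ≤ s → 1 ≤ j → j ≤ s → Leaves B s 3 i → Enters B s 3 j →
    ∃ x y t, s < x ∧ x ≤ s + 3 ∧ s < y ∧ y ≤ s + 3 ∧ s < t ∧ t ≤ s + 3 ∧ x ≠ y ∧ x ≠ t ∧ y ≠ t ∧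
      B i x ∧ B x y ∧ B y t ∧ B t j

theorem Cfg.triple {B : ℕ → ℕ → Prop} {s : ℕ} (h : Cfg B s 3) : Triple B s := by
  classical
  have hR : Finset.Ioc s (s + 3) = {s + 1, s + 2, s + 3} := by
    ext k; simp; omega
  have hdeg : ∀ x, degOn B x (Finset.Ioc s (s + 3))
      = arcs B x (s + 1) + arcs B x (s + 2) + arcs B x (s + 3) := by
    intro x
    rw [hR, degOn, Finset.sum_insert (by simp), Finset.sum_insert (by simp),
      Finset.sum_singleton, add_assoc]
  have hmem : ∀ x, s < x → x ≤ s + 3 → x ∈ Set.Ioc s (s + 3) := fun x h1 h2 => ⟨h1, h2⟩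
  have hcount : ∀ x ∈ Set.Ioc s (s + 3), ∀ M : Finset ℕ,
      (∀ k ∈ M, 1 ≤ k ∧ k ≤ s + 1 ∧ (k ≤ s → ¬ B x k) ∧ (2 ≤ k → ¬ B (k - 1) x)) →
      M.card + 3 ≤ arcs B x (s + 1) + arcs B x (s + 2) + arcs B x (s + 3) := by
    intro x hx M hM
    have h1 := h.le_degOn_of_outside hx
    have h2 := h.degOn_Icc_le hx M hM
    rw [hdeg] at h1
    omega
  have a1 := h.irrefl (s + 1)
  have a2 := h.irrefl (s + 2)
  have a3 := h.irrefl (s + 3)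
  have hreach : ∀ x ∈ Set.Ioc s (s + 3), ∀ y ∈ Set.Ioc s (s + 3),
      ReachIn B (Set.Ioc s (s + 3)) x y := by
    have c1 := hcount (s + 1) ⟨by omega, by omega⟩ ∅ (by simp)
    have c2 := hcount (s + 2) ⟨by omega, by omega⟩ ∅ (by simp)
    have c3 := hcount (s + 3) ⟨by omega, by omega⟩ ∅ (by simp)
    have step : ∀ x ∈ Set.Ioc s (s + 3), ∀ y ∈ Set.Ioc s (s + 3), x = y ∨ B x y ∨
        ∃ t ∈ Set.Ioc s (s + 3), B x t ∧ B t y := by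
      intro x hx y hy
      obtain rfl | rfl | rfl : x = s + 1 ∨ x = s + 2 ∨ x = s + 3 := by
        have := hx.1; have := hx.2; omega
      all_goals
        obtain rfl | rfl | rfl : y = s + 1 ∨ y = s + 2 ∨ y = s + 3 := by
          have := hy.1; have := hy.2; omega
      all_goals
        by_contra! hno
        have n1 := hno.2.2 (s + 1) ⟨by omega, by omega⟩
        have n2 := hno.2.2 (s + 2) ⟨by omega, by omega⟩
        have n3 := hno.2.2 (s + 3) ⟨by omega, by omega⟩
        have n0 := hno.2.1
        have n0' := hno.1
        clear hno hcount hdeg hR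
        simp only [arcs] at c1 c2 c3
        grind
    intro x hx y hy
    rcases step x hx y hy with rfl | hxy | ⟨t, ht, hxt, hty⟩
    · exact .refl
    · exact .single ⟨hx, hy, hxy⟩
    · exact .tail (.single ⟨hx, ht, hxt⟩) ⟨ht, hy, hty⟩
  have hle : ∀ i j, 1 ≤ i → i ≤ s → 1 ≤ j → j ≤ s → Leaves B s 3 i → Enters B s 3 j → j ≤ i := by
    rintro i j - - - hj ⟨x, hx, hix⟩ ⟨y, hy, hyj⟩
    by_contra hlt
    exact h.not_forward (by omega) hj hx (hreach x hx y hy) hix hyj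
  have hs1 : s + 1 ∈ Set.Ioc s (s + 3) := ⟨by omega, by omega⟩
  refine ⟨h, hle, fun k l hk hkl hl hk' hl' => ?_, fun i j hi his hj hjs hI hO => ?_⟩
  · have c := hcount (s + 1) hs1 {k, l} (by
      intro m hm
      obtain rfl | rfl : m = k ∨ m = l := by simpa using hm
      · exact ⟨hk, by omega, fun h1 h2 => hk'.1 h1 ⟨_, hs1, h2⟩,
          fun h1 h2 => hk'.2 h1 ⟨_, hs1, h2⟩⟩
      · exact ⟨by omega, hl, fun h1 h2 => hl'.1 h1 ⟨_, hs1, h2⟩,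
          fun h1 h2 => hl'.2 h1 ⟨_, hs1, h2⟩⟩)
    rw [Finset.card_pair hkl.ne, arcs_self h.irrefl] at c
    have := arcs_le_two (A := B) (s + 1) (s + 2)
    have := arcs_le_two (A := B) (s + 1) (s + 3)
    omega
  · have hji := hle i j hi his hj hjs hI hO
    have key : ∀ x ∈ Set.Ioc s (s + 3),
        (if B i x then 0 else 1) + (if B x j then 0 else 1) + 3
          ≤ arcs B x (s + 1) + arcs B x (s + 2) + arcs B x (s + 3) := by
      intro x hx
      have d1 : ¬ B i x → 1 ≤ i + 1 ∧ i + 1 ≤ s + 1 ∧ (i + 1 ≤ s → ¬ B x (i + 1)) ∧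
          (2 ≤ i + 1 → ¬ B (i + 1 - 1) x) := fun hn => ⟨by omega, by omega, fun h1 h2 => by
        have := hle i (i + 1) hi his (by omega) h1 hI ⟨x, hx, h2⟩
        omega, fun _ => by simpa using hn⟩
      have d2 : ¬ B x j → 1 ≤ j ∧ j ≤ s + 1 ∧ (j ≤ s → ¬ B x j) ∧
          (2 ≤ j → ¬ B (j - 1) x) := fun hn => ⟨by omega, by omega, fun _ => hn, fun h1 h2 => by
        have := hle (j - 1) j (by omega) (by omega) hj hjs ⟨x, hx, h2⟩ hO
        omega⟩
      split_ifs with h1 h2 h2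
      · have := hcount x hx ∅ (by simp)
        simpa using this
      · have := hcount x hx {j} (by simpa using d2 h2)
        simpa using this
      · have := hcount x hx {i + 1} (by simpa using d1 h1)
        simpa using this
      · have := hcount x hx {j, i + 1} (by
          intro m hm
          obtain rfl | rfl : m = j ∨ m = i + 1 := by simpa using hm
          · exact d2 h2
          · exact d1 h1)
        rw [Finset.card_pair (by omega)] at this
        omega
    have c1 := key (s + 1) ⟨by omega, by omega⟩
    have c2 := key (s + 2) ⟨by omega, by omega⟩
    have c3 := key (s + 3) ⟨by omega, by omega⟩
    have hI' : B i (s + 1) ∨ B i (s + 2) ∨ B i (s + 3) := by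
      obtain ⟨x, hx, hix⟩ := hI
      obtain rfl | rfl | rfl : x = s + 1 ∨ x = s + 2 ∨ x = s + 3 := by
        have := hx.1; have := hx.2; omega
      all_goals simp [hix]
    have hO' : B (s + 1) j ∨ B (s + 2) j ∨ B (s + 3) j := by
      obtain ⟨x, hx, hxj⟩ := hO
      obtain rfl | rfl | rfl : x = s + 1 ∨ x = s + 2 ∨ x = s + 3 := by
        have := hx.1; have := hx.2; omega
      all_goals simp [hxj]
    by_contra hno
    have n : ∀ x y t, s < x → x ≤ s + 3 → s < y → y ≤ s + 3 → s < t → t ≤ s + 3 → x ≠ y → x ≠ t →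
        y ≠ t → ¬ (B i x ∧ B x y ∧ B y t ∧ B t j) := fun x y t h1 h2 h3 h4 h5 h6 h7 h8 h9 h10 =>
      hno ⟨x, y, t, h1, h2, h3, h4, h5, h6, h7, h8, h9, h10⟩
    have n1 := n (s + 1) (s + 2) (s + 3) (by omega) (by omega) (by omega) (by omega) (by omega)
      (by omega) (by omega) (by omega) (by omega)
    have n2 := n (s + 1) (s + 3) (s + 2) (by omega) (by omega) (by omega) (by omega) (by omega)
      (by omega) (by omega) (by omega) (by omega)
    have n3 := n (s + 2) (s + 1) (s + 3) (by omega) (by omega) (by omega) (by omega) (by omega)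
      (by omega) (by omega) (by omega) (by omega)
    have n4 := n (s + 2) (s + 3) (s + 1) (by omega) (by omega) (by omega) (by omega) (by omega)
      (by omega) (by omega) (by omega) (by omega)
    have n5 := n (s + 3) (s + 1) (s + 2) (by omega) (by omega) (by omega) (by omega) (by omega)
      (by omega) (by omega) (by omega) (by omega)
    have n6 := n (s + 3) (s + 2) (s + 1) (by omega) (by omega) (by omega) (by omega) (by omega)
      (by omega) (by omega) (by omega) (by omega)
    clear hno n key hcount hreach hdeg hR hI hO hle
    simp only [arcs] at c1 c2 c3
    generalize B (s + 1) (s + 2) = x12 at *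
    generalize B (s + 1) (s + 3) = x13 at *
    generalize B (s + 2) (s + 3) = x23 at *
    generalize B (s + 2) (s + 1) = x21 at *
    generalize B (s + 3) (s + 1) = x31 at *
    generalize B (s + 3) (s + 2) = x32 at *
    grind

/-- A triple configuration whose path `1, …, s` may be continued outside at both ends. -/
structure Ends (B : ℕ → ℕ → Prop) (s : ℕ) : Prop extends Triple B s where
  first : Enters B s 3 1
  last : Leaves B s 3 s

/-- The special vertex turns at `a` except at `d`, the outside vertices turn at `b` except
at `e`. -/
structure Turns (B : ℕ → ℕ → Prop) (s a d b e : ℕ) : Prop extends Ends B s where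
  one_lt_a : 1 < a
  a_lt : a < s
  one_lt_b : 1 < b
  b_lt : b < s
  a_ne : a ≠ d
  b_ne : b ≠ e
  a_ne' : d = a + 1 → a + 1 < s
  out : ∀ k, 1 ≤ k → k ≤ s → (B 0 k ↔ k ≤ a ∧ k ≠ d)
  inn : ∀ k, 1 ≤ k → k ≤ s → (B k 0 ↔ a ≤ k ∧ k + 1 ≠ d)
  out' : ∀ k, 1 ≤ k → k ≤ s → (Enters B s 3 k ↔ k ≤ b ∧ k ≠ e)
  inn' : ∀ k, 1 ≤ k → k ≤ s → (Leaves B s 3 k ↔ b ≤ k ∧ k + 1 ≠ e)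

variable {B : ℕ → ℕ → Prop} {s : ℕ}

theorem Triple.exists_enters (h : Triple B s) (k : ℕ) (hk : k ≤ s) :
    ∃ j, 1 ≤ j ∧ j ≤ s ∧ j ≠ k ∧ Enters B s 3 j := by
  obtain ⟨y, j, hy, -, hj, hjk, hyj⟩ := h.exists_exit hk (x := s + 1) ⟨by omega, by omega⟩
  have hj0 : j ≠ 0 := fun h0 => h.not_zero_in hy (h0 ▸ hyj)
  exact ⟨j, by omega, hj, hjk, y, hy, hyj⟩

theorem Triple.exists_leaves (h : Triple B s) (k : ℕ) (hk : k ≤ s) :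
    ∃ j, 1 ≤ j ∧ j ≤ s ∧ j ≠ k ∧ Leaves B s 3 j := by
  obtain ⟨y, j, hy, -, hj, hjk, hyj⟩ := h.exists_entry hk (x := s + 1) ⟨by omega, by omega⟩
  have hj0 : j ≠ 0 := fun h0 => h.not_zero_out hy (h0 ▸ hyj)
  exact ⟨j, by omega, hj, hjk, y, hy, hyj⟩

theorem Cfg.exists_zero_in {r : ℕ} (h : Cfg B s r) (hs : 2 ≤ s) (k : ℕ) (hk : 1 ≤ k) (hks : k ≤ s) :
    ∃ j, 1 ≤ j ∧ j ≤ s ∧ j ≠ k ∧ B j 0 := by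
  obtain ⟨j, h1, h2, h3, h4⟩ := h.rev.exists_zero_out hs (s + 1 - k) (by omega) (by omega)
  rw [Cfg.mirror_of_le h1 h2] at h4
  exact ⟨s + 1 - j, by omega, by omega, by omega, h4⟩

theorem enters_rev (k : ℕ) (hk : 1 ≤ k) (hks : k ≤ s) :
    Enters (fun i j => B (Cfg.mirror s 3 j) (Cfg.mirror s 3 i)) s 3 k ↔
      Leaves B s 3 (s + 1 - k) := by
  constructor <;> rintro ⟨x, hx, h⟩ <;> have h1 := hx.1 <;> have h2 := hx.2
  · rw [Cfg.mirror_of_le hk hks, Cfg.mirror_of_lt h1] at h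
    exact ⟨_, ⟨by omega, by omega⟩, h⟩
  · refine ⟨2 * s + 4 - x, ⟨by omega, by omega⟩, ?_⟩
    beta_reduce
    rw [Cfg.mirror_of_le hk hks, Cfg.mirror_of_lt (by omega),
      show 2 * s + 3 + 1 - (2 * s + 4 - x) = x by omega]
    exact h

theorem leaves_rev (k : ℕ) (hk : 1 ≤ k) (hks : k ≤ s) :
    Leaves (fun i j => B (Cfg.mirror s 3 j) (Cfg.mirror s 3 i)) s 3 k ↔
      Enters B s 3 (s + 1 - k) := by
  constructor <;> rintro ⟨x, hx, h⟩ <;> have h1 := hx.1 <;> have h2 := hx.2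
  · rw [Cfg.mirror_of_le hk hks, Cfg.mirror_of_lt h1] at h
    exact ⟨_, ⟨by omega, by omega⟩, h⟩
  · refine ⟨2 * s + 4 - x, ⟨by omega, by omega⟩, ?_⟩
    beta_reduce
    rw [Cfg.mirror_of_le hk hks, Cfg.mirror_of_lt (by omega),
      show 2 * s + 3 + 1 - (2 * s + 4 - x) = x by omega]
    exact h

namespace Ends

theorem rev (h : Ends B s) : Ends (fun i j => B (Cfg.mirror s 3 j) (Cfg.mirror s 3 i)) s where
  toTriple := h.toCfg.rev.triple
  first := by
    have hs := h.pos
    rw [enters_rev 1 le_rfl hs]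
    exact h.last
  last := by
    have hs := h.pos
    rw [leaves_rev s hs le_rfl, show s + 1 - s = 1 by omega]
    exact h.first

theorem gap (h : Ends B s) {i j : ℕ} (hi : 1 ≤ i) (hij : i < j) (hj : j ≤ s) (hi0 : B i 0)
    (h0j : B 0 j) : i + 4 ≤ j := by
  have hs := h.pos
  obtain ⟨x, y, t, hx, hx', hy, hy', ht, ht', hxy', hxt', hyt', hsx, hxy, hyt, ht1⟩ :=
    h.path s 1 hs le_rfl le_rfl hs h.last h.first
  by_contra hlt
  refine h.not_links 0 [(j, s), (x, x), (y, y), (t, t), (1, i)] ⟨h0j, hsx, hxy, hyt, ht1, hi0⟩ ?_ ?_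
  · simp only [Fits, Avoids, or_true, and_true, true_and]; omega
  · simp only [blocksLength]; omega

/-- Rerouting along an arc `p → q` through the outside vertices and the special vertex. -/
theorem not_jump_in (h : Ends B s) {p q o i : ℕ} (hp : 1 ≤ p) (hpo : p < o) (hoi : o ≤ i)
    (hiq : i < q) (hq : q ≤ s) (hpq : B p q) (ho : Enters B s 3 o) (hi : B i 0)
    (hlost : o + q ≤ p + i + 4) : False := by
  have hs := h.pos
  obtain ⟨x, y, t, hx, hx', hy, hy', ht, ht', hxy', hxt', hyt', hsx, hxy, hyt, hto⟩ :=
    h.path s o hs le_rfl (by omega) (by omega) h.last ho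
  refine h.not_links p [(q, s), (x, x), (y, y), (t, t), (o, i)] ⟨hpq, hsx, hxy, hyt, hto, hi⟩ ?_ ?_
  · simp only [Fits, Avoids, or_true, and_true, true_and]; omega
  · simp only [blocksLength]; omega

theorem not_jump_out (h : Ends B s) {p q o i : ℕ} (hp : 1 ≤ p) (hpo : p < o) (hoi : o ≤ i)
    (hiq : i < q) (hq : q ≤ s) (hpq : B p q) (ho : B 0 o) (hi : Leaves B s 3 i)
    (hlost : o + q ≤ p + i + 4) : False := by
  have hs := h.pos
  obtain ⟨x, y, t, hx, hx', hy, hy', ht, ht', hxy', hxt', hyt', hix, hxy, hyt, ht1⟩ :=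
    h.path i 1 (by omega) (by omega) le_rfl hs hi h.first
  refine h.not_links 0 [(o, i), (x, x), (y, y), (t, t), (1, p), (q, s)]
    ⟨ho, hix, hxy, hyt, ht1, hpq, h.back⟩ ?_ ?_
  · simp only [Fits, Avoids, or_true, and_true, true_and]; omega
  · simp only [blocksLength]; omega

theorem exists_turns (h : Ends B s) (hs : 2 ≤ s) : ∃ a d b e, Turns B s a d b e := by
  have hcount : ∀ k l, 1 ≤ k → k < l → l ≤ s + 1 → Lost (fun k => B 0 k) (fun k => B k 0) s k →
      ¬ Lost (fun k => B 0 k) (fun k => B k 0) s l := by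
    intro k l hk hkl hl hk' hl'
    have := h.card_defects_le (fun k h1 h2 h3 h4 => by
      have := h.gap h1 (Nat.lt_succ_self k) h2 h3 h4
      omega) {k, l} (by
        intro m hm
        obtain rfl | rfl : m = k ∨ m = l := by simpa using hm
        · exact ⟨hk, by omega, hk'⟩
        · exact ⟨by omega, hl, hl'⟩)
    rw [Finset.card_pair hkl.ne] at this
    omega
  obtain ⟨a, d, ha1, has, h0a, had⟩ := exists_turn_except (O := fun k => B 0 k)
    (I := fun k => B k 0) (s := s) (fun i j hi his hj hjs hi0 h0j => by
      by_contra hlt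
      obtain ⟨i', j', h1, h2, h3, h4, h5, h6⟩ := exists_closest (O := fun k => B 0 k)
        (I := fun k => B k 0) (Nat.lt_of_not_le hlt) hi0 h0j
      have h7 := h.gap (by omega) h2 (by omega) h4 h5
      exact hcount (i' + 2) (i' + 3) (by omega) (by omega) (by omega)
        ⟨fun _ => (h6 _ (by omega) (by omega)).1, fun _ => (h6 _ (by omega) (by omega)).2⟩
        ⟨fun _ => (h6 _ (by omega) (by omega)).1, fun _ => (h6 _ (by omega) (by omega)).2⟩)
    hcount ⟨1, le_rfl, h.pos, h.arc 0 h.pos⟩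
  obtain ⟨b, e, hb1, hbs, hwb, hbe⟩ := exists_turn_except h.le h.lost ⟨1, le_rfl, h.pos, h.first⟩
  obtain ⟨j₁, hj1, hj1s, hj1', h0j1⟩ := h.exists_zero_out hs 1 le_rfl h.pos
  obtain ⟨j₂, hj2, hj2s, hj2', h0j2⟩ := h.exists_zero_in hs s h.pos le_rfl
  obtain ⟨j₃, hj3, hj3s, hj3', h0j3⟩ := h.exists_enters 1 h.pos
  obtain ⟨j₄, hj4, hj4s, hj4', h0j4⟩ := h.exists_leaves s le_rfl
  have h1 := (had j₁ hj1 hj1s).1.1 h0j1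
  have h2 := (had j₂ hj2 hj2s).2.1 h0j2
  have h3 := (hbe j₃ hj3 hj3s).1.1 h0j3
  have h4 := (hbe j₄ hj4 hj4s).2.1 h0j4
  exact ⟨a, d, b, e, h, by omega, by omega, by omega, by omega, ((had a ha1 has).1.1 h0a).2,
    ((hbe b hb1 hbs).1.1 hwb).2, by omega, fun k hk hks => (had k hk hks).1,
    fun k hk hks => (had k hk hks).2, fun k hk hks => (hbe k hk hks).1,
    fun k hk hks => (hbe k hk hks).2⟩

end Ends

namespace Turns

variable {a d b e : ℕ}

theorem exists_jump_over (h : Turns B s a d b e) {k : ℕ} (hk1 : 1 < k) (hks : k < s) :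
    ∃ p q, 1 ≤ p ∧ p < k ∧ k < q ∧ q ≤ s ∧ B p q := by
  refine h.exists_jump hk1 hks ?_
  by_cases hka : k ≤ a
  · refine Or.inl fun i h1 h2 h3 => ?_
    have := (h.inn i h1 (by omega)).1 h3
    omega
  · refine Or.inr fun j h1 h2 h3 => ?_
    have := (h.out j (by omega) h2).1 h3
    omega

theorem not_enters (h : Turns B s a d b e) {p q o i : ℕ} (hpq : B p q) (hi : B i 0) (hp : 1 ≤ p)
    (hq : q ≤ s) (hpo : p < o) (hoi : o ≤ i) (hiq : i < q) (hlost : o + q ≤ p + i + 4) :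
    b < o ∨ o = e := by
  by_contra hno
  exact h.not_jump_in hp hpo hoi hiq hq hpq ((h.out' o (by omega) (by omega)).2 (by omega)) hi hlost

theorem not_leaves (h : Turns B s a d b e) {p q o i : ℕ} (hpq : B p q) (ho : B 0 o) (hp : 1 ≤ p)
    (hq : q ≤ s) (hpo : p < o) (hoi : o ≤ i) (hiq : i < q) (hlost : o + q ≤ p + i + 4) :
    i < b ∨ i + 1 = e := by
  by_contra hno
  exact h.not_jump_out hp hpo hoi hiq hq hpq ho
    ((h.inn' i (by omega) (by omega)).2 (by omega)) hlost

theorem jump_eq (h : Turns B s a d b e) {p q : ℕ} (hp : 1 ≤ p) (hpq' : p + 1 < q) (hq : q ≤ s)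
    (hpq : B p q) (ho : B 0 (p + 1)) (hi : B (q - 1) 0) :
    q = p + 2 ∧ ((e = p + 1 ∧ p + 2 ≤ b) ∨ (e = p + 2 ∧ b ≤ p)) := by
  have hbe := h.b_ne
  have n1 := h.not_enters hpq hi hp hq (o := p + 1) (by omega) (by omega) (by omega) (by omega)
  have n2 := h.not_leaves hpq ho hp hq (i := q - 1) (by omega) (by omega) (by omega) (by omega)
  by_cases hpq2 : p + 2 < q
  · have n3 := h.not_enters hpq hi hp hq (o := p + 2) (by omega) (by omega) (by omega) (by omega)
    have n4 := h.not_leaves hpq ho hp hq (i := q - 2) (by omega) (by omega) (by omega) (by omega)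
    omega
  · omega

theorem zero_out (h : Turns B s a d b e) {k : ℕ} (hk : 1 ≤ k) (hka : k ≤ a) (hkd : k ≠ d) : B 0 k :=
  (h.out k hk (by have := h.a_lt; omega)).2 ⟨hka, hkd⟩

theorem zero_in (h : Turns B s a d b e) {k : ℕ} (hk : a ≤ k) (hks : k ≤ s) (hkd : k + 1 ≠ d) :
    B k 0 :=
  (h.inn k (by have := h.one_lt_a; omega) hks).2 ⟨hk, hkd⟩

theorem enters (h : Turns B s a d b e) {k : ℕ} (hk : 1 ≤ k) (hkb : k ≤ b) (hke : k ≠ e) :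
    Enters B s 3 k :=
  (h.out' k hk (by have := h.b_lt; omega)).2 ⟨hkb, hke⟩

theorem leaves (h : Turns B s a d b e) {k : ℕ} (hk : b ≤ k) (hks : k ≤ s) (hke : k + 1 ≠ e) :
    Leaves B s 3 k :=
  (h.inn' k (by have := h.one_lt_b; omega) hks).2 ⟨hk, hke⟩

theorem false_of_eq (h : Turns B s a d b e) (hd : d = a + 1) : False := by
  subst hd
  have ha1 := h.one_lt_a
  have has := h.a_ne' rfl
  have key : ∀ p q, 1 ≤ p → p < a → a + 1 < q → q ≤ s → ¬ B p q := by
    intro p q hp hpa haq hq hpq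
    have := h.jump_eq hp (by omega) hq hpq (h.zero_out (by omega) (by omega) (by omega))
      (h.zero_in (by omega) (by omega) (by omega))
    omega
  obtain ⟨p, q, hp, hpa, haq, hq, hpq⟩ := h.exists_jump_over ha1 h.a_lt
  obtain ⟨p', q', hp', hpa', haq', hq', hpq'⟩ := h.exists_jump_over (k := a + 1) (by omega) has
  obtain rfl : q = a + 1 := by
    by_contra hne
    exact key p q hp hpa (by omega) hq hpq
  obtain rfl : p' = a := by
    by_contra hne
    exact key p' q' hp' (by omega) haq' hq' hpq'
  obtain ⟨x, y, t, hx, hx', hy, hy', ht, ht', hxy', hxt', hyt', hsx, hxy, hyt, ht1⟩ :=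
    h.path s 1 h.pos le_rfl le_rfl h.pos h.last h.first
  refine h.not_links 0 [(p + 1, p'), (q', s), (x, x), (y, y), (t, t), (1, p), (p' + 1, q' - 1)]
    ⟨h.zero_out (by omega) (by omega) (by omega), hpq', hsx, hxy, hyt, ht1, hpq,
      h.zero_in (by omega) (by omega) (by omega)⟩ ?_ ?_
  · simp only [Fits, Avoids, or_true, and_true, true_and]; omega
  · simp only [blocksLength]; omega

/-- The arcs jumping over the turn of the special vertex. -/
theorem jump_over_turn (h : Turns B s a d b e) (hd : d = 0 ∨ a + 1 < d) {p q : ℕ} (hp : 1 ≤ p)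
    (hpa : p < a) (haq : a < q) (hq : q ≤ s) (hpq : B p q) :
    p + 1 = a ∧ ((q = a + 1 ∧ (e = a ∧ a + 1 ≤ b ∨ e = a + 1 ∧ b + 1 ≤ a)) ∨
      (q = a + 2 ∧ d = a + 2 ∧ e = a ∧ a + 2 ≤ b)) := by
  have hbe := h.b_ne
  have ho := h.zero_out (k := p + 1) (by omega) (by omega) (by omega)
  by_cases hqd : q = d
  · have hi := h.zero_in (k := q - 2) (by omega) (by omega) (by omega)
    have n1 := h.not_enters hpq hi hp hq (o := p + 1) (by omega) (by omega) (by omega) (by omega)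
    have n2 := h.not_leaves hpq ho hp hq (i := q - 1) (by omega) (by omega) (by omega) (by omega)
    have n3 := h.not_leaves hpq ho hp hq (i := q - 2) (by omega) (by omega) (by omega) (by omega)
    by_cases hpq2 : p + 3 < q
    · have n4 := h.not_enters hpq hi hp hq (o := p + 2) (by omega) (by omega) (by omega) (by omega)
      omega
    · omega
  · have hi := h.zero_in (k := q - 1) (by omega) (by omega) (by omega)
    have := h.jump_eq hp (by omega) hq hpq ho hi
    omega

end Turns

variable {B : ℕ → ℕ → Prop} {s : ℕ}

theorem toFinset_range'_eq_Icc (a b : ℕ) :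
    (List.range' a (b + 1 - a)).toFinset = Finset.Icc a b := by
  ext k; simp; omega

/-- Insertion of a vertex between consecutive vertices of an interval. -/
theorem exists_insertion_Icc {v a b : ℕ} (hd : b + 1 - a + 2 ≤ degOn B v (Finset.Icc a b)) :
    ∃ i, a ≤ i ∧ i < b ∧ B i v ∧ B v (i + 1) := by
  obtain ⟨L₁, x, y, L₂, hL, hx, hy⟩ := exists_insertion (A := B) (v := v)
    (L := List.range' a (b + 1 - a)) List.nodup_range' (by
      rw [toFinset_range'_eq_Icc, List.length_range']; exact hd)
  have h1 : (List.range' a (b + 1 - a))[L₁.length]? = some x := by simp [hL]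
  have h2 : (List.range' a (b + 1 - a))[L₁.length + 1]? = some y := by
    simp [hL]
  have h3 : L₁.length + 1 < b + 1 - a := by
    have := congrArg List.length hL
    simp at this
    omega
  rw [List.getElem?_range' (by omega)] at h1 h2
  obtain rfl := Option.some.inj h1
  obtain rfl := Option.some.inj h2
  exact ⟨a + 1 * L₁.length, by omega, by omega, hx, by convert hy using 1; omega⟩

namespace Turns

variable {a d b e : ℕ}

theorem le_b (h : Turns B s a d b e) (hd : d = 0 ∨ a + 1 < d) (he : e = a + 1) : ¬ b + 1 ≤ a := by
  intro hba
  have hb1 := h.one_lt_b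
  have has := h.a_lt
  obtain ⟨p, q, hp, hpb, hbq, hq, hpq⟩ := h.exists_jump_over (k := b) hb1 (by omega)
  have ho := h.zero_out (k := p + 1) (by omega) (by omega) (by omega)
  by_cases hqa : q = a + 1
  · have := h.not_leaves hpq ho hp hq (i := a - 1) (by omega) (by omega) (by omega) (by omega)
    omega
  · have := h.not_leaves hpq ho hp hq (i := q - 1) (by omega) (by omega) (by omega) (by omega)
    omega

theorem eq_of_lt_b (h : Turns B s a d b e) (hd : d = 0 ∨ a + 1 < d) (he : e = a) (hb : a < b) :
    d = b + 1 ∧ ∀ p q, 1 ≤ p → p < b → b < q → q ≤ s → B p q →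
      (q = b + 1 ∧ (p + 1 = b ∨ (p + 1 = a ∧ b = a + 1))) := by
  have hbs := h.b_lt
  have ha1 := h.one_lt_a
  have key : ∀ p q, 1 ≤ p → p < b → b < q → q ≤ s → B p q →
      d = b + 1 ∧ (q = b + 1 ∧ (p + 1 = b ∨ (p + 1 = a ∧ b = a + 1))) := by
    intro p q hp hpb hbq hq hpq
    by_cases hqd : q = d
    · have hi := h.zero_in (k := q - 2) (by omega) (by omega) (by omega)
      by_cases hpa : p + 1 = a
      · by_contra hne
        have := h.not_enters hpq hi hp hq (o := p + 2) (by omega) (by omega) (by omega) (by omega)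
        omega
      · by_contra hne
        have := h.not_enters hpq hi hp hq (o := p + 1) (by omega) (by omega) (by omega) (by omega)
        omega
    · have hi := h.zero_in (k := q - 1) (by omega) (by omega) (by omega)
      exfalso
      by_cases hpa : p + 1 = a
      · have := h.not_enters hpq hi hp hq (o := p + 2) (by omega) (by omega) (by omega) (by omega)
        omega
      · have := h.not_enters hpq hi hp hq (o := p + 1) (by omega) (by omega) (by omega) (by omega)
        omega
  obtain ⟨p, q, hp, hpb, hbq, hq, hpq⟩ := h.exists_jump_over (k := b) (by omega) hbs
  exact ⟨(key p q hp hpb hbq hq hpq).1, fun p q h1 h2 h3 h4 h5 => (key p q h1 h2 h3 h4 h5).2⟩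

theorem false_of_ne (h : Turns B s a d b e) (hs : 5 ≤ s) (hd : d = 0 ∨ a + 1 < d) : False := by
  have ha1 := h.one_lt_a
  have has := h.a_lt
  obtain ⟨p, q, hp, hpa, haq, hq, hpq⟩ := h.exists_jump_over ha1 has
  have h1 := h.jump_over_turn hd hp hpa haq hq hpq
  have h2 := h.le_b hd
  obtain rfl : e = a := by omega
  have hab : e < b := by omega
  obtain ⟨rfl, h3⟩ := h.eq_of_lt_b hd rfl hab
  obtain rfl : q = e + 1 := by omega
  obtain rfl : e = p + 1 := by omega
  have hbs := h.b_lt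
  have hjump : ∀ p' q', 1 ≤ p' → p' < p + 1 → p + 1 < q' → q' ≤ s → B p' q' →
      p' = p ∧ q' = p + 2 := by
    intro p' q' h4 h5 h6 h7 h8
    have := h.jump_over_turn hd h4 h5 h6 h7 h8
    omega
  obtain ⟨p₁, q₁, hp1, hpb1, hbq1, hq1, hpq1⟩ := h.exists_jump_over (k := b) (by omega) hbs
  have h4 := h3 p₁ q₁ hp1 hpb1 hbq1 hq1 hpq1
  obtain rfl : q₁ = b + 1 := h4.1
  have h5 : p₁ + 1 = b := by
    rcases h4.2 with h4 | h4
    · exact h4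
    · have := hjump p₁ (b + 1) hp1 (by omega) (by omega) hq1 hpq1
      omega
  obtain ⟨x, y, t, hx, hx', hy, hy', ht, ht', hxy', hxt', hyt', hsx, hxy, hyt, ht1⟩ :=
    h.path s 1 h.pos le_rfl le_rfl h.pos h.last h.first
  by_cases hbp : b = p + 2
  · subst hbp
    obtain rfl : p₁ = p + 1 := by omega
    by_cases hB : p + 4 ≤ s
    · obtain ⟨p', q', hp', hpk, hkq, hq', hpq'⟩ := h.exists_jump_over (k := p + 3) (by omega)
        (by omega)
      have h6 : ¬ p' < p + 1 := fun hlt => by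
        have := hjump p' q' hp' hlt (by omega) hq' hpq'
        omega
      obtain rfl | rfl : p' = p + 1 ∨ p' = p + 2 := by omega
      · refine h.not_links 0 [(p + 1, p + 1), (q', s), (x, x), (y, y), (t, t), (1, p),
          (p + 2, q' - 1)] ⟨h.zero_out (by omega) (by omega) (by omega), hpq', hsx, hxy, hyt, ht1,
            hpq, h.zero_in (by omega) (by omega) (by omega)⟩ ?_ ?_
        · simp only [Fits, Avoids, or_true, and_true, true_and]; omega
        · simp only [blocksLength]; omega
      · obtain ⟨x, y, t, hx, hx', hy, hy', ht, ht', hxy', hxt', hyt', hsx, hxy, hyt, ht1⟩ :=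
          h.path (q' - 1) (p + 2) (by omega) (by omega) (by omega) (by omega)
            (h.leaves (by omega) (by omega) (by omega)) (h.enters (by omega) (by omega) (by omega))
        refine h.not_links (p + 1) [(p + 3, q' - 1), (x, x), (y, y), (t, t), (p + 2, p + 2),
          (q', s)] ⟨hpq1, hsx, hxy, hyt, ht1, hpq', h.back⟩ ?_ ?_
        · simp only [Fits, Avoids, or_true, and_true, true_and]; omega
        · simp only [blocksLength]; omega
    · obtain ⟨p', q', hp', hpk, hkq, hq', hpq'⟩ := h.exists_jump_over (k := p) (by omega)
        (by omega)
      have h6 : ¬ p + 1 < q' := fun hlt => by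
        have := hjump p' q' hp' (by omega) hlt hq' hpq'
        omega
      obtain rfl : q' = p + 1 := by omega
      refine h.not_links 0 [(p' + 1, p), (p + 2, s), (x, x), (y, y), (t, t), (1, p'),
        (p + 1, p + 1)] ⟨h.zero_out (by omega) (by omega) (by omega), hpq, hsx, hxy, hyt, ht1,
          hpq', h.zero_in (by omega) (by omega) (by omega)⟩ ?_ ?_
      · simp only [Fits, Avoids, or_true, and_true, true_and]; omega
      · simp only [blocksLength]; omega
  · have h6 := h.degree_le (p + 1) (by omega) (by omega)
    rw [Cfg.degree_split, degOn_eq_zero (S := Finset.Ioc s (s + 3)) fun u hu => by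
      rw [Finset.mem_Ioc] at hu
      refine ⟨fun hlt => ?_, fun hlt => ?_⟩
      · have := (h.inn' (p + 1) (by omega) (by omega)).1 ⟨u, hu, hlt⟩
        omega
      · have := (h.out' (p + 1) (by omega) (by omega)).1 ⟨u, hu, hlt⟩
        omega] at h6
    have h7 := arcs_le_two (A := B) (p + 1) 0
    have h8 : degOn B (p + 1) (Finset.Icc 1 s)
        = degOn B (p + 1) (Finset.Icc 1 p) + degOn B (p + 1) (Finset.Icc (p + 2) s) := by
      have h9 : Finset.Icc 1 s = Finset.Icc 1 p ∪ {p + 1} ∪ Finset.Icc (p + 2) s := by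
        ext k; simp; omega
      rw [h9, degOn_union, degOn_union]
      · simp [degOn, arcs_self h.irrefl]
      · rw [Finset.disjoint_left]; intro k; simp; omega
      · rw [Finset.disjoint_left]; intro k; simp; omega
    have hout := h.zero_out (k := p + 1) (by omega) (by omega) (by omega)
    have hin := h.zero_in (k := p + 1) (by omega) (by omega) (by omega)
    by_cases h9 : p + 1 - 1 + 2 ≤ degOn B (p + 1) (Finset.Icc 1 p)
    · obtain ⟨i, hi, hip, h10, h11⟩ := exists_insertion_Icc h9
      refine h.not_links 0 [(i + 1, p), (p + 2, s), (x, x), (y, y), (t, t), (1, i),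
        (p + 1, p + 1)] ⟨h.zero_out (by omega) (by omega) (by omega), hpq, hsx, hxy, hyt, ht1,
          h10, hin⟩ ?_ ?_
      · simp only [Fits, Avoids, or_true, and_true, true_and]; omega
      · simp only [blocksLength]; omega
    · obtain ⟨i, hi, hip, h10, h11⟩ := exists_insertion_Icc (B := B) (v := p + 1) (a := p + 2)
        (b := s) (by omega)
      obtain ⟨i', hi', hii', hid⟩ : ∃ i', p + 2 ≤ i' ∧ (i' ≤ i ∧ i ≤ i' + 1) ∧ i' + 1 ≠ b + 1 := by
        by_cases hib : i = b
        · exact ⟨i - 1, by omega, by omega, by omega⟩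
        · exact ⟨i, by omega, by omega, by omega⟩
      refine h.not_links 0 [(p + 1, p + 1), (i + 1, s), (x, x), (y, y), (t, t), (1, p),
        (p + 2, i')] ⟨hout, h11, hsx, hxy, hyt, ht1, hpq,
          h.zero_in (by omega) (by omega) (by omega)⟩ ?_ ?_
      · simp only [Fits, Avoids, or_true, and_true, true_and]; omega
      · simp only [blocksLength]; omega

end Turns

theorem Ends.false (h : Ends B s) (hs : 5 ≤ s) : False := by
  obtain ⟨a, d, b, e, ht⟩ := h.exists_turns (by omega)
  by_cases hd : d = 0 ∨ a + 1 < d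
  · exact ht.false_of_ne hs hd
  by_cases hda : d = a + 1
  · exact ht.false_of_eq hda
  obtain ⟨a', d', b', e', ht'⟩ := h.rev.exists_turns (by omega)
  have had := ht.a_ne
  have had' := ht'.a_ne
  have ha1 := ht.one_lt_a
  have has := ht.a_lt
  have ha1' := ht'.one_lt_a
  have has' := ht'.a_lt
  have key : ∀ k, 1 ≤ k → k ≤ s → ((k ≤ a' ∧ k ≠ d') ↔ a ≤ s + 1 - k ∧ s + 1 - k + 1 ≠ d) := by
    intro k hk hks
    rw [← ht'.out k hk hks, ← ht.inn (s + 1 - k) (by omega) (by omega),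
      Cfg.mirror_of_le hk hks, Cfg.mirror_zero]
  have key' : ∀ k, 1 ≤ k → k ≤ s → ((a' ≤ k ∧ k + 1 ≠ d') ↔ s + 1 - k ≤ a ∧ s + 1 - k ≠ d) := by
    intro k hk hks
    rw [← ht'.inn k hk hks, ← ht.out (s + 1 - k) (by omega) (by omega),
      Cfg.mirror_of_le hk hks, Cfg.mirror_zero]
  have h1 := key a' (by omega) (by omega)
  have h2 := key (s + 1 - a) (by omega) (by omega)
  have h3 := key' (s + 1 - d) (by omega) (by omega)
  exact ht'.false_of_ne hs (by omega)

variable {B : ℕ → ℕ → Prop} {s : ℕ}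

/-- The renumbering that moves `1` between `i` and `i + 1`. -/
def shift (i k : ℕ) : ℕ := if k = 0 then 0 else if k < i then k + 1 else if k = i then 1 else k

theorem shift_zero (i : ℕ) : shift i 0 = 0 := rfl

theorem shift_of_lt {i k : ℕ} (h1 : 1 ≤ k) (h2 : k < i) : shift i k = k + 1 := by
  unfold shift; split_ifs <;> omega

theorem shift_self {i : ℕ} (h : 1 ≤ i) : shift i i = 1 := by
  unfold shift; split_ifs <;> omega

theorem shift_of_gt {i k : ℕ} (h : i < k) : shift i k = k := by
  unfold shift; split_ifs <;> omega

theorem shift_arc {i : ℕ} (ha : ∀ k, 1 ≤ k → k < s → B k (k + 1)) (h2 : 2 ≤ i) (his : i < s)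
    (hi : B i 1) (hi' : B 1 (i + 1)) (k : ℕ) (h1 : 1 ≤ k) (hk : k < s) :
    B (shift i k) (shift i (k + 1)) := by
  rcases Nat.lt_trichotomy k i with h | h | h
  · rcases Nat.lt_or_ge (k + 1) i with h' | h'
    · rw [shift_of_lt h1 h, shift_of_lt (by omega) h']
      exact ha _ (by omega) (by omega)
    · obtain rfl : i = k + 1 := by omega
      rw [shift_of_lt h1 h, shift_self (by omega)]
      exact hi
  · subst h
    rw [shift_self (by omega), shift_of_gt (by omega)]
    exact hi'
  · rw [shift_of_gt h, shift_of_gt (by omega)]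
    exact ha _ h1 hk

theorem Base.shift {n m i : ℕ} (h : Base B n m) (hi : i < n) :
    Base (fun u v => B (shift i u) (shift i v)) n m :=
  h.reindex (_root_.shift i) (fun k hk => by unfold _root_.shift; split_ifs <;> omega)
    (fun k hk l hl hkl => by unfold _root_.shift at hkl; grind) rfl (by omega)

theorem walk_range'_of_le {a : ℕ} (k : ℕ) (ha : ∀ i, a ≤ i → i < a + k → B i (i + 1)) :
    Walk B a (a + k) (List.range' a (k + 1)) := by
  induction k with
  | zero => exact .single a
  | succ k ih =>
    rw [List.range'_concat]
    refine (ih fun i h1 h2 => ha i h1 (by omega)).append (ha _ (by omega) (by omega)) ?_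
    rw [show a + 1 * (k + 1) = a + (k + 1) by omega]
    exact .single _

/-- If the outside vertices extend the path `1, …, s` at both ends but the special vertex has no
arc to `1`, then it has an arc to `2`. -/
theorem Base.zero_out_two (h : Base B (s + 3 + 1) (s + 1)) (hs : 2 ≤ s)
    (ha : ∀ k, 1 ≤ k → k < s → B k (k + 1)) (h01 : ¬ B 0 1)
    (hR : ∀ x ∈ Finset.Ioc s (s + 3), ¬ B 0 x ∧ ¬ B x 0)
    (hO : ∃ j, 1 ≤ j ∧ j ≤ s ∧ B 0 j) {x y t : ℕ} (hx : s < x) (hx' : x ≤ s + 3) (hy : s < y)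
    (hy' : y ≤ s + 3) (ht : s < t) (ht' : t ≤ s + 3) (hxy : x ≠ y) (hxt : x ≠ t) (hyt : y ≠ t)
    (hsx : B s x) (axy : B x y) (ayt : B y t) (ht1 : B t 1) : B 0 2 ∧ ¬ B 1 0 := by
  have hgap : ∀ i j, 1 ≤ i → i < j → j ≤ s → B i 0 → B 0 j → i + 4 ≤ j := by
    intro i j hi hij hj hi0 h0j
    by_contra hlt
    have w1 := walk_range'_of_le (B := B) (a := j) (s - j)
      fun k h1 h2 => ha k (by omega) (by omega)
    have w2 := walk_range'_of_le (B := B) (a := 1) (i - 1)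
      fun k h1 h2 => ha k (by omega) (by omega)
    rw [show j + (s - j) = s by omega] at w1
    rw [show 1 + (i - 1) = i by omega, show i - 1 + 1 = i by omega] at w2
    have w : Walk B 0 i (0 :: (List.range' j (s - j + 1) ++ x :: y :: t :: List.range' 1 i)) :=
      .cons h0j (w1.append hsx (.cons axy (.cons ayt (.cons ht1 w2))))
    have := h.longest _ ⟨?_, 0, i, w, hi0⟩ ?_ (by simp)
    · simp at this
      omega
    · simp only [List.nodup_cons, List.nodup_append, List.mem_append, List.mem_cons,
        List.mem_range'_1]
      refine ⟨by omega, List.nodup_range', ⟨by omega, by omega, by omega, List.nodup_range'⟩, ?_⟩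
      rintro a ha b hb rfl
      omega
    · intro k hk
      simp only [List.mem_append, List.mem_cons, List.mem_range'_1] at hk
      omega
  have hdeg : s ≤ degOn B 0 (Finset.Icc 1 s) := by
    have h1 := h.degree_zero
    rw [Cfg.degree_split, arcs_self h.irrefl, degOn_eq_zero hR] at h1
    omega
  have hM : ∀ k, 1 < k → k ≤ s + 1 → (k ≤ s → ¬ B 0 k) → (2 ≤ k → ¬ B (k - 1) 0) → False := by
    intro k h1 h2 h3 h4
    have := degOn_Icc_add_card_le (B := B) (v := 0) (s := s) (fun k h1 h2 h3 h4 => by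
      have := hgap k (k + 1) h1 (by omega) (by omega) h3 h4
      omega) {1, k} (by
        intro m hm
        obtain rfl | rfl : m = 1 ∨ m = k := by simpa using hm
        · exact ⟨le_rfl, by omega, fun _ => h01, fun h => by omega⟩
        · exact ⟨by omega, h2, h3, h4⟩)
    rw [Finset.card_pair (by omega)] at this
    omega
  have hle : ∀ i j, 1 ≤ i → i < j → j ≤ s → B i 0 → ¬ B 0 j := by
    intro i j hi hij hj hi0 h0j
    obtain ⟨k, h1, h2, h3, h4⟩ := exists_defect (O := fun k => B 0 k) (I := fun k => B k 0) hij
      hi0 h0j fun i' j' h1 h2 h3 h4 h5 => by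
        have := hgap i' j' (by omega) h3 (by omega) h4 h5
        omega
    exact hM k (by omega) (by omega) (fun _ => h3) (fun _ => h4)
  have h10 : ¬ B 1 0 := by
    intro h10
    obtain ⟨j, h1, h2, h3⟩ := hO
    have : j ≠ 1 := fun e => h01 (e ▸ h3)
    exact hle 1 j le_rfl (by omega) h2 h10 h3
  refine ⟨?_, h10⟩
  by_contra h02
  exact hM 2 (by omega) (by omega) (fun _ => h02) (fun _ => h10)

theorem Triple.enters_one (h : Triple B s) (hs : 5 ≤ s) : Enters B s 3 1 := by
  by_contra h1
  have hl1 : Lost (Enters B s 3) (Leaves B s 3) s 1 := ⟨fun _ => h1, fun h => by omega⟩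
  have hlost : ∀ k, 2 ≤ k → k ≤ s + 1 → ¬ Lost (Enters B s 3) (Leaves B s 3) s k :=
    fun k h2 hk => h.lost 1 k le_rfl (by omega) hk hl1
  have hLs : Leaves B s 3 s := by
    by_contra hn
    exact hlost (s + 1) (by omega) le_rfl ⟨fun h => by omega, fun _ => hn⟩
  have hL : ∀ k, 1 ≤ k → k ≤ 2 → ¬ Leaves B s 3 k := by
    intro k hk1 hk2 hk
    obtain ⟨o, ho1, hos, ho2, ho⟩ := h.exists_enters 2 (by omega)
    have h3 : o ≠ 1 := fun e => h1 (e ▸ ho)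
    have := h.le k o hk1 (by omega) ho1 hos hk ho
    omega
  have hE2 : Enters B s 3 2 := by
    by_contra hn
    exact hlost 2 le_rfl (by omega) ⟨fun _ => hn, fun _ => hL 1 le_rfl (by omega)⟩
  have hE3 : Enters B s 3 3 := by
    by_contra hn
    exact hlost 3 (by omega) (by omega) ⟨fun _ => hn, fun _ => hL 2 (by omega) (by omega)⟩
  have ha : ∀ k, 1 ≤ k → k < s → B k (k + 1) := fun k _ hk => h.arc k hk
  have hR : ∀ x ∈ Finset.Ioc s (s + 3), ¬ B 0 x ∧ ¬ B x 0 := fun x hx => by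
    rw [Finset.mem_Ioc] at hx
    exact ⟨h.not_zero_out hx, h.not_zero_in hx⟩
  obtain ⟨i, hi3, his, hi, hi'⟩ := exists_insertion_Icc (B := B) (v := 1) (a := 3) (b := s) (by
    have h2 := h.degree_le 1 le_rfl (by omega)
    rw [Cfg.degree_split, degOn_eq_zero (S := Finset.Ioc s (s + 3)) fun u hu => ⟨
      fun hu' => hL 1 le_rfl (by omega) ⟨u, Finset.mem_Ioc.1 hu, hu'⟩,
      fun hu' => h1 ⟨u, Finset.mem_Ioc.1 hu, hu'⟩⟩,
      show Finset.Icc 1 s = ({1} ∪ {2}) ∪ Finset.Icc 3 s by ext k; simp; omega,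
      degOn_union (by rw [Finset.disjoint_left]; intro k; simp; omega),
      degOn_union (by simp)] at h2
    simp only [degOn, Finset.sum_singleton, arcs_self h.irrefl] at h2 ⊢
    have := arcs_le_two (A := B) 1 0
    have := arcs_le_two (A := B) 1 2
    omega)
  have hbase := h.toBase.shift (i := i) (by omega)
  have harc := shift_arc ha (by omega) his hi hi'
  have hgt : ∀ x, s < x → shift i x = x := fun x hx => shift_of_gt (by omega)
  have hsh1 : shift i 1 = 2 := shift_of_lt le_rfl (by omega)
  have hsh2 : shift i 2 = 3 := shift_of_lt (by omega) (by omega)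
  have hshs : shift i s = s := shift_of_gt his
  obtain ⟨x, y, t, hx, hx', hy, hy', ht, ht', hxy, hxt, hyt, hsx, axy, ayt, ht2⟩ :=
    h.path s 2 (by omega) le_rfl (by omega) (by omega) hLs hE2
  by_cases h02 : B 0 2
  · have hcfg : Cfg (fun u v => B (shift i u) (shift i v)) s 3 := by
      refine ⟨hbase, fun k hk => ?_, ?_⟩
      · rcases Nat.eq_zero_or_pos k with rfl | hk0
        · simpa [hsh1, shift_zero] using h02
        · exact harc k hk0 hk
      · simpa [hshs, shift_zero] using h.back
    refine Ends.false ⟨hcfg.triple, ?_, ?_⟩ hs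
    · obtain ⟨u, hu, hu2⟩ := hE2
      exact ⟨u, hu, by simpa [hgt u hu.1, hsh1] using hu2⟩
    · obtain ⟨u, hu, hu2⟩ := hLs
      exact ⟨u, hu, by simpa [hgt u hu.1, hshs] using hu2⟩
  · obtain ⟨h03, h20⟩ := hbase.zero_out_two (by omega) harc (by simpa [hsh1, shift_zero] using h02)
      (fun u hu => by simpa [hgt u (Finset.mem_Ioc.1 hu).1, shift_zero] using hR u hu)
      ⟨i, by omega, by omega, by
        simpa [shift_zero, shift_self (show 1 ≤ i by omega)] using h.arc 0 (by omega)⟩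
      hx hx' hy hy' ht ht' hxy hxt hyt (by simpa [hshs, hgt x hx] using hsx)
      (by simpa [hgt x hx, hgt y hy] using axy) (by simpa [hgt y hy, hgt t ht] using ayt)
      (by simpa [hgt t ht, hsh1] using ht2)
    simp only [hsh1, hsh2, shift_zero] at h03 h20
    obtain ⟨j, hj2, hjs, hj, hj'⟩ := exists_insertion_Icc
      (B := fun u v => B (shift i u) (shift i v)) (v := 1) (a := 2) (b := s) (by
        have h2 := hbase.degree_le 1 le_rfl (by omega)
        have h3 : degOn (fun u v => B (shift i u) (shift i v)) 1 (Finset.Ioc s (s + 3)) ≤ 3 := by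
          calc _ ≤ ∑ u ∈ Finset.Ioc s (s + 3), 1 := Finset.sum_le_sum fun u hu => by
                have : ¬ B 2 u := fun hu' => hL 2 (by omega) le_rfl ⟨u, Finset.mem_Ioc.1 hu, hu'⟩
                simp only [arcs, hsh1, hgt u (Finset.mem_Ioc.1 hu).1, this, if_false]
                split_ifs <;> simp
            _ = 3 := by simp
        rw [Cfg.degree_split, show Finset.Icc 1 s = {1} ∪ Finset.Icc 2 s by ext k; simp; omega,
          degOn_union (by simp)] at h2
        simp only [degOn, Finset.sum_singleton] at h2 h3 ⊢
        rw [arcs_self hbase.irrefl, arcs_eq_zero.2 (by simp [hsh1, shift_zero, h02, h20])] at h2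
        omega)
    have hbase' := hbase.shift (i := j) (by omega)
    have harc' := shift_arc (B := fun u v => B (shift i u) (shift i v)) harc hj2 hjs hj hj'
    have hsj1 : shift i (shift j 1) = 3 := by rw [shift_of_lt le_rfl (by omega), hsh2]
    have hsjs : shift i (shift j s) = s := by rw [shift_of_gt hjs, hshs]
    have hgt' : ∀ x, s < x → shift i (shift j x) = x := fun x hx => by
      rw [shift_of_gt (i := j) (by omega), hgt x hx]
    have hcfg : Cfg (fun u v => B (shift i (shift j u)) (shift i (shift j v))) s 3 := by
      refine ⟨hbase', fun k hk => ?_, ?_⟩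
      · rcases Nat.eq_zero_or_pos k with rfl | hk0
        · simpa [hsj1, shift_zero] using h03
        · exact harc' k hk0 hk
      · simpa [hsjs, shift_zero] using h.back
    refine Ends.false ⟨hcfg.triple, ?_, ?_⟩ hs
    · obtain ⟨u, hu, hu2⟩ := hE3
      exact ⟨u, hu, by simpa [hgt' u hu.1, hsj1] using hu2⟩
    · obtain ⟨u, hu, hu2⟩ := hLs
      exact ⟨u, hu, by simpa [hgt' u hu.1, hsjs] using hu2⟩

theorem Cfg.false_of_three (h : Cfg B s 3) (hs : 5 ≤ s) : False := by
  refine Ends.false ⟨h.triple, h.triple.enters_one hs, ?_⟩ hs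
  have := h.rev.triple.enters_one hs
  rwa [enters_rev 1 le_rfl (by omega), show s + 1 - 1 = s by omega] at this

section Lists

variable {V : Type*} {A : V → V → Prop}

theorem Walk.getD_zero {x y : V} {L : List V} (h : Walk A x y L) (d : V) : L.getD 0 d = x := by
  cases h <;> simp

theorem Walk.getD_last {x y : V} {L : List V} (h : Walk A x y L) (d : V) :
    L.getD (L.length - 1) d = y := by
  induction h with
  | single x => simp
  | @cons u v w L ha h ih =>
    have := List.length_pos_iff.2 h.ne_nil
    rw [List.length_cons, show L.length + 1 - 1 = L.length - 1 + 1 by omega,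
      List.getD_cons_succ, ih]

theorem Walk.getD_arc {x y : V} {L : List V} (h : Walk A x y L) (d : V) :
    ∀ i, i + 1 < L.length → A (L.getD i d) (L.getD (i + 1) d) := by
  induction h with
  | single x => intro i hi; simp at hi
  | @cons u v w L ha h ih =>
    intro i hi
    rcases i with _ | i
    · rw [List.getD_cons_zero, List.getD_cons_succ, h.getD_zero]
      exact ha
    · rw [List.getD_cons_succ, List.getD_cons_succ]
      exact ih i (by simpa using hi)

theorem Walk.dropLast {x y : V} {L : List V} (h : Walk A x y (L ++ [y])) :
    L = [] ∧ x = y ∨ ∃ u, Walk A x u L ∧ A u y := by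
  have h' := h.reverse
  rw [List.reverse_append, List.reverse_singleton, List.singleton_append] at h'
  rcases h'.tail with ⟨h1, h2⟩ | ⟨u, hu, hw⟩
  · exact Or.inl ⟨by simpa using h1, h2.symm⟩
  · exact Or.inr ⟨u, by simpa using hw.reverse, hu⟩

/-- A closed walk can be started at any of its vertices. -/
theorem ClosedWalk.exists_rotation {L : List V} (h : ClosedWalk A L) {b : V} (hb : b ∈ L) :
    ∃ L' e, L'.Perm L ∧ Walk A b e L' ∧ A e b := by
  obtain ⟨hnd, x, y, hw, hyx⟩ := h
  obtain ⟨L₁, L₂, rfl, h1, h2⟩ := hw.exists_eq_append hb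
  rcases h1.dropLast with ⟨rfl, rfl⟩ | ⟨u, hu, hub⟩
  · exact ⟨_, y, List.Perm.refl _, h2, hyx⟩
  · exact ⟨_, u, List.perm_append_comm, h2.append hyx hu, hub⟩

end Lists

/-- The numbering of vertices in which `0` is followed by the members of a list. -/
def numbering (M : List ℕ) (k : ℕ) : ℕ := (0 :: M).getD k 0

theorem numbering_zero (M : List ℕ) : numbering M 0 = 0 := rfl

theorem numbering_succ (M : List ℕ) (k : ℕ) : numbering M (k + 1) = M.getD k 0 :=
  List.getD_cons_succ

theorem Base.numbering {B : ℕ → ℕ → Prop} {n m : ℕ} (h : Base B n m) {M : List ℕ} (hM : M.Nodup)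
    (hmem : ∀ v ∈ M, 1 ≤ v ∧ v < n) (hlen : M.length + 1 = n) :
    Base (fun i j => B (numbering M i) (numbering M j)) n m := by
  have hnd : (0 :: M).Nodup := List.nodup_cons.2 ⟨fun h0 => by have := hmem 0 h0; omega, hM⟩
  refine h.reindex (_root_.numbering M) (fun i hi => ?_) (fun i hi j hj hij => ?_) rfl (by omega)
  · have hi' : i < (0 :: M).length := by simp; omega
    rw [_root_.numbering, List.getD_eq_getElem _ _ hi']
    rcases List.mem_cons.1 (List.getElem_mem hi') with h0 | h0
    · omega
    · exact (hmem _ h0).2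
  · have hi' : i < (0 :: M).length := by simp; omega
    have hj' : j < (0 :: M).length := by simp; omega
    rw [_root_.numbering, _root_.numbering, List.getD_eq_getElem _ _ hi',
      List.getD_eq_getElem _ _ hj'] at hij
    exact (List.Nodup.getElem_inj_iff hnd).1 hij

variable {B : ℕ → ℕ → Prop} {s r n m N e : ℕ}

/-- A Hamiltonian cycle `1, …, N` of the digraph without the special vertex `0`, such that `0` can
be inserted by skipping the last `e` vertices. -/
structure Skip (B : ℕ → ℕ → Prop) (N m e : ℕ) : Prop extends Base B (N + 1) m where
  arc : ∀ k, 1 ≤ k → k < N → B k (k + 1)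
  back : B N 1
  lt : e < N
  out : B 0 1
  inn : B (N - e) 0

/-- The renumbering of the cycle `1, …, N` starting at `j`. -/
def rotate (N j k : ℕ) : ℕ :=
  if k = 0 then 0 else if k + j ≤ N + 1 then k + j - 1 else k + j - 1 - N

theorem rotate_of_le {j k : ℕ} (hk : 1 ≤ k) (h : k + j ≤ N + 1) : rotate N j k = k + j - 1 := by
  rw [rotate, if_neg (by omega), if_pos h]

theorem rotate_of_gt {j k : ℕ} (hk : 1 ≤ k) (h : N + 1 < k + j) :
    rotate N j k = k + j - 1 - N := by
  rw [rotate, if_neg (by omega), if_neg (by omega)]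

theorem Base.exists_skip (h : Base B (N + 1) m) (ha : ∀ k, 1 ≤ k → k < N → B k (k + 1))
    (hb : B N 1) {i j : ℕ} (hi1 : 1 ≤ i) (hiN : i ≤ N) (hj1 : 1 ≤ j) (hjN : j ≤ N) (hi : B i 0)
    (hj : B 0 j) : ∃ C, Skip C N m (if i < j then j - i - 1 else N + j - i - 1) := by
  refine ⟨fun u v => B (rotate N j u) (rotate N j v), ⟨h.reindex (rotate N j) (fun k hk => ?_)
    (fun k hk l hl hkl => ?_) rfl (by omega), fun k hk1 hk => ?_, ?_, ?_, ?_, ?_⟩⟩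
  · unfold rotate; split_ifs <;> omega
  · unfold rotate at hkl; grind
  · rcases Nat.lt_trichotomy (k + j) (N + 1) with h1 | h1 | h1
    · rw [rotate_of_le hk1 (by omega), rotate_of_le (by omega) (by omega),
        show k + 1 + j - 1 = k + j - 1 + 1 by omega]
      exact ha _ (by omega) (by omega)
    · rw [rotate_of_le hk1 (by omega), rotate_of_gt (by omega) (by omega),
        show k + 1 + j - 1 - N = 1 by omega, show k + j - 1 = N by omega]
      exact hb
    · rw [rotate_of_gt hk1 (by omega), rotate_of_gt (by omega) (by omega),
        show k + 1 + j - 1 - N = k + j - 1 - N + 1 by omega]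
      exact ha _ (by omega) (by omega)
  · rw [rotate_of_le (k := 1) le_rfl (by omega), show 1 + j - 1 = j by omega]
    by_cases h1 : N + j ≤ N + 1
    · obtain rfl : j = 1 := by omega
      rw [rotate_of_le (by omega) h1]
      exact hb
    · rw [rotate_of_gt (by omega) (by omega)]
      have := ha (j - 1) (by omega) (by omega)
      rwa [show j - 1 + 1 = j by omega, show j - 1 = N + j - 1 - N by omega] at this
  · split_ifs <;> omega
  · rw [rotate_of_le (k := 1) le_rfl (by omega), show 1 + j - 1 = j by omega]
    exact hj
  · have : rotate N j (N - if i < j then j - i - 1 else N + j - i - 1) = i := by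
      split_ifs with h1
      · rw [rotate_of_gt (by omega) (by omega)]
        omega
      · rw [rotate_of_le (by omega) (by omega)]
        omega
    rw [this]
    exact hi

theorem Cfg.exists_skip_four (h : Cfg B s r) (hr : 4 ≤ r) {K : List ℕ} (hK : ClosedWalk B K)
    (hKU : ∀ v, v ∈ K ↔ v ∈ Finset.Icc 1 (s + r)) :
    r = 4 ∧ ∃ C a, Cfg C s 4 ∧ C s (s + 1) ∧ C (s + 1) (s + 2) ∧ C (s + 2) (s + 3) ∧
      C (s + 3) (s + 4) ∧ C (s + 4) 1 ∧ 1 ≤ a ∧ a ≤ s ∧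
      ∀ k, 1 ≤ k → k ≤ s → ((C 0 k ↔ k ≤ a) ∧ (C k 0 ↔ a ≤ k)) := by
  classical
  have hs := h.pos
  have hlen : K.length = s + r := by
    rw [← List.toFinset_card_of_nodup hK.1, show K.toFinset = Finset.Icc 1 (s + r) by
      ext v; simp only [List.mem_toFinset, hKU]]
    simp
  have hex : ∃ e C, Skip C (s + r) (s + 1) e := by
    obtain ⟨hnd, x, y, hw, hyx⟩ := hK
    have hbase := h.toBase.numbering hnd (fun v hv => by
      have := (hKU v).1 hv
      rw [Finset.mem_Icc] at this
      omega) (by omega)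
    have hpos : ∀ v, 1 ≤ v → v ≤ s + r → ∃ k, 1 ≤ k ∧ k ≤ s + r ∧ numbering K k = v := by
      intro v h1 h2
      obtain ⟨i, hi, rfl⟩ := List.getElem_of_mem ((hKU v).2 (Finset.mem_Icc.2 ⟨h1, h2⟩))
      exact ⟨i + 1, by omega, by omega, by rw [numbering_succ, List.getD_eq_getElem _ _ hi]⟩
    obtain ⟨i, hi1, hi2, hi⟩ := hpos s hs (by omega)
    obtain ⟨j, hj1, hj2, hj⟩ := hpos 1 le_rfl (by omega)
    refine ⟨_, hbase.exists_skip (i := i) (j := j) (fun k hk1 hk => ?_) ?_ hi1 hi2 hj1 hj2 ?_ ?_⟩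
    · obtain ⟨k, rfl⟩ : ∃ l, k = l + 1 := ⟨k - 1, by omega⟩
      simp only [numbering_succ]
      exact hw.getD_arc 0 k (by omega)
    · have h1 := numbering_succ K (s + r - 1)
      have h2 := numbering_succ K 0
      rw [hw.getD_zero] at h2
      rw [← hlen, hw.getD_last, hlen, show s + r - 1 + 1 = s + r by omega] at h1
      simpa [h1, h2] using hyx
    · simpa [hi, numbering_zero] using h.back
    · simpa [hj, numbering_zero] using h.arc 0 (by omega)
  obtain ⟨C, hC⟩ := Nat.find_spec hex
  have hmin : ∀ e, (∃ C, Skip C (s + r) (s + 1) e) → Nat.find hex ≤ e := fun e he =>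
    Nat.find_min' hex he
  generalize Nat.find hex = e at hC hmin
  have hlt := hC.lt
  have hgap : ∀ i j, 1 ≤ i → i < j → j ≤ s + r → C i 0 → C 0 j → i + 1 + e ≤ j := by
    intro i j h1 h2 h3 h4 h5
    have := hmin _ (hC.toBase.exists_skip hC.arc hC.back h1 (by omega) (by omega) h3 h4 h5)
    rw [if_pos h2] at this
    omega
  have hin : ∀ i, s + r - e < i → i ≤ s + r → ¬ C i 0 := by
    intro i h1 h2 h3
    have := hmin _ (hC.toBase.exists_skip hC.arc hC.back (i := i) (j := 1) (by omega) h2 le_rfl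
      (by omega) h3 hC.out)
    rw [if_neg (by omega)] at this
    omega
  have hout : ∀ j, s + r - e < j → j ≤ s + r → ¬ C 0 j := by
    intro j h1 h2 h3
    have := hgap _ j (by omega) h1 h2 hC.inn h3
    omega
  have her : r ≤ e := by
    have w := walk_range'_of_le (B := C) (a := 1) (s + r - e - 1)
      fun k h1 h2 => hC.arc k h1 (by omega)
    rw [show s + r - e - 1 + 1 = s + r - e by omega,
      show 1 + (s + r - e - 1) = s + r - e by omega] at w
    have := hC.longest (0 :: List.range' 1 (s + r - e))
      ⟨by simp [List.nodup_range'], 0, _, .cons hC.out w, hC.inn⟩ (by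
        intro i hi
        simp only [List.mem_cons, List.mem_range'_1] at hi
        omega) (by simp)
    simp at this
    omega
  have hdeg : s + r + 1 ≤ degOn C 0 (Finset.Icc 1 (s + r - e)) + 4 := by
    have h1 := hC.degree_zero
    rwa [show s + r + 1 = s + r - e + e + 1 by omega, Cfg.degree_split, arcs_self hC.irrefl,
      degOn_eq_zero (S := Finset.Ioc (s + r - e) (s + r - e + e)) fun u hu => by
        rw [Finset.mem_Ioc] at hu
        exact ⟨hout u hu.1 (by omega), hin u hu.1 (by omega)⟩,
      show s + r - e + e + 1 = s + r + 1 by omega, zero_add, add_zero] at h1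
  have hcount : ∀ M : Finset ℕ, (∀ k ∈ M, 1 ≤ k ∧ k ≤ s + r - e + 1 ∧ (k ≤ s + r - e → ¬ C 0 k) ∧
      (2 ≤ k → ¬ C (k - 1) 0)) → M.card + e ≤ 4 := by
    intro M hM
    have := degOn_Icc_add_card_le (B := C) (v := 0) (s := s + r - e) (fun k h1 h2 h3 h4 => by
      have := hgap k (k + 1) h1 (by omega) (by omega) h3 h4
      omega) M hM
    omega
  have h0 := hcount ∅ (by simp)
  simp only [Finset.card_empty] at h0
  obtain rfl : r = 4 := by omega
  obtain rfl : e = 4 := by omega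
  have hse : s + 4 - 4 = s := by omega
  rw [hse] at hcount hin hout hdeg
  obtain ⟨a, ha1, has, ha⟩ := exists_turn (O := fun k => C 0 k) (I := fun k => C k 0) hs
    (fun i j h1 h2 h3 h4 h5 => by
      obtain ⟨k, h6, h7, h8, h9⟩ := exists_defect (O := fun k => C 0 k) (I := fun k => C k 0) h2
        h4 h5 fun i' j' h1 h2 h3 h4 h5 => by
          have := hgap i' j' (by omega) h3 (by omega) h4 h5
          omega
      have := hcount {k} (by
        intro l hl
        obtain rfl := Finset.mem_singleton.1 hl
        exact ⟨by omega, by omega, fun _ => h8, fun _ => h9⟩)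
      simp at this)
    (fun k h1 h2 => by
      by_contra! hno
      have := hcount {k} (by
        intro l hl
        obtain rfl := Finset.mem_singleton.1 hl
        exact ⟨by omega, by omega, hno.1, hno.2⟩)
      simp at this)
  refine ⟨rfl, C, a, ⟨hC.toBase, fun k hk => ?_, by simpa [hse] using hC.inn⟩,
    hC.arc _ (by omega) (by omega), hC.arc _ (by omega) (by omega), hC.arc _ (by omega) (by omega),
    hC.arc _ (by omega) (by omega), hC.back, ha1, has, ha⟩
  rcases Nat.eq_zero_or_pos k with rfl | hk0
  · exact hC.out
  · exact hC.arc k hk0 (by omega)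

namespace Cfg

variable {B : ℕ → ℕ → Prop} {s r : ℕ}

/-- A path through outside vertices leads from `k` back to `o`. -/
def Detour (B : ℕ → ℕ → Prop) (s r k o : ℕ) : Prop :=
  ∃ x y, x ∈ Set.Ioc s (s + r) ∧ ReachIn B (Set.Ioc s (s + r)) x y ∧ B k x ∧ B y o

theorem exists_detour (h : Cfg B s r) (hr : 1 ≤ r) :
    ∃ o k, 1 ≤ o ∧ o < k ∧ k ≤ s ∧ Detour B s r k o := by
  have h1 : s + 1 ∈ Set.Ioc s (s + r) := ⟨by omega, by omega⟩
  have hy0 : ∀ {y j}, y ∈ Set.Ioc s (s + r) → B y j → 1 ≤ j := fun {y j} hy hyj => by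
    have : j ≠ 0 := fun h0 => h.not_zero_in hy (h0 ▸ hyj)
    omega
  obtain ⟨y, j, hy, hxy, hj, hj0, hyj⟩ := h.exists_exit (Nat.zero_le s) h1
  obtain ⟨y', j', hy', hxy', hj', hjj, hyj'⟩ := h.exists_exit hj h1
  obtain ⟨x, i, hx, hx1, hi, hi0, hix⟩ := h.exists_entry (Nat.zero_le s) h1
  have hle : ∀ y j, j ≤ s → ReachIn B (Set.Ioc s (s + r)) (s + 1) y → B y j → j ≤ i := by
    intro y j hj hxy hyj
    by_contra hlt
    exact h.not_forward (by omega) hj hx (hx1.trans hxy) hix hyj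
  have l1 := hle y j hj hxy hyj
  have l2 := hle y' j' hj' hxy' hyj'
  rcases Nat.lt_or_ge j i with h2 | h2
  · exact ⟨j, i, hy0 hy hyj, h2, hi, x, y, hx, hx1.trans hxy, hix, hyj⟩
  · exact ⟨j', i, hy0 hy' hyj', by omega, hi, x, y', hx, hx1.trans hxy', hix, hyj'⟩

theorem exists_longest_detour (h : Cfg B s r) (hr : 1 ≤ r) :
    ∃ o k, 1 ≤ o ∧ o < k ∧ k ≤ s ∧ Detour B s r k o ∧
      ∀ o' k', 1 ≤ o' → k' ≤ s → k < k' + o - o' → ¬ Detour B s r k' o' := by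
  classical
  have hex : ∃ d, ∃ o, 1 ≤ o ∧ o + (s - d) ≤ s ∧ o < o + (s - d) ∧
      Detour B s r (o + (s - d)) o := by
    obtain ⟨o, k, h1, h2, h3, h4⟩ := h.exists_detour hr
    refine ⟨s - (k - o), o, h1, by omega, by omega, ?_⟩
    rwa [show o + (s - (s - (k - o))) = k by omega]
  obtain ⟨o, h1, h2, h3, h4⟩ := Nat.find_spec hex
  refine ⟨o, _, h1, h3, h2, h4, fun o' k' ho' hk' hlt hd => ?_⟩
  refine Nat.find_min hex (m := s - (k' - o')) (by omega) ⟨o', ho', by omega, by omega, ?_⟩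
  rwa [show o' + (s - (s - (k' - o'))) = k' by omega]

theorem le_degOn_Icc (h : Cfg B s r) {v : ℕ} (h1 : 1 ≤ v) (h2 : v ≤ s + r) :
    s + r + 1 ≤ degOn B v (Finset.Icc 1 (s + r)) + arcs B v 0 := by
  have h3 := h.degree_le v h1 (by omega)
  rwa [show Finset.range (s + r + 1) = Finset.Icc 1 (s + r) ∪ {0} by ext k; simp; omega,
    degOn_union (by simp), degOn, degOn, Finset.sum_singleton] at h3

theorem two_mul_card_le (h : Cfg B s r) {x t : ℕ} (hx : x ∈ Set.Ioc s (s + r)) (h1 : 1 ≤ t)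
    (h2 : t ≤ s + r) : 2 * (Finset.Icc 1 (s + r)).card
      ≤ degOn B x (Finset.Icc 1 (s + r)) + degOn B t (Finset.Icc 1 (s + r)) := by
  have h3 := h.le_degOn_Icc (v := x) (by have := hx.1; omega) hx.2
  have h4 := h.le_degOn_Icc h1 h2
  rw [arcs_eq_zero.2 ⟨h.not_zero_in hx, h.not_zero_out hx⟩] at h3
  have := arcs_le_two (A := B) t 0
  rw [Nat.card_Icc]
  omega

/-- Some cycle avoiding `0` contains `1, …, s`. -/
theorem exists_cycle_avoiding_zero (h : Cfg B s r) (hr : 1 ≤ r) :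
    ∃ K, ClosedWalk B K ∧ (∀ v ∈ K, v ∈ Finset.Icc 1 (s + r)) ∧ ∀ v ∈ Finset.Icc 1 s, v ∈ K := by
  obtain ⟨o, k, ho, hok, hk, ⟨x, y, hx, hxy, hkx, hyo⟩, hmax⟩ := h.exists_longest_detour hr
  have hx1 := hx.1
  have hx2 := hx.2
  obtain ⟨Q, hQ, hndQ, hQR⟩ := hxy.exists_walk hx
  have hw := walk_range' h.arc (a := o) (k - o) (by omega)
  rw [show o + (k - o) = k by omega] at hw
  have hLs : (List.range' o (k - o + 1)).toFinset = Finset.Icc o k := by ext v; simp; omega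
  have hT : ∀ t ∈ Finset.Icc 1 (o - 1) ∪ Finset.Icc (k + 1) s,
      1 ≤ t ∧ t ≤ s ∧ (t < o ∨ k < t) := by
    intro t ht
    simp only [Finset.mem_union, Finset.mem_Icc] at ht
    omega
  have hfor : ∀ w ∈ Set.Ioc s (s + r), ReachIn B (Set.Ioc s (s + r)) x w →
      ∀ t, 1 ≤ t → t ≤ s → t < o ∨ k < t → ¬ B w t := by
    intro w hw hxw t h1 h2 h3 hwt
    rcases h3 with h3 | h3
    · exact hmax t k h1 hk (by omega) ⟨x, w, hx, hxw, hkx, hwt⟩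
    · exact h.not_forward h3 h2 hx hxw hkx hwt
  have hback : ∀ w ∈ Set.Ioc s (s + r), ReachIn B (Set.Ioc s (s + r)) w x →
      ∀ t, 1 ≤ t → t ≤ s → t < o ∨ k < t → ¬ B t w := by
    intro w hw hwx t h1 h2 h3 htw
    rcases h3 with h3 | h3
    · exact h.not_forward h3 (by omega) hw (hwx.trans hxy) htw hyo
    · exact hmax o t ho h2 (by omega) ⟨w, y, hw, hwx.trans hxy, htw, hyo⟩
  obtain ⟨L, hL, hndL, hLT⟩ := exists_walk_union h.irrefl (Finset.Icc 1 (s + r)) hw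
    List.nodup_range' (T := Finset.Icc 1 (o - 1) ∪ Finset.Icc (k + 1) s) (x := x)
    (by rw [hLs]; intro v; simp; omega)
    (by intro v hv; have := hT v hv; simp; omega)
    (by rw [hLs, Finset.disjoint_left]; intro v hv hv'; have := hT v hv'; simp at hv; omega)
    (by simp; omega) (by simp; omega)
    (by intro hx'; have := hT x hx'; omega)
    (fun t ht => by
      obtain ⟨h1, h2, h3⟩ := hT t ht
      exact arcs_eq_zero.2 ⟨hfor x hx .refl t h1 h2 h3, hback x hx .refl t h1 h2 h3⟩)
    (fun w hw hwL hwT hwx t ht => by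
      obtain ⟨h1, h2, h3⟩ := hT t ht
      have hwR : w ∈ Set.Ioc s (s + r) := by
        simp only [Finset.mem_union, Finset.mem_Icc, List.mem_range'_1] at hw hwL hwT
        exact ⟨by omega, by omega⟩
      have c1 : ¬ (B x w ∧ B w t) := fun hc =>
        hfor w hwR (.single ⟨hx, hwR, hc.1⟩) t h1 h2 h3 hc.2
      have c2 : ¬ (B t w ∧ B w x) := fun hc =>
        hback w hwR (.single ⟨hwR, hx, hc.2⟩) t h1 h2 h3 hc.1
      unfold arcs
      split_ifs <;> first | omega | (exfalso; tauto))
    (by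
      by_contra hlt
      rw [List.length_range', hLs] at hlt
      obtain ⟨i, h1, h2, h3, h4⟩ := exists_insertion_Icc (B := B) (v := x) (a := o) (b := k)
        (by omega)
      exact h.not_forward (Nat.lt_succ_self i) (by omega) hx .refl h3 h4)
    (fun t ht => by
      obtain ⟨h1, h2, h3⟩ := hT t ht
      exact h.two_mul_card_le hx h1 (by omega))
  have hLmem : ∀ v, v ∈ L ↔ v ∈ Finset.Icc 1 s := by
    intro v
    rw [← List.mem_toFinset, hLT, hLs]
    simp
    omega
  refine ⟨L ++ Q, ⟨List.nodup_append.2 ⟨hndL, hndQ, ?_⟩, o, y, hL.append hkx hQ, hyo⟩,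
    fun v hv => ?_, fun v hv => List.mem_append_left _ ((hLmem v).2 hv)⟩
  · rintro u hu v hv rfl
    rw [hLmem, Finset.mem_Icc] at hu
    have := (hQR u hv).1
    omega
  · rcases List.mem_append.1 hv with hv | hv
    · rw [hLmem, Finset.mem_Icc] at hv
      rw [Finset.mem_Icc]
      omega
    · have h1 := (hQR v hv).1
      have h2 := (hQR v hv).2
      rw [Finset.mem_Icc]
      omega

/-- A cycle avoiding `0` and containing `1, …, s` that misses a vertex can be enlarged. -/
theorem exists_larger_cycle (h : Cfg B s r) {K : List ℕ} (hK : ClosedWalk B K)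
    (hKU : ∀ v ∈ K, v ∈ Finset.Icc 1 (s + r)) (hKP : ∀ v ∈ Finset.Icc 1 s, v ∈ K) {x : ℕ}
    (hxU : x ∈ Finset.Icc 1 (s + r)) (hxK : x ∉ K) :
    ∃ M, ClosedWalk B M ∧ (∀ v ∈ M, v ∈ Finset.Icc 1 (s + r)) ∧
      (∀ v ∈ Finset.Icc 1 s, v ∈ M) ∧ K.length < M.length := by
  have hs := h.pos
  have hxU' := Finset.mem_Icc.1 hxU
  have h1K := hKP 1 (Finset.mem_Icc.2 ⟨le_rfl, hs⟩)
  let X : Set ℕ := {v | v ∈ Finset.Icc 1 (s + r) ∧ v ∉ K}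
  have hS : ∀ v, v < s + r + 1 ∧ v ≠ 0 → v ∉ X → v ∈ K := by
    intro v hv hvX
    by_contra hvK
    exact hvX ⟨Finset.mem_Icc.2 ⟨by omega, by omega⟩, hvK⟩
  have hx0 : x ∈ X := ⟨hxU, hxK⟩
  have h1X : 1 ∉ X := fun h' => h'.2 h1K
  obtain ⟨d, b, hxd, hdX, hbX, -, hb, hdb⟩ := (h.reach 0 x 1 (by omega) (by omega) (by omega)
    (by omega) (by omega)).exists_exit hx0 h1X
  obtain ⟨c, a, hcx, hcX, haX, -, ha, hac⟩ := (h.reach 0 1 x (by omega) (by omega) (by omega)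
    (by omega) (by omega)).swap.exists_exit hx0 h1X
  have hcd : ReachIn B X c d := (hcx.swap.mono Set.inter_subset_right).trans
    (hxd.mono Set.inter_subset_right)
  obtain ⟨Q, hQ, hndQ, hQX⟩ := hcd.exists_walk hcX
  obtain ⟨K', e, hperm, hw, heb⟩ := hK.exists_rotation (hS b hb hbX)
  have hnd' : K'.Nodup := hperm.nodup_iff.2 hK.1
  obtain ⟨L, T, rfl, hL, hT⟩ := hw.exists_eq_append (hperm.mem_iff.2 (hS a ha haX))
  have hp : (T ++ (L ++ [a])).Perm K := by
    refine List.Perm.trans ?_ hperm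
    refine List.perm_append_comm.trans ?_
    simp
  have hmem : ∀ v, v ∈ T ++ (L ++ [a]) ↔ v ∈ K := fun v => hp.mem_iff
  obtain ⟨M, hM, hMU, hKM, v, hvM, hvK⟩ := exists_cycle_of_bypass h.irrefl
    (Finset.Icc 1 (s + r)) rfl hL (by simpa using hT.append heb (.single b)) hQ hac hdb
    (hp.nodup_iff.2 hK.1) hndQ (fun q hq hq' => (hQX q hq).2 ((hmem q).1 hq'))
    (fun v hv => hKU v ((hmem v).1 hv)) (fun q hq => (hQX q hq).1)
    (fun u hu huK t ht => by
      have ht' := Finset.mem_Icc.1 (hKU t ((hmem t).1 (List.mem_append_left _ ht)))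
      have hu' : ¬ u ≤ s := fun hus => huK ((hmem u).2 (hKP u (by
        rw [Finset.mem_Icc] at hu ⊢
        omega)))
      rw [Finset.mem_Icc] at hu
      exact h.two_mul_card_le ⟨by omega, hu.2⟩ ht'.1 ht'.2)
  have hKM' : ∀ v ∈ K, v ∈ M := fun v hv => hKM v ((hmem v).2 hv)
  refine ⟨M, hM, hMU, fun v hv => hKM' v (hKP v hv), ?_⟩
  have hvK' : v ∉ K := fun hv => hvK ((hmem v).2 hv)
  have := (List.subperm_of_subset (l₁ := v :: K) (List.nodup_cons.2 ⟨hvK', hK.1⟩) (l₂ := M) (by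
    intro u hu
    rcases List.mem_cons.1 hu with rfl | hu
    · exact hvM
    · exact hKM' u hu)).length_le
  simpa using this

/-- The digraph without the special vertex is Hamiltonian. -/
theorem exists_spanning_cycle (h : Cfg B s r) (hr : 1 ≤ r) :
    ∃ K, ClosedWalk B K ∧ ∀ v, v ∈ K ↔ v ∈ Finset.Icc 1 (s + r) := by
  have key : ∀ d, ∀ K, ClosedWalk B K → (∀ v ∈ K, v ∈ Finset.Icc 1 (s + r)) →
      (∀ v ∈ Finset.Icc 1 s, v ∈ K) → s + r ≤ K.length + d →
      ∃ K, ClosedWalk B K ∧ ∀ v, v ∈ K ↔ v ∈ Finset.Icc 1 (s + r) := by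
    intro d
    induction d with
    | zero =>
      intro K hK hKU _ hd
      refine ⟨K, hK, fun v => ⟨hKU v, fun hv => ?_⟩⟩
      rw [← List.mem_toFinset]
      have := Finset.eq_of_subset_of_card_le (s := K.toFinset) (t := Finset.Icc 1 (s + r))
        (fun v hv => hKU v (List.mem_toFinset.1 hv))
        (by rw [List.toFinset_card_of_nodup hK.1, Nat.card_Icc]; omega)
      rwa [this]
    | succ d ih =>
      intro K hK hKU hKP hd
      by_cases hall : ∀ v ∈ Finset.Icc 1 (s + r), v ∈ K
      · exact ⟨K, hK, fun v => ⟨hKU v, hall v⟩⟩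
      · push Not at hall
        obtain ⟨x, hx, hxK⟩ := hall
        obtain ⟨M, h1, h2, h3, h4⟩ := h.exists_larger_cycle hK hKU hKP hx hxK
        exact ih M h1 h2 h3 (by omega)
  obtain ⟨K, h1, h2, h3⟩ := h.exists_cycle_avoiding_zero hr
  exact key (s + r) K h1 h2 h3 (by omega)

end Cfg

theorem of_two_le_arcs {V : Type*} {A : V → V → Prop} {u v : V} (h : 2 ≤ arcs A u v) :
    A u v ∧ A v u := by
  unfold arcs at h
  split_ifs at h with h1 h2 h2
  · exact ⟨h1, h2⟩
  all_goals omega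

/-- Four outside vertices which continue the cycle from `s` back to `1`, a special vertex with
arcs to `1, …, a` and from `a, …, s`, and an arc `p → q` jumping over `a`. -/
structure Quad (B : ℕ → ℕ → Prop) (s a p q : ℕ) : Prop extends Cfg B s 4 where
  arc_one : B s (s + 1)
  arc_two : B (s + 1) (s + 2)
  arc_three : B (s + 2) (s + 3)
  arc_four : B (s + 3) (s + 4)
  arc_last : B (s + 4) 1
  zero_out : ∀ k, 1 ≤ k → k ≤ a → B 0 k
  zero_in : ∀ k, a ≤ k → k ≤ s → B k 0
  one_le : 1 ≤ p
  lt_turn : p < a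
  turn_lt : a < q
  le_last : q ≤ s
  jump : B p q

namespace Quad

variable {B : ℕ → ℕ → Prop} {s a p q : ℕ}

theorem rev (h : Quad B s a p q) :
    Quad (fun i j => B (Cfg.mirror s 4 j) (Cfg.mirror s 4 i)) s (s + 1 - a) (s + 1 - q)
      (s + 1 - p) := by
  have h1 := h.one_le
  have h2 := h.lt_turn
  have h3 := h.turn_lt
  have h4 := h.le_last
  exact
    { h.toCfg.rev with
      arc_one := by
        rw [Cfg.mirror_of_lt (by omega), Cfg.mirror_of_le (by omega) le_rfl]
        convert h.arc_last using 1 <;> omega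
      arc_two := by
        rw [Cfg.mirror_of_lt (by omega), Cfg.mirror_of_lt (by omega)]
        convert h.arc_four using 1 <;> omega
      arc_three := by
        rw [Cfg.mirror_of_lt (by omega), Cfg.mirror_of_lt (by omega)]
        convert h.arc_three using 1 <;> omega
      arc_four := by
        rw [Cfg.mirror_of_lt (by omega), Cfg.mirror_of_lt (by omega)]
        convert h.arc_two using 1 <;> omega
      arc_last := by
        rw [Cfg.mirror_of_le le_rfl (by omega), Cfg.mirror_of_lt (by omega)]
        convert h.arc_one using 1 <;> omega
      zero_out := fun k hk hka => by
        rw [Cfg.mirror_of_le hk (by omega)]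
        exact h.zero_in _ (by omega) (by omega)
      zero_in := fun k hk hks => by
        rw [Cfg.mirror_of_le (by omega) hks]
        exact h.zero_out _ (by omega) (by omega)
      one_le := by omega
      lt_turn := by omega
      turn_lt := by omega
      le_last := by omega
      jump := by
        rw [Cfg.mirror_of_le (by omega) (by omega), Cfg.mirror_of_le (by omega) (by omega)]
        convert h.jump using 1 <;> omega }

/-- An outside vertex is one of the four. -/
theorem eq_of_mem {x : ℕ} (hx : x ∈ Set.Ioc s (s + 4)) :
    x = s + 1 ∨ x = s + 2 ∨ x = s + 3 ∨ x = s + 4 := by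
  have h1 := hx.1
  have h2 := hx.2
  omega

/-- Rerouting along the jump, losing a few vertices in front of `q`. -/
theorem not_out (h : Quad B s a p q) {i x : ℕ} (hi : p < i) (hiq : i < q)
    (hx : x ∈ Set.Ioc s (s + 4)) (hlost : q + x ≤ i + s + 5) : ¬ B i x := fun hix => by
  have h1 := h.one_le
  have h2 := h.lt_turn
  have h3 := h.turn_lt
  have h4 := h.le_last
  have h0 := h.zero_out (p + 1) (by omega) (by omega)
  have hpq := h.jump
  rcases eq_of_mem hx with rfl | rfl | rfl | rfl
  · refine h.not_links 0 [(p + 1, i), (s + 1, s + 1), (s + 2, s + 2), (s + 3, s + 3),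
      (s + 4, s + 4), (1, p), (q, s)]
      ⟨h0, hix, h.arc_two, h.arc_three, h.arc_four, h.arc_last, hpq, h.back⟩ ?_ ?_
    · simp only [Fits, Avoids, or_true, and_true, true_and]; omega
    · simp only [blocksLength]; omega
  · refine h.not_links 0 [(p + 1, i), (s + 2, s + 2), (s + 3, s + 3),
      (s + 4, s + 4), (1, p), (q, s)]
      ⟨h0, hix, h.arc_three, h.arc_four, h.arc_last, hpq, h.back⟩ ?_ ?_
    · simp only [Fits, Avoids, or_true, and_true, true_and]; omega
    · simp only [blocksLength]; omega
  · refine h.not_links 0 [(p + 1, i), (s + 3, s + 3), (s + 4, s + 4), (1, p), (q, s)]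
      ⟨h0, hix, h.arc_four, h.arc_last, hpq, h.back⟩ ?_ ?_
    · simp only [Fits, Avoids, or_true, and_true, true_and]; omega
    · simp only [blocksLength]; omega
  · refine h.not_links 0 [(p + 1, i), (s + 4, s + 4), (1, p), (q, s)]
      ⟨h0, hix, h.arc_last, hpq, h.back⟩ ?_ ?_
    · simp only [Fits, Avoids, or_true, and_true, true_and]; omega
    · simp only [blocksLength]; omega

theorem not_out_pred (h : Quad B s a p q) {x : ℕ} (hx : x ∈ Set.Ioc s (s + 4)) :
    ¬ B (q - 1) x := by
  have h2 := h.lt_turn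
  have h3 := h.turn_lt
  have := hx.2
  exact h.not_out (by omega) (by omega) hx (by omega)

theorem not_in_succ (h : Quad B s a p q) {x : ℕ} (hx : x ∈ Set.Ioc s (s + 4)) :
    ¬ B x (p + 1) := by
  have h1 := h.one_le
  have h2 := h.lt_turn
  have h3 := h.turn_lt
  have h4 := h.le_last
  have hx1 := hx.1
  have hx2 := hx.2
  have := h.rev.not_out_pred (x := 2 * s + 5 - x) ⟨by omega, by omega⟩
  rw [Cfg.mirror_of_lt (by omega), Cfg.mirror_of_le (by omega) (by omega)] at this
  convert this using 2 <;> omega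

theorem five_le_degOn (h : Quad B s a p q) {x : ℕ} (hx : x ∈ Set.Ioc s (s + 4)) :
    5 ≤ degOn B x (Finset.Ioc s (s + 4)) := by
  have h1 := h.one_le
  have h2 := h.lt_turn
  have h3 := h.turn_lt
  have h4 := h.le_last
  have hd := h.le_degOn_of_outside hx
  by_cases hpx : B p x
  · have := h.degOn_Icc_le hx {q} (by
      simp only [Finset.mem_singleton]
      rintro k rfl
      exact ⟨by omega, by omega, fun _ => h.not_forward (by omega) h4 hx .refl hpx,
        fun _ => h.not_out_pred hx⟩)
    rw [Finset.card_singleton] at this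
    omega
  · have := h.degOn_Icc_le hx {p + 1} (by
      simp only [Finset.mem_singleton]
      rintro k rfl
      exact ⟨by omega, by omega, fun _ => h.not_in_succ hx, fun _ => by simpa using hpx⟩)
    rw [Finset.card_singleton] at this
    omega

theorem le_degOn_Icc (h : Quad B s a p q) {x : ℕ} (hx : x ∈ Set.Ioc s (s + 4)) :
    s ≤ degOn B x (Finset.Icc 1 s) + 1 := by
  have h1 := h.le_degOn_of_outside hx
  have h2 := h.degOn_outside_le hx
  omega

theorem degOn_Ioc_eq (B : ℕ → ℕ → Prop) (s x : ℕ) : degOn B x (Finset.Ioc s (s + 4)) =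
    arcs B x (s + 1) + arcs B x (s + 2) + arcs B x (s + 3) + arcs B x (s + 4) := by
  have : Finset.Ioc s (s + 4) = {s + 1, s + 2, s + 3, s + 4} := by
    ext k; simp; omega
  rw [this, degOn, Finset.sum_insert (by simp), Finset.sum_insert (by simp),
    Finset.sum_insert (by simp), Finset.sum_singleton]
  omega

/-- The outside vertices induce a strong digraph. -/
theorem reach_outside (h : Quad B s a p q) {x y : ℕ} (hx : x ∈ Set.Ioc s (s + 4))
    (hy : y ∈ Set.Ioc s (s + 4)) : ReachIn B (Set.Ioc s (s + 4)) x y := by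
  have hm : ∀ i, 1 ≤ i → i ≤ 4 → s + i ∈ Set.Ioc s (s + 4) :=
    fun i _ _ => ⟨by omega, by omega⟩
  have arc : ∀ i j, 1 ≤ i → i ≤ 4 → 1 ≤ j → j ≤ 4 → B (s + i) (s + j) →
      ReachIn B (Set.Ioc s (s + 4)) (s + i) (s + j) :=
    fun i j h1 h2 h3 h4 hb => .single ⟨hm i h1 h2, hm j h3 h4, hb⟩
  have h12 := arc 1 2 (by omega) (by omega) (by omega) (by omega) h.arc_two
  have h23 := arc 2 3 (by omega) (by omega) (by omega) (by omega) h.arc_three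
  have h34 := arc 3 4 (by omega) (by omega) (by omega) (by omega) h.arc_four
  have h41 : ReachIn B (Set.Ioc s (s + 4)) (s + 4) (s + 1) := by
    by_cases hb : B (s + 4) (s + 1)
    · exact arc 4 1 (by omega) (by omega) (by omega) (by omega) hb
    have d4 := h.five_le_degOn (hm 4 (by omega) (by omega))
    have d1 := h.five_le_degOn (hm 1 (by omega) (by omega))
    rw [degOn_Ioc_eq, arcs_self h.irrefl] at d4 d1
    have e1 : arcs B (s + 4) (s + 1) ≤ 1 := by
      unfold arcs; split_ifs <;> omega
    have e2 : arcs B (s + 1) (s + 4) ≤ 1 := by rw [arcs_comm]; exact e1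
    have := arcs_le_two (A := B) (s + 4) (s + 3)
    have := arcs_le_two (A := B) (s + 1) (s + 3)
    have f1 : 2 ≤ arcs B (s + 4) (s + 2) := by omega
    have f2 : 2 ≤ arcs B (s + 1) (s + 2) := by omega
    exact (arc 4 2 (by omega) (by omega) (by omega) (by omega) (of_two_le_arcs f1).1).trans
      (arc 2 1 (by omega) (by omega) (by omega) (by omega) (of_two_le_arcs f2).2)
  have to1 : ReachIn B (Set.Ioc s (s + 4)) x (s + 1) := by
    rcases eq_of_mem hx with rfl | rfl | rfl | rfl
    exacts [.refl, (h23.trans h34).trans h41, h34.trans h41, h41]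
  refine to1.trans ?_
  rcases eq_of_mem hy with rfl | rfl | rfl | rfl
  exacts [.refl, h12, h12.trans h23, (h12.trans h23).trans h34]

/-- No arc leads from a vertex strictly below the jump to an outside vertex. -/
theorem not_out_of_lt (h : Quad B s a p q) {i : ℕ} (hi : p < i) (hiq : i < q) :
    ¬ Leaves B s 4 i := by
  have h1 := h.one_le
  have h2 := h.lt_turn
  have h3 := h.turn_lt
  have h4 := h.le_last
  have hm : ∀ i, 1 ≤ i → i ≤ 4 → s + i ∈ Set.Ioc s (s + 4) :=
    fun i _ _ => ⟨by omega, by omega⟩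
  have key : ∀ d, ∀ i, p < i → i < q → q = i + d → ¬ Leaves B s 4 i := by
    intro d
    induction d using Nat.strong_induction_on with
    | _ d ih =>
    rintro i hi hiq hd ⟨u, hu, hiu⟩
    have hno : ∀ j, i < j → j ≤ s → ∀ x ∈ Set.Ioc s (s + 4), ¬ B x j :=
      fun j hij hjs x hx => h.not_forward hij hjs hu (h.reach_outside hu hx) hiu
    have hout : ∀ j, i < j → j < q → ∀ x ∈ Set.Ioc s (s + 4), ¬ B j x := fun j hij hjq x hx hb =>
      ih (q - j) (by omega) j (by omega) hjq (by omega) ⟨x, hx, hb⟩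
    have hiq' : i ≠ q - 1 := by
      rintro rfl
      exact h.not_out_pred hu hiu
    have hcount : ∀ x ∈ Set.Ioc s (s + 4), degOn B x (Finset.Icc 1 s) + (q - i - 1) ≤ s + 1 := by
      intro x hx
      have := h.degOn_Icc_le hx (Finset.Icc (i + 2) q) (by
        intro k hk
        rw [Finset.mem_Icc] at hk
        exact ⟨by omega, by omega, fun hks => hno k (by omega) hks x hx,
          fun _ => hout (k - 1) (by omega) (by omega) x hx⟩)
      rw [Nat.card_Icc] at this
      omega
    have hcount' : ∀ x ∈ Set.Ioc s (s + 4), ¬ B i x →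
        degOn B x (Finset.Icc 1 s) + (q - i) ≤ s + 1 := by
      intro x hx hix
      have := h.degOn_Icc_le hx (Finset.Icc (i + 1) q) (by
        intro k hk
        rw [Finset.mem_Icc] at hk
        refine ⟨by omega, by omega, fun hks => hno k (by omega) hks x hx, fun _ => ?_⟩
        rcases Nat.eq_or_lt_of_le hk.1 with rfl | hlt
        · simpa using hix
        · exact hout (k - 1) (by omega) (by omega) x hx)
      rw [Nat.card_Icc] at this
      omega
    have c1 := hcount _ (hm 1 (by omega) (by omega))
    have d1 := h.le_degOn_Icc (hm 1 (by omega) (by omega))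
    have o1 : ¬ B i (s + 1) := h.not_out hi hiq (hm 1 (by omega) (by omega)) (by omega)
    have o2 : ¬ B i (s + 2) := h.not_out hi hiq (hm 2 (by omega) (by omega)) (by omega)
    have c1' := hcount' _ (hm 1 (by omega) (by omega)) o1
    have hq2 : q = i + 2 := by omega
    have o3 : ¬ B i (s + 3) := h.not_out hi hiq (hm 3 (by omega) (by omega)) (by omega)
    have hi4 : B i (s + 4) := by
      rcases eq_of_mem hu with rfl | rfl | rfl | rfl
      exacts [absurd hiu o1, absurd hiu o2, absurd hiu o3, hiu]
    have h41 : B (s + 4) (s + 1) := by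
      have e := h.le_degOn_of_outside (hm 1 (by omega) (by omega))
      rw [degOn_Ioc_eq, arcs_self h.irrefl] at e
      have := arcs_le_two (A := B) (s + 1) (s + 2)
      have := arcs_le_two (A := B) (s + 1) (s + 3)
      exact (of_two_le_arcs (by omega : 2 ≤ arcs B (s + 1) (s + 4))).2
    have h11 : B (s + 1) 1 := by
      by_contra hn
      have := h.degOn_Icc_le (hm 1 (by omega) (by omega)) {1, i + 1, i + 2} (by
        simp only [Finset.mem_insert, Finset.mem_singleton]
        rintro k (rfl | rfl | rfl)
        · exact ⟨by omega, by omega, fun _ => hn, by omega⟩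
        · exact ⟨by omega, by omega,
            fun hks => hno _ (by omega) hks _ (hm 1 (by omega) (by omega)), fun _ => o1⟩
        · exact ⟨by omega, by omega,
            fun hks => hno _ (by omega) hks _ (hm 1 (by omega) (by omega)),
            fun _ => hout _ (by omega) (by omega) _ (hm 1 (by omega) (by omega))⟩)
      rw [Finset.card_eq_three.2 ⟨1, i + 1, i + 2, by omega, by omega, by omega, rfl⟩] at this
      omega
    refine h.not_links 0 [(p + 1, i), (s + 4, s + 4), (s + 1, s + 1), (1, p), (q, s)]
      ⟨h.zero_out _ (by omega) (by omega), hi4, h41, h11, h.jump, h.back⟩ ?_ ?_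
    · simp only [Fits, Avoids, or_true, and_true, true_and]; omega
    · simp only [blocksLength]; omega
  exact key (q - i) i hi hiq (by omega)

theorem not_in_of_lt (h : Quad B s a p q) {i : ℕ} (hi : p < i) (hiq : i < q) :
    ¬ Enters B s 4 i := by
  have h1 := h.one_le
  have h4 := h.le_last
  rintro ⟨x, hx, hxi⟩
  have hx1 := hx.1
  have hx2 := hx.2
  refine h.rev.not_out_of_lt (i := s + 1 - i) (by omega) (by omega)
    ⟨2 * s + 5 - x, ⟨by omega, by omega⟩, ?_⟩
  beta_reduce
  rw [Cfg.mirror_of_lt (by omega), Cfg.mirror_of_le (by omega) (by omega)]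
  convert hxi using 1 <;> omega

theorem length_le (h : Quad B s a p q) : q ≤ p + 3 := by
  have h1 := h.one_le
  have h2 := h.lt_turn
  have h3 := h.turn_lt
  have h4 := h.le_last
  have hx : s + 1 ∈ Set.Ioc s (s + 4) := ⟨by omega, by omega⟩
  have hd := h.le_degOn_Icc hx
  have hin : ∀ k, p < k → k < q → ¬ B (s + 1) k := fun k hk hkq hb =>
    h.not_in_of_lt hk hkq ⟨_, hx, hb⟩
  have hout : ∀ k, p < k → k < q → ¬ B k (s + 1) := fun k hk hkq hb =>
    h.not_out_of_lt hk hkq ⟨_, hx, hb⟩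
  by_cases hpx : B p (s + 1)
  · have := h.degOn_Icc_le hx (Finset.Icc (p + 2) q) (by
      intro k hk
      rw [Finset.mem_Icc] at hk
      exact ⟨by omega, by omega, fun hks => h.not_forward (by omega) hks hx .refl hpx,
        fun _ => hout _ (by omega) (by omega)⟩)
    rw [Nat.card_Icc] at this
    omega
  · have := h.degOn_Icc_le hx (Finset.Icc (p + 1) (q - 1)) (by
      intro k hk
      rw [Finset.mem_Icc] at hk
      refine ⟨by omega, by omega, fun _ => hin k (by omega) (by omega), fun _ => ?_⟩
      rcases Nat.eq_or_lt_of_le hk.1 with rfl | hlt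
      · simpa using hpx
      · exact hout _ (by omega) (by omega))
    rw [Nat.card_Icc] at this
    omega

protected theorem false (h : Quad B s a p q) : False := by
  have h1 := h.one_le
  have h2 := h.lt_turn
  have h3 := h.turn_lt
  have h4 := h.le_last
  have hlen := h.length_le
  have hd := h.degree_le a (by omega) (by omega)
  rw [Cfg.degree_split, degOn_eq_zero (S := Finset.Ioc s (s + 4)) fun x hx => by
    rw [Finset.mem_Ioc] at hx
    exact ⟨fun hb => h.not_out_of_lt h2 h3 ⟨x, hx, hb⟩,
      fun hb => h.not_in_of_lt h2 h3 ⟨x, hx, hb⟩⟩] at hd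
  have hsplit : Finset.Icc 1 s =
      (Finset.Icc 1 p ∪ Finset.Icc q s) ∪ ({a} ∪ (Finset.Ioo p q).erase a) := by
    ext k; simp; omega
  have hJ := degOn_le_two_mul (A := B) a ((Finset.Ioo p q).erase a)
  rw [Finset.card_erase_of_mem (by simp; omega), Nat.card_Ioo] at hJ
  have ha : degOn B a {a} = 0 := by simp [degOn, arcs_self h.irrefl]
  have h0 := arcs_le_two (A := B) a 0
  rw [hsplit, degOn_union, degOn_union, degOn_union (by simp), ha] at hd
  rotate_left
  · rw [Finset.disjoint_left]; intro k; simp; omega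
  · rw [Finset.disjoint_left]; intro k; simp; omega
  rcases Nat.lt_or_ge (degOn B a (Finset.Icc 1 p)) (p + 2) with hlt | hge
  · obtain ⟨i, hqi, his, hia, hai⟩ := exists_insertion_Icc (B := B) (v := a) (a := q) (b := s)
      (by omega)
    refine h.not_links 0 [(a, a), (i + 1, s), (s + 1, s + 1), (s + 2, s + 2), (s + 3, s + 3),
      (s + 4, s + 4), (1, p), (q, i)]
      ⟨h.zero_out a (by omega) le_rfl, hai, h.arc_one, h.arc_two, h.arc_three, h.arc_four,
        h.arc_last, h.jump, h.zero_in i (by omega) (by omega)⟩ ?_ ?_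
    · simp only [Fits, Avoids, or_true, and_true, true_and]; omega
    · simp only [blocksLength]; omega
  · obtain ⟨i, h1i, hip, hia, hai⟩ := exists_insertion_Icc (B := B) (v := a) (a := 1) (b := p)
      (by omega)
    refine h.not_links 0 [(i + 1, p), (q, s), (s + 1, s + 1), (s + 2, s + 2), (s + 3, s + 3),
      (s + 4, s + 4), (1, i), (a, a)]
      ⟨h.zero_out _ (by omega) (by omega), h.jump, h.arc_one, h.arc_two, h.arc_three,
        h.arc_four, h.arc_last, hia, h.zero_in a le_rfl (by omega)⟩ ?_ ?_
    · simp only [Fits, Avoids, or_true, and_true, true_and]; omega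
    · simp only [blocksLength]; omega

end Quad

theorem Cfg.false_of_four_le {B : ℕ → ℕ → Prop} {s r : ℕ} (h : Cfg B s r) (hr : 4 ≤ r)
    (hn : 9 ≤ s + r + 1) : False := by
  obtain ⟨K, hK, hKU⟩ := h.exists_spanning_cycle (by omega)
  obtain ⟨rfl, C, a, hC, h1, h2, h3, h4, h5, ha, has, hz⟩ := h.exists_skip_four hr hK hKU
  obtain ⟨j, hj, hjs, hj1, hj0⟩ := hC.exists_zero_out (by omega) 1 le_rfl (by omega)
  obtain ⟨l, hl, hls, hl1, hl0⟩ := hC.exists_zero_in (by omega) s (by omega) le_rfl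
  have hja := (hz j hj hjs).1.1 hj0
  have hal := (hz l hl hls).2.1 hl0
  obtain ⟨p, q, hp, hpa, haq, hqs, hpq⟩ := hC.exists_jump (k := a) (by omega) (by omega)
    (Or.inl fun i hi hia hi0 => by
      have := (hz i hi (by omega)).2.1 hi0
      omega)
  exact Quad.false (a := a) (p := p) (q := q)
    { hC with
      arc_one := h1
      arc_two := h2
      arc_three := h3
      arc_four := h4
      arc_last := h5
      zero_out := fun k hk hka => (hz k hk (by omega)).1.2 hka
      zero_in := fun k hak hks => (hz k (by omega) hks).2.2 hak
      one_le := hp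
      lt_turn := hpa
      turn_lt := haq
      le_last := hqs
      jump := hpq }

theorem Base.exists_closedWalk_zero {B : ℕ → ℕ → Prop} {n m : ℕ} (h : Base B n m) (hn : 3 ≤ n) :
    ∃ L, ClosedWalk B L ∧ (∀ i ∈ L, i < n) ∧ 0 ∈ L := by
  obtain ⟨u, v, -, hu, hv, -, hv', huv⟩ := (h.reach 2 0 1 (by omega) (by omega) (by omega)
    (by omega) (by omega)).exists_exit (X := {0}) rfl (by simp)
  obtain rfl : u = 0 := hu
  have hv0 : v ≠ 0 := hv
  obtain ⟨k, hk, hk0, hkv⟩ : ∃ k < n, k ≠ 0 ∧ k ≠ v := by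
    by_cases hv1 : v = 1
    · exact ⟨2, by omega, by omega, by omega⟩
    · exact ⟨1, by omega, by omega, by omega⟩
  obtain ⟨L, hL, hnd, hmem⟩ := (h.reach k v 0 hk hv'.1 (by omega) (by omega)
    (by omega)).exists_walk ⟨hv'.1, by omega⟩
  exact ⟨L, ⟨hnd, v, 0, hL, huv⟩, fun i hi => (hmem i hi).1, hL.end_mem⟩

theorem Base.exists_longest {B : ℕ → ℕ → Prop} {n m : ℕ} (h : Base B n m) (hn : 3 ≤ n) :
    ∃ L, ClosedWalk B L ∧ (∀ i ∈ L, i < n) ∧ 0 ∈ L ∧ Base B n L.length := by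
  let S : Set ℕ := {k | ∃ L, ClosedWalk B L ∧ (∀ i ∈ L, i < n) ∧ 0 ∈ L ∧ L.length = k}
  have hbdd : BddAbove S := ⟨m, by
    rintro _ ⟨L, h1, h2, h3, rfl⟩
    exact h.longest L h1 h2 h3⟩
  have hne : S.Nonempty := by
    obtain ⟨L, h1, h2, h3⟩ := h.exists_closedWalk_zero hn
    exact ⟨_, L, h1, h2, h3, rfl⟩
  obtain ⟨L, h1, h2, h3, h4⟩ := Nat.sSup_mem hne hbdd
  refine ⟨L, h1, h2, h3, h.irrefl, h.degree_le, h.degree_zero, h.reach, fun K k1 k2 k3 => ?_⟩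
  rw [h4]
  exact le_csSup hbdd ⟨K, k1, k2, k3, rfl⟩

theorem Base.exists_spanning_cycle {B : ℕ → ℕ → Prop} {n m : ℕ} (h : Base B n m) (hn : 9 ≤ n) :
    ∃ L, ClosedWalk B L ∧ (∀ i ∈ L, i < n) ∧ L.length = n := by
  obtain ⟨L, hL, hLn, hL0, hb⟩ := h.exists_longest (by omega)
  refine ⟨L, hL, hLn, ?_⟩
  by_contra hne
  obtain ⟨L', e, hperm, hw, he⟩ := hL.exists_rotation hL0
  obtain ⟨P, rfl⟩ : ∃ P, L' = 0 :: P := by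
    cases hw
    · exact ⟨[], rfl⟩
    · exact ⟨_, rfl⟩
  rw [← hperm.length_eq] at hb hne
  have hnd : (0 :: P).Nodup := hperm.nodup_iff.2 hL.1
  have hlt : ∀ v ∈ 0 :: P, v < n := fun v hv => hLn v (hperm.subset hv)
  let Q := (Finset.range n \ (0 :: P).toFinset).toList
  have hQ : ∀ v, v ∈ Q ↔ v < n ∧ v ∉ 0 :: P := fun v => by
    rw [Finset.mem_toList, Finset.mem_sdiff, Finset.mem_range, List.mem_toFinset]
  have hlen : (0 :: P).length + Q.length = n := by
    have := Finset.card_sdiff_add_card_eq_card (s := (0 :: P).toFinset) (t := Finset.range n)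
      fun v hv => by simpa using hlt v (List.mem_toFinset.1 hv)
    rw [List.toFinset_card_of_nodup hnd, Finset.card_range] at this
    rw [Finset.length_toList]
    omega
  rw [List.length_cons] at hb hlen hne
  have hM : (P ++ Q).Nodup := by
    rw [List.nodup_append]
    refine ⟨(List.nodup_cons.1 hnd).2, Finset.nodup_toList _, ?_⟩
    rintro v hv w hw rfl
    exact ((hQ v).1 hw).2 (List.mem_cons_of_mem 0 hv)
  have hmem : ∀ v ∈ P ++ Q, 1 ≤ v ∧ v < n := by
    intro v hv
    have hv0 : v ≠ 0 := by
      rintro rfl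
      rcases List.mem_append.1 hv with h0 | h0
      · exact (List.nodup_cons.1 hnd).1 h0
      · exact ((hQ 0).1 h0).2 (by simp)
    rcases List.mem_append.1 hv with hv | hv
    · exact ⟨by omega, hlt v (List.mem_cons_of_mem 0 hv)⟩
    · exact ⟨by omega, ((hQ v).1 hv).1⟩
  have hnum : ∀ i ≤ P.length, _root_.numbering (P ++ Q) i = (0 :: P).getD i 0 := by
    intro i hi
    rw [_root_.numbering, ← List.cons_append, List.getD_append]
    simp; omega
  have hB := hb.numbering hM hmem (by rw [List.length_append]; omega)
  rw [show n = P.length + Q.length + 1 by omega] at hB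
  have hcfg : Cfg (fun i j => B (_root_.numbering (P ++ Q) i) (_root_.numbering (P ++ Q) j))
      P.length Q.length := by
    refine ⟨hB, fun i hi => ?_, ?_⟩
    · rw [hnum i hi.le, hnum (i + 1) hi]
      exact hw.getD_arc 0 i (by simp; omega)
    · rw [hnum _ le_rfl, numbering_zero]
      have := hw.getD_last 0
      rw [List.length_cons, Nat.add_sub_cancel] at this
      rwa [this]
  have hr := hcfg.two_le (by omega)
  by_cases h2 : Q.length = 2
  · rw [h2] at hcfg
    exact hcfg.false_of_two
  by_cases h3 : Q.length = 3
  · rw [h3] at hcfg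
    exact hcfg.false_of_three (by omega)
  exact hcfg.false_of_four_le (by omega) (by omega)

theorem ClosedWalk.isHamiltonian {V : Type*} [Fintype V] {A : V → V → Prop} {L : List V}
    (h : ClosedWalk A L) (hlen : L.length = Fintype.card V) (hV : 2 ≤ Fintype.card V) :
    IsHamiltonian A := by
  obtain ⟨hnd, x, y, hw, hyx⟩ := h
  have hinj : Function.Injective fun i : Fin (Fintype.card V) => L.getD i x := by
    intro i j hij
    have hi := i.2
    have hj := j.2
    beta_reduce at hij
    rw [List.getD_eq_getElem _ _ (by omega), List.getD_eq_getElem _ _ (by omega)] at hij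
    exact Fin.ext ((List.Nodup.getElem_inj_iff hnd).1 hij)
  refine ⟨_, ⟨hV, hinj, fun i => ?_⟩,
    ((Fintype.bijective_iff_injective_and_card _).2 ⟨hinj, by simp⟩).2⟩
  have hi := i.2
  rcases Nat.lt_or_ge (i + 1) (Fintype.card V) with hlt | hge
  · simp only [Nat.mod_eq_of_lt hlt]
    exact hw.getD_arc x i (by omega)
  · have hlast := hw.getD_last x
    rw [show L.length - 1 = i by omega] at hlast
    simp only [show (i : ℕ) + 1 = Fintype.card V by omega, Nat.mod_self]
    rw [hlast, hw.getD_zero]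
    exact hyx

theorem exists_enumeration {V : Type*} [Fintype V] (z : V) : ∃ f : ℕ → V, f 0 = z ∧
    Set.BijOn f (Finset.range (Fintype.card V)) Set.univ := by
  classical
  have hpos : 0 < Fintype.card V := Fintype.card_pos_iff.2 ⟨z⟩
  let e := (Fintype.equivFin V).symm
  let g := (Equiv.swap ⟨0, hpos⟩ (e.symm z)).trans e
  refine ⟨fun k => if hk : k < Fintype.card V then g ⟨k, hk⟩ else z, by simp [hpos, g], ?_, ?_, ?_⟩
  · exact fun _ _ => trivial
  · intro i hi j hj hij
    simp only [Finset.coe_range, Set.mem_Iio] at hi hj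
    simpa [hi, hj] using hij
  · intro v _
    obtain ⟨k, rfl⟩ := g.surjective v
    exact ⟨k, by simp, by simp⟩

theorem Base.of_isKStrong {V : Type*} [Fintype V] {A : V → V → Prop} (hirr : ∀ v, ¬ A v v)
    (hA : IsKStrong A 2) {f : ℕ → V}
    (hf : Set.BijOn f (Finset.range (Fintype.card V)) Set.univ)
    (h0 : Fintype.card V ≤ degree A (f 0) + 4)
    (hdeg : ∀ v, v ≠ f 0 → Fintype.card V ≤ degree A v) :
    Base (fun i j => A (f i) (f j)) (Fintype.card V) (Fintype.card V) := by
  classical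
  have hpos : 0 < Fintype.card V := Fintype.card_pos_iff.2 ⟨f 0⟩
  have hd : ∀ v, degOn (fun i j => A (f i) (f j)) v (Finset.range (Fintype.card V)) =
      degree A (f v) := by
    intro v
    rw [degree_eq_degOn, ← degOn_image f v _ hf.injOn]
    congr 1
    rw [← Finset.coe_inj, Finset.coe_image, hf.image_eq, Finset.coe_univ]
  have hinj : ∀ i < Fintype.card V, ∀ j < Fintype.card V, f i = f j → i = j :=
    fun i hi j hj hij => hf.injOn (by simpa using hi) (by simpa using hj) hij
  refine ⟨fun i => hirr _, fun v h1 hv => ?_, ?_, fun k x y hk hx hy hxk hyk => ?_,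
    fun L hL hLn _ => ?_⟩
  · rw [hd]
    exact hdeg _ fun he => by have := hinj v hv 0 hpos he; omega
  · rw [hd]
    exact h0
  · have hr := hA.2 {f k} (by simp) (f x) (fun he => hxk (hinj x hx k hk he)) (f y)
      (fun he => hyk (hinj y hy k hk he))
    generalize hX : f x = X at hr
    induction hr using Relation.ReflTransGen.head_induction_on generalizing x with
    | refl =>
      obtain rfl := hinj x hx y hy hX
      exact .refl
    | @head a c hac _ ih =>
      obtain ⟨w, hw, rfl⟩ := hf.surjOn (Set.mem_univ c)
      have hw' : w < Fintype.card V := by simpa using hw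
      have hwk : w ≠ k := by
        rintro rfl
        exact hac.2.1 rfl
      subst hX
      exact .head ⟨⟨hx, hxk⟩, ⟨hw', hwk⟩, hac.2.2⟩ (ih w hw' hwk rfl)
  · have := Finset.card_le_card (s := L.toFinset) (t := Finset.range (Fintype.card V))
      fun v hv => by simpa using hLn v (List.mem_toFinset.1 hv)
    rwa [List.toFinset_card_of_nodup hL.1, Finset.card_range] at this

/-- Let `D` be a 2-strong digraph of order `n ≥ 9` with minimum degree at least `n - 4`.
If `n - 1` vertices of `D` have degree at least `n`, then `D` is Hamiltonian. -/
theorem statement5 {V : Type*} [Fintype V] [DecidableEq V] (A : V → V → Prop)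
    (hirr : Irreflexive A)
    (n : ℕ) (hn9 : 9 ≤ n) (hcard : Fintype.card V = n)
    (h2strong : IsKStrong A 2)
    (hmindeg : ∀ v : V, n - 4 ≤ degree A v)
    (z : V)
    (hdeg : ∀ v : V, v ≠ z → n ≤ degree A v) :
    IsHamiltonian A := by
  subst hcard
  obtain ⟨f, rfl, hf⟩ := exists_enumeration z
  have hB := Base.of_isKStrong hirr h2strong hf (by have := hmindeg (f 0); omega) hdeg
  obtain ⟨L, hL, hLn, hlen⟩ := hB.exists_spanning_cycle hn9
  exact (hL.map (A := A) (f := f) (fun _ _ h => h) fun i hi j hj hij =>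
    hf.injOn (by simpa using hLn i hi) (by simpa using hLn j hj) hij).isHamiltonian
      (by simpa using hlen) (by omega)
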